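/- arXiv:0811.3057 — 5 statements merged into one kernel-verified Lean document; each statement's English description precedes it below -/
import Mathlib

section
/- Let d, D be integers with d ≥ 1, D ≥ 1, and let k ≥ D + 2 be an integer. Let p be a real polynomial of degree exactly D with leading coefficient p_D, let θ, α ∈ ℝ^d, and set x_j := (p(j)·θ + α) mod 1 for j ∈ {1, …, k}. If x_j ∈ BOX_D for every j ∈ {1, …, k}, then there exists a vector polynomial P(t) = Σ_{i=0}^D P_i t^i with P_i ∈ ℝ^d such that P(j) = x_j for all j ∈ {1, …, k} and D!·P_D = (D!·p_D·θ) mod 1. -/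
/-- `mod1 x` is the unique representative of `x` modulo `1` lying in `[-1/2, 1/2)`. -/
noncomputable def mod1 (x : ℝ) : ℝ := Int.fract (x + 1 / 2) - 1 / 2

open Finset in
/-- The `n`-th finite difference of a real sequence, written as an explicit sum. -/
noncomputable def finDiff (n : ℕ) (f : ℕ → ℝ) (y : ℕ) : ℝ :=
  ∑ k ∈ range (n + 1), (((-1 : ℤ) ^ (n - k) * n.choose k : ℤ) : ℝ) * f (y + k)

theorem finDiff_sub (n : ℕ) (f g : ℕ → ℝ) (y : ℕ) :
    finDiff n (fun j => f j - g j) y = finDiff n f y - finDiff n g y := by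
  simp only [finDiff, mul_sub, Finset.sum_sub_distrib]

theorem finDiff_poly (n : ℕ) (Q : Polynomial ℝ) (hQ : Q.natDegree ≤ n) (y : ℕ) :
    finDiff n (fun j => Q.eval (j : ℝ)) y = n.factorial * Q.coeff n := by
  have key : finDiff n (fun j => Q.eval (j : ℝ)) y = (fwdDiff (1 : ℝ))^[n] Q.eval (y : ℝ) := by
    rw [fwdDiff_iter_eq_sum_shift]
    simp [finDiff]
  rw [key]
  rcases hQ.lt_or_eq with h | h
  · rw [Polynomial.fwdDiff_iter_eq_zero_of_degree_lt h, Polynomial.coeff_eq_zero_of_natDegree_lt h]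
    simp
  · subst h
    rw [Polynomial.fwdDiff_iter_degree_eq_factorial]
    simp [mul_comm]

theorem finDiff_int (n : ℕ) (f : ℕ → ℤ) (y : ℕ) :
    ∃ m : ℤ, finDiff n (fun j => (f j : ℝ)) y = m :=
  ⟨∑ k ∈ Finset.range (n + 1), ((-1 : ℤ) ^ (n - k) * n.choose k : ℤ) * f (y + k), by
    simp [finDiff]⟩

theorem finDiff_bound (n : ℕ) (f : ℕ → ℝ) (y : ℕ) (c : ℝ) (h : ∀ k ≤ n, |f (y + k)| < c) :
    |finDiff n f y| < 2 ^ n * c := by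
  have h2 : (2 : ℝ) ^ n * c = ∑ k ∈ Finset.range (n + 1), (n.choose k : ℝ) * c := by
    rw [← Finset.sum_mul]
    congr 1
    exact_mod_cast (Nat.sum_range_choose n).symm
  rw [h2]
  refine (Finset.abs_sum_le_sum_abs _ _).trans_lt ?_
  refine Finset.sum_lt_sum_of_nonempty ⟨0, by simp⟩ ?_
  intro k hk
  have hk' : k ≤ n := by simpa [Nat.lt_succ_iff] using hk
  have hc : (0 : ℝ) < n.choose k := by exact_mod_cast Nat.choose_pos hk'
  have : |(((-1 : ℤ) ^ (n - k) * n.choose k : ℤ) : ℝ)| = n.choose k := by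
    push_cast
    rw [abs_mul, abs_pow]
    simp
  rw [abs_mul, this]
  exact mul_lt_mul_of_pos_left (h k hk') hc

theorem mod1_eq (t s : ℝ) (m : ℤ) (h : t - s = m) (hs : |s| < 1 / 2) : mod1 t = s := by
  obtain ⟨h1, h2⟩ := abs_lt.mp hs
  have : t + 1 / 2 = (s + 1 / 2) + m := by linarith
  rw [mod1, this, Int.fract_add_intCast, Int.fract_eq_self.mpr ⟨by linarith, by linarith⟩]
  ring

theorem finDiff_top (n : ℕ) (f : ℕ → ℝ) (y : ℕ) (h : ∀ k < n, f (y + k) = 0) :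
    finDiff n f y = f (y + n) := by
  rw [finDiff, Finset.sum_range_succ, Finset.sum_eq_zero]
  · simp
  · intro k hk
    rw [h k (Finset.mem_range.mp hk), mul_zero]

theorem one_dim (D k : ℕ) (hk : D + 2 ≤ k)
    (q : Polynomial ℝ) (hq : q.natDegree ≤ D) (x : ℕ → ℝ)
    (hx : ∀ j : ℕ, x j = mod1 (q.eval (j : ℝ)))
    (hbox : ∀ j ∈ Finset.Icc 1 k, |x j| < (2 : ℝ) ^ (-(D : ℤ) - 1)) :
    ∃ Q : Polynomial ℝ, Q.natDegree ≤ D ∧ (∀ j ∈ Finset.Icc 1 k, Q.eval (j : ℝ) = x j) ∧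
      (D.factorial : ℝ) * Q.coeff D = mod1 (D.factorial * q.coeff D) := by
  have hpow : (2 : ℝ) ^ (-(D : ℤ) - 1) = ((2 : ℝ) ^ (D + 1))⁻¹ := by
    rw [← zpow_natCast, ← zpow_neg]
    congr 1
    push_cast
    ring
  rw [hpow] at hbox
  have hxN : ∀ j : ℕ, x j = q.eval (j : ℝ) - ((⌊q.eval (j : ℝ) + 1 / 2⌋ : ℤ) : ℝ) := by
    intro j
    rw [hx, mod1, Int.fract]
    ring
  have hxint : ∀ n y, ∃ m : ℤ, finDiff n (fun j => q.eval (j : ℝ)) y - finDiff n x y = m := by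
    intro n y
    obtain ⟨m, hm⟩ := finDiff_int n (fun j => ⌊q.eval (j : ℝ) + 1 / 2⌋) y
    refine ⟨m, ?_⟩
    rw [← hm, ← finDiff_sub]
    congr 1
    funext j
    rw [hxN]
    ring
  have hzero : ∀ y, 1 ≤ y → y + (D + 1) ≤ k → finDiff (D + 1) x y = 0 := by
    intro y hy hyk
    obtain ⟨m, hm⟩ := hxint (D + 1) y
    rw [finDiff_poly _ _ (by omega), Polynomial.coeff_eq_zero_of_natDegree_lt (by omega)] at hm
    have hb := finDiff_bound (D + 1) x y _ (fun i hi => hbox (y + i) (by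
      rw [Finset.mem_Icc]; omega))
    rw [mul_inv_cancel₀ (by positivity)] at hb
    have he : finDiff (D + 1) x y = ((-m : ℤ) : ℝ) := by push_cast; linarith
    rw [he] at hb ⊢
    have : |(-m : ℤ)| < 1 := by exact_mod_cast hb
    rw [Int.abs_lt_one_iff.mp this]
    simp
  have hinj : Set.InjOn (fun j : ℕ => (j : ℝ)) (Finset.Icc 1 (D + 1) : Finset ℕ) :=
    fun a _ b _ h => Nat.cast_injective (R := ℝ) h
  set Q := Lagrange.interpolate (Finset.Icc 1 (D + 1)) (fun j : ℕ => (j : ℝ)) x with hQ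
  have hQdeg : Q.natDegree ≤ D := by
    have := Lagrange.degree_interpolate_lt x hinj
    rw [Nat.card_Icc] at this
    have h2 := Polynomial.natDegree_le_of_degree_le this.le
    by_cases h0 : Q = 0
    · rw [h0]; simp
    · have := (Polynomial.natDegree_lt_iff_degree_lt h0).mpr this
      omega
  have hval : ∀ j ≤ k, 1 ≤ j → Q.eval (j : ℝ) - x j = 0 := by
    intro j
    induction j using Nat.strong_induction_on with
    | _ j ih =>
      intro hjk hj
      by_cases hjD : j ≤ D + 1
      · have := Lagrange.eval_interpolate_at_node x hinj (Finset.mem_Icc.mpr ⟨hj, hjD⟩)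
        rw [← hQ] at this
        exact sub_eq_zero.mpr this
      · obtain ⟨y, rfl⟩ : ∃ y, j = y + (D + 1) := ⟨j - (D + 1), by omega⟩
        have ht := finDiff_top (D + 1) (fun j => Q.eval (j : ℝ) - x j) y
          (fun i hi => ih (y + i) (by omega) (by omega) (by omega))
        rw [finDiff_sub, hzero y (by omega) hjk, finDiff_poly _ _ (by omega),
          Polynomial.coeff_eq_zero_of_natDegree_lt (by omega)] at ht
        simpa using ht.symm
  refine ⟨Q, hQdeg, fun j hj => ?_, ?_⟩
  · rw [Finset.mem_Icc] at hj
    exact sub_eq_zero.mp (hval j hj.2 hj.1)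
  · have ht : finDiff D (fun j => Q.eval (j : ℝ) - x j) 1 = 0 := by
      rw [finDiff_top _ _ _ (fun i hi => hval (1 + i) (by omega) (by omega))]
      exact hval _ (by omega) (by omega)
    rw [finDiff_sub, finDiff_poly _ _ hQdeg] at ht
    obtain ⟨m, hm⟩ := hxint D 1
    rw [finDiff_poly _ _ hq] at hm
    have hb := finDiff_bound D x 1 _ (fun i hi => hbox (1 + i) (by
      rw [Finset.mem_Icc]; omega))
    have he : (2 : ℝ) ^ D * ((2 : ℝ) ^ (D + 1))⁻¹ = 1 / 2 := by
      rw [pow_succ]; field_simp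
    rw [he] at hb
    rw [mod1_eq _ _ m hm hb]
    linarith

theorem stmt5 (d D k : ℕ) (hd : 1 ≤ d) (hD : 1 ≤ D) (hk : D + 2 ≤ k)
    (p : Polynomial ℝ) (hp : p.natDegree = D) (θ α : Fin d → ℝ)
    (x : ℕ → Fin d → ℝ)
    (hx : ∀ j, ∀ i, x j i = mod1 (p.eval (j : ℝ) * θ i + α i))
    (hbox : ∀ j ∈ Finset.Icc 1 k, ∀ i, |x j i| < (2 : ℝ) ^ (-(D : ℤ) - 1)) :
    ∃ P : Fin (D + 1) → Fin d → ℝ,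
      (∀ j ∈ Finset.Icc 1 k, ∀ i,
        (∑ m : Fin (D + 1), (j : ℝ) ^ (m : ℕ) * P m i) = x j i) ∧
      (∀ i, (D.factorial : ℝ) * P (Fin.last D) i =
        mod1 ((D.factorial : ℝ) * p.leadingCoeff * θ i)) := by
  have hone : ∀ i : Fin d, ∃ Q : Polynomial ℝ, Q.natDegree ≤ D ∧
      (∀ j ∈ Finset.Icc 1 k, Q.eval (j : ℝ) = x j i) ∧
      (D.factorial : ℝ) * Q.coeff D = mod1 (D.factorial * p.leadingCoeff * θ i) := by
    intro i
    have hdeg : (p * Polynomial.C (θ i) + Polynomial.C (α i)).natDegree ≤ D := by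
      rw [Polynomial.natDegree_add_C, ← hp]
      exact Polynomial.natDegree_mul_C_le _ _
    obtain ⟨Q, h1, h2, h3⟩ := one_dim D k hk (p * Polynomial.C (θ i) + Polynomial.C (α i))
      hdeg (fun j => x j i) (fun j => by simp [hx]) (fun j hj => hbox j hj i)
    refine ⟨Q, h1, h2, ?_⟩
    rw [h3, Polynomial.coeff_add, Polynomial.coeff_mul_C, Polynomial.coeff_C_of_ne_zero (by omega),
      Polynomial.leadingCoeff, hp, add_zero, mul_assoc]
  choose Q h1 h2 h3 using hone
  refine ⟨fun m i => (Q i).coeff m, fun j hj i => ?_, fun i => ?_⟩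
  · rw [← h2 i j hj, Polynomial.eval_eq_sum_range' (Nat.lt_succ_of_le (h1 i)),
      ← Fin.sum_univ_eq_sum_range (fun m => (Q i).coeff m * (j : ℝ) ^ m)]
    exact Finset.sum_congr rfl fun m _ => mul_comm _ _
  · simpa using h3 i
end

section
/- There exists an integer d_0 such that for all integers d ≥ d_0 and D ≥ 1, all integers n ≥ 1, every nonempty subset A ⊆ {1, …, n}, and every real δ with 0 < 2δ ≤ 1/n, there exists a real number z such that the d-dimensional Lebesgue measure of the set {x ∈ BOX_D : there exists a ∈ A with |(‖x‖₂² − μ_D)/σ_D − (z − (a−1)/n)| < δ} is at least (2/5) · 2^{−dD} · |A| · δ. -/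
open MeasureTheory
open ProbabilityTheory

lemma integral_le_lint {Ω : Type*} [MeasurableSpace Ω] (P : Measure Ω) (g : Ω → ℝ) (hg : Integrable g P) :
    ENNReal.ofReal (∫ x, g x ∂P) ≤ ∫⁻ x, ENNReal.ofReal (g x) ∂P := by
  have h := ofReal_integral_eq_lintegral_ofReal (μ := P) (f := fun x => max (g x) 0) hg.pos_part
    (Filter.Eventually.of_forall fun x => le_max_right _ _)
  have h2 : ∀ x, ENNReal.ofReal (max (g x) 0) = ENNReal.ofReal (g x) := by
    intro x; simp [ENNReal.ofReal_max]
  simp only [h2] at h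
  rw [← h]
  exact ENNReal.ofReal_le_ofReal (integral_mono hg hg.pos_part fun x => le_max_left _ _)

lemma parab_int (c u v : ℝ) : ∫ z in u..v, (1 - (z - c)^2/4) = (v-u) - ((v-c)^3 - (u-c)^3)/12 := by
  rw [intervalIntegral.integral_sub (Continuous.intervalIntegrable (by fun_prop) _ _) (Continuous.intervalIntegrable (by fun_prop) _ _),
    intervalIntegral.integral_div, intervalIntegral.integral_comp_sub_right (fun z => z^2)]
  simp [integral_pow]
  ring

lemma one_term {Ω : Type*} [MeasurableSpace Ω] (P : Measure Ω) [IsProbabilityMeasure P] (X : Ω → ℝ)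
    (hX : Measurable X) (h2 : MemLp X 2 P) (hm : ∫ x, X x ∂P = 0) (hv : ∫ x, X x ^ 2 ∂P = 1)
    (s c δ : ℝ) (hδ : 0 < δ) (h : (s - c)^2 + δ^2/3 ≤ 1/4) :
    ENNReal.ofReal (11/8*δ) ≤
      ∫⁻ z in Set.Ioo (c-2) (c+2), ENNReal.ofReal (1 - (z - c)^2/4) * P {x | |X x - (z - s)| < δ} := by
  have hX1 : Integrable X P := h2.integrable (by norm_num)
  have hX2 : Integrable (fun x => X x ^ 2) P := h2.integrable_sq
  set G : ℝ → Ω → ENNReal := fun z x => {p : ℝ × Ω | |X p.2 - (p.1 - s)| < δ}.indicator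
    (fun p => ENNReal.ofReal (1 - (p.1 - c)^2/4)) (z, x) with hG
  have hS : MeasurableSet {p : ℝ × Ω | |X p.2 - (p.1 - s)| < δ} := by
    apply measurableSet_lt _ measurable_const
    exact ((hX.comp measurable_snd).sub (measurable_fst.sub_const s)).abs
  have hGm : Measurable (Function.uncurry G) := by
    apply Measurable.indicator _ hS
    fun_prop
  have e1 : ∀ z, ENNReal.ofReal (1 - (z - c)^2/4) * P {x | |X x - (z - s)| < δ} = ∫⁻ x, G z x ∂P := by
    intro z
    have : G z = {x | |X x - (z - s)| < δ}.indicator (fun _ => ENNReal.ofReal (1 - (z - c)^2/4)) := by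
      ext x; simp [hG, Set.indicator]
    rw [this, lintegral_indicator_const]
    exact measurableSet_lt ((hX.sub_const _).abs) measurable_const
  simp only [e1]
  rw [lintegral_lintegral_swap hGm.aemeasurable]
  have e2 : ∀ x, ENNReal.ofReal (2*δ*(1 - ((X x + (s - c))^2 + δ^2/3)/4)) ≤
      ∫⁻ z in Set.Ioo (c-2) (c+2), G z x := by
    intro x
    have hle : X x + s - δ ≤ X x + s + δ := by linarith
    have : ∫⁻ z in Set.Ioo (c-2) (c+2), G z x = ∫⁻ z in Set.Ioc (X x + s - δ) (X x + s + δ), ENNReal.ofReal (1 - (z - c)^2/4) := by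
      rw [← restrict_Ioo_eq_restrict_Ioc, ← lintegral_indicator measurableSet_Ioo, ← lintegral_indicator measurableSet_Ioo]
      congr 1; ext z
      have hh : |X x - (z - s)| < δ ↔ z ∈ Set.Ioo (X x + s - δ) (X x + s + δ) := by
        rw [abs_lt, Set.mem_Ioo]; constructor <;> rintro ⟨_, _⟩ <;> constructor <;> linarith
      by_cases hz : z ∈ Set.Ioo (c-2) (c+2)
      · rw [Set.indicator_of_mem hz]
        simp only [hG, Set.indicator, Set.mem_ofPred_eq, hh]
      · rw [Set.indicator_of_notMem hz]
        have : ENNReal.ofReal (1 - (z - c)^2/4) = 0 := by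
          rw [ENNReal.ofReal_eq_zero]
          by_contra hc
          push Not at hc
          apply hz
          have := abs_lt_of_sq_lt_sq (a := z - c) (b := 2) (by linarith) (by norm_num)
          rw [abs_lt] at this
          constructor <;> linarith
        simp [Set.indicator, this]
    rw [this]
    refine le_trans (le_of_eq ?_) (integral_le_lint _ _ ?_)
    · rw [← intervalIntegral.integral_of_le hle, parab_int]
      congr 1; ring
    · exact (Continuous.integrableOn_Ioc (by fun_prop))
  refine le_trans ?_ (lintegral_mono e2)
  refine le_trans ?_ (integral_le_lint _ _ ?_)
  · apply ENNReal.ofReal_le_ofReal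
    have : ∀ x, 2*δ*(1 - ((X x + (s - c))^2 + δ^2/3)/4) =
      (2*δ*(1 - ((s-c)^2 + δ^2/3)/4) - δ*(s-c) * X x) - δ/2 * X x ^2 := by intro x; ring
    simp only [this]
    have hi : Integrable (fun x => 2*δ*(1 - ((s-c)^2 + δ^2/3)/4) - δ*(s-c) * X x) P :=
      (integrable_const _).sub (hX1.const_mul _)
    rw [integral_sub hi (hX2.const_mul _),
      integral_sub (integrable_const _) (hX1.const_mul _), integral_const_mul _ X, integral_const_mul (δ/2), hm, hv]
    simp
    nlinarith
  · have : ∀ x, 2*δ*(1 - ((X x + (s - c))^2 + δ^2/3)/4) =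
      (2*δ*(1 - ((s-c)^2 + δ^2/3)/4) - δ*(s-c) * X x) - δ/2 * X x ^2 := by intro x; ring
    simp only [this]
    exact (((integrable_const _).sub (hX1.const_mul _))).sub (hX2.const_mul _)

lemma abstract_stmt {Ω : Type*} [MeasurableSpace Ω] (P : Measure Ω) [IsProbabilityMeasure P] (X : Ω → ℝ)
    (hX : Measurable X) (h2 : MemLp X 2 P) (hm : ∫ x, X x ∂P = 0) (hv : ∫ x, X x ^ 2 ∂P = 1)
    (n : ℕ) (hn : 1 ≤ n) (A : Finset ℕ) (hA : A ⊆ Finset.Icc 1 n) (hne : A.Nonempty)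
    (δ : ℝ) (hδ : 0 < δ) (hδn : 2 * δ ≤ 1 / (n : ℝ)) :
    ∃ z : ℝ, ENNReal.ofReal (2/5 * (A.card : ℝ) * δ) ≤
      P {x | ∃ a ∈ A, |X x - (z - ((a : ℝ) - 1) / (n : ℝ))| < δ} := by
  have hn0 : (1:ℝ) ≤ n := by exact_mod_cast hn
  have hn1 : (0:ℝ) < n := by linarith
  by_contra hcon
  push Not at hcon
  have hms : ∀ z t : ℝ, MeasurableSet {x | |X x - (z - t)| < δ} := fun z t =>
    measurableSet_lt ((hX.sub_const _).abs) measurable_const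
  have hU : ∀ z : ℝ, P {x | ∃ a ∈ A, |X x - (z - ((a : ℝ) - 1) / (n : ℝ))| < δ} =
      ∑ a ∈ A, P {x | |X x - (z - ((a : ℝ) - 1) / (n : ℝ))| < δ} := by
    intro z
    rw [← measure_biUnion_finset]
    · congr 1; ext x; simp
    · intro a ha b hb hab
      refine Set.disjoint_left.2 fun x hx hy => ?_
      simp only [Set.mem_ofPred_eq] at hx hy
      apply hab
      rw [abs_lt] at hx hy
      have e : ((a:ℝ)-1)/n - ((b:ℝ)-1)/n = ((a:ℝ)-b)/n := by ring
      have l1 : ((a:ℝ)-b)/n < 1/n := by linarith [hx.1, hx.2, hy.1, hy.2]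
      have l2 : (-1)/n < ((a:ℝ)-b)/n := by
        have : (-1:ℝ)/n = -(1/n) := by ring
        linarith [hx.1, hx.2, hy.1, hy.2]
      rw [div_lt_div_iff_of_pos_right hn1] at l1 l2
      have l1' : (a:ℝ) < b + 1 := by linarith
      have l2' : (b:ℝ) < a + 1 := by linarith
      have : a < b + 1 := by exact_mod_cast l1'
      have : b < a + 1 := by exact_mod_cast l2'
      omega
    · intro a _; exact hms _ _
  set c : ℝ := 1/2 - 1/(2*n) with hc
  have hterm : ∀ a ∈ A, ENNReal.ofReal (11/8*δ) ≤
      ∫⁻ z in Set.Ioo (c-2) (c+2), ENNReal.ofReal (1 - (z - c)^2/4) *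
        P {x | |X x - (z - ((a : ℝ) - 1) / (n : ℝ))| < δ} := by
    intro a ha
    apply one_term P X hX h2 hm hv _ _ _ hδ
    have := Finset.mem_Icc.1 (hA ha)
    have h1 : (1:ℝ) ≤ a := by exact_mod_cast this.1
    have h2 : (a:ℝ) ≤ n := by exact_mod_cast this.2
    set q : ℝ := 1/(n:ℝ) with hq
    have hq0 : 0 < q := by positivity
    have hq1 : q ≤ 1 := by rw [hq, div_le_one hn1]; exact hn0
    have hs0 : 0 ≤ ((a:ℝ)-1)/n := div_nonneg (by linarith) hn1.le
    have hs1 : ((a:ℝ)-1)/n ≤ 1 - q := by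
      have : 1 - q = ((n:ℝ)-1)/n := by rw [hq]; field_simp
      rw [this]; gcongr
    have hcq : c = 1/2 - q/2 := by rw [hc, hq]; ring
    rw [hcq]
    set s := ((a:ℝ)-1)/n
    have : (s - (1/2 - q/2))^2 ≤ (1/2 - q/2)^2 := by nlinarith
    nlinarith
  have hsum := Finset.sum_le_sum hterm
  have hmeas : ∀ a : ℕ, Measurable fun z : ℝ => P {x | |X x - (z - ((a : ℝ) - 1) / (n : ℝ))| < δ} := by
    intro a
    have hS : MeasurableSet {p : ℝ × Ω | |X p.2 - (p.1 - ((a : ℝ) - 1) / (n : ℝ))| < δ} := by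
      apply measurableSet_lt _ measurable_const
      exact ((hX.comp measurable_snd).sub (measurable_fst.sub_const _)).abs
    exact measurable_measure_prodMk_left hS
  rw [← lintegral_finsetSum] at hsum
  · have hb : (∫⁻ z in Set.Ioo (c-2) (c+2), ∑ a ∈ A, ENNReal.ofReal (1 - (z - c)^2/4) *
        P {x | |X x - (z - ((a : ℝ) - 1) / (n : ℝ))| < δ}) ≤
        ∫⁻ z in Set.Ioo (c-2) (c+2), ENNReal.ofReal (1 - (z - c)^2/4) *
          ENNReal.ofReal (2/5 * (A.card : ℝ) * δ) := by
      apply lintegral_mono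
      intro z
      simp only
      rw [← Finset.mul_sum, ← hU]
      gcongr
      exact (hcon z).le
    have hI : ∫⁻ z in Set.Ioo (c-2) (c+2), ENNReal.ofReal (1 - (z - c)^2/4) = ENNReal.ofReal (8/3) := by
      rw [← ofReal_integral_eq_lintegral_ofReal]
      · rw [← integral_Ioc_eq_integral_Ioo, ← intervalIntegral.integral_of_le (by linarith), parab_int]
        congr 1; ring
      · rw [restrict_Ioo_eq_restrict_Ioc]
        exact (Continuous.integrableOn_Ioc (by fun_prop))
      · filter_upwards [ae_restrict_mem measurableSet_Ioo] with z hz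
        simp only [Pi.zero_apply]
        nlinarith [hz.1, hz.2]
    rw [lintegral_mul_const _ (by fun_prop), hI, ← ENNReal.ofReal_mul (by norm_num)] at hb
    have := hsum.trans hb
    rw [Finset.sum_const, nsmul_eq_mul, ← ENNReal.ofReal_natCast, ← ENNReal.ofReal_mul (by positivity),
      ENNReal.ofReal_le_ofReal_iff (by positivity)] at this
    have hcard : (0:ℝ) < A.card := by exact_mod_cast hne.card_pos
    nlinarith [mul_pos hcard hδ]
  · intro a _
    exact Measurable.mul (by fun_prop) (hmeas a)

noncomputable def unifM (b : ℝ) : Measure ℝ :=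
  (ENNReal.ofReal (2*b))⁻¹ • volume.restrict (Set.Ioo (-b) b)

lemma unifM_prob (b : ℝ) (hb : 0 < b) : IsProbabilityMeasure (unifM b) := by
  constructor
  simp only [unifM, Measure.smul_apply, Measure.restrict_apply_univ, Real.volume_Ioo, smul_eq_mul]
  rw [show b - -b = 2*b by ring]
  exact ENNReal.inv_mul_cancel (by simpa using hb) ENNReal.ofReal_ne_top

lemma unifM_pow (b : ℝ) (hb : 0 < b) (k : ℕ) :
    ∫ x, x ^ k ∂(unifM b) = (2*b)⁻¹ * ((b^(k+1) - (-b)^(k+1))/(k+1)) := by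
  rw [unifM, integral_smul_measure, ← integral_Ioc_eq_integral_Ioo,
    ← intervalIntegral.integral_of_le (by linarith), integral_pow]
  rw [ENNReal.toReal_inv, ENNReal.toReal_ofReal (by positivity), smul_eq_mul]

lemma unifM_memLp (b : ℝ) (hb : 0 < b) : MemLp (fun x : ℝ => x ^ 2) 2 (unifM b) := by
  have := unifM_prob b hb
  refine MemLp.of_bound (by fun_prop) (b^2) ?_
  apply Measure.ae_smul_measure
  filter_upwards [ae_restrict_mem measurableSet_Ioo] with z hz
  rw [Real.norm_eq_abs, abs_of_nonneg (by positivity)]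
  nlinarith [hz.1, hz.2]

lemma unifM_mean (b : ℝ) (hb : 0 < b) : ∫ x, x ^ 2 ∂(unifM b) = b^2/3 := by
  rw [unifM_pow b hb]; field_simp; norm_num; ring

lemma unifM_var (b : ℝ) (hb : 0 < b) : Var[fun x : ℝ => x ^ 2; unifM b] = 4*b^4/45 := by
  have := unifM_prob b hb
  rw [variance_eq_sub (unifM_memLp b hb), unifM_mean b hb]
  have : ∫ x, ((fun x : ℝ => x ^ 2) ^ 2) x ∂(unifM b) = ∫ x, x ^ 4 ∂(unifM b) := by
    congr 1; ext x; simp only [Pi.pow_apply]; ring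
  rw [this, unifM_pow b hb]; field_simp; norm_num; ring

lemma pi_unifM (b : ℝ) (hb : 0 < b) (d : ℕ) :
    Measure.pi (fun _ : Fin d => unifM b) =
      ((ENNReal.ofReal (2*b))⁻¹)^d • volume.restrict (Set.pi Set.univ fun _ : Fin d => Set.Ioo (-b) b) := by
  have := unifM_prob b hb
  apply Measure.pi_eq
  intro s hs
  rw [Measure.smul_apply, Measure.restrict_apply (MeasurableSet.univ_pi hs), ← Set.pi_inter_distrib,
    volume_pi_pi]
  simp only [unifM, Measure.smul_apply, smul_eq_mul, Finset.prod_mul_distrib, Measure.restrict_apply (hs _)]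
  simp

theorem stmt7 :
    ∃ d₀ : ℕ, ∀ d : ℕ, d₀ ≤ d → ∀ D : ℕ, 1 ≤ D → ∀ n : ℕ, 1 ≤ n →
      ∀ A : Finset ℕ, A ⊆ Finset.Icc 1 n → A.Nonempty →
      ∀ δ : ℝ, 0 < δ → 2 * δ ≤ 1 / (n : ℝ) →
      ∃ z : ℝ,
        ENNReal.ofReal ((2 / 5) * (2 : ℝ) ^ (-((d * D : ℕ) : ℤ)) * (A.card : ℝ) * δ) ≤
          volume {x : Fin d → ℝ |
            (∀ i, |x i| < (2 : ℝ) ^ (-(D : ℤ) - 1)) ∧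
            ∃ a ∈ A,
              |((∑ i, x i ^ 2) - (2 : ℝ) ^ (-(2 * (D : ℤ))) * d / 12) /
                  ((2 : ℝ) ^ (-(2 * (D : ℤ))) * Real.sqrt ((d : ℝ) / 180)) -
                (z - ((a : ℝ) - 1) / (n : ℝ))| < δ} := by
  refine ⟨1, fun d hd D _ n hn A hA hne δ hδ hδn => ?_⟩
  set b : ℝ := (2 : ℝ) ^ (-(D : ℤ) - 1) with hbdef
  have hb : 0 < b := by positivity
  have h2b : 2 * b = (2:ℝ) ^ (-(D:ℤ)) := by
    rw [hbdef, zpow_sub₀ (by norm_num)]; norm_num; ring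
  have hsq : (2 : ℝ) ^ (-(2 * (D : ℤ))) = 4 * b^2 := by
    rw [show 4 * b^2 = (2*b)^2 by ring, h2b, ← zpow_natCast, ← zpow_mul]; congr 1; push_cast; ring
  have hvol : (2 : ℝ) ^ (-((d * D : ℕ) : ℤ)) = (2*b)^d := by
    rw [h2b, ← zpow_natCast, ← zpow_mul]; congr 1; push_cast; ring
  have hd0 : (0:ℝ) < d := by exact_mod_cast hd
  rw [hsq, hvol]
  have hprob := unifM_prob b hb
  set P := Measure.pi (fun _ : Fin d => unifM b) with hP
  set S : (Fin d → ℝ) → ℝ := fun x => ∑ i, x i ^ 2 with hS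
  set r := √((d:ℝ)/180) with hr
  have hr0 : 0 < r := by positivity
  have hr2 : r^2 = (d:ℝ)/180 := Real.sq_sqrt (by positivity)
  have hmi : ∀ i : Fin d, MemLp (fun x : Fin d → ℝ => x i ^ 2) 2 P := fun i =>
    (unifM_memLp b hb).comp_measurePreserving (measurePreserving_eval (fun _ : Fin d => unifM b) i)
  have hSm : MemLp S 2 P := memLp_finsetSum _ fun i _ => hmi i
  have hSmean : ∫ x, S x ∂P = 4*b^2*d/12 := by
    rw [hS, integral_finsetSum _ fun i _ => (hmi i).integrable (by norm_num)]
    have : ∀ i : Fin d, ∫ x : Fin d → ℝ, x i ^ 2 ∂P = b^2/3 := by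
      intro i
      rw [← unifM_mean b hb]
      exact integral_comp_eval (μ := fun _ : Fin d => unifM b) (i := i) (f := fun x : ℝ => x^2) (by fun_prop)
    simp [this]; ring
  have hSvar : Var[S; P] = d * (4*b^4/45) := by
    have := variance_sum_pi (μ := fun _ : Fin d => unifM b) (X := fun _ x => x^2) fun _ => unifM_memLp b hb
    rw [Finset.sum_const, unifM_var b hb] at this
    rw [show S = ∑ i, fun ω : Fin d → ℝ => ω i ^ 2 by ext x; simp [hS], hP, this]
    simp
  have hSi : Integrable S P := hSm.integrable (by norm_num)
  obtain ⟨z, hz⟩ := abstract_stmt P (fun x => (S x - 4*b^2*d/12) / (4*b^2*r)) (by fun_prop)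
    (by
      have := (hSm.sub (memLp_const (4*b^2*d/12))).mul_const ((4*b^2*r)⁻¹)
      simpa [div_eq_mul_inv] using this)
    (by rw [integral_div, integral_sub hSi (integrable_const _), hSmean]; simp)
    (by
      rw [variance_eq_integral hSi.aemeasurable, hSmean] at hSvar
      simp only [div_pow]
      rw [integral_div, hSvar, mul_pow, hr2]
      field_simp; norm_num)
    n hn A hA hne δ hδ hδn
  refine ⟨z, ?_⟩
  set T := {x : Fin d → ℝ | ∃ a ∈ A, |(S x - 4*b^2*d/12) / (4*b^2*r) - (z - ((a : ℝ) - 1) / (n : ℝ))| < δ} with hT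
  have hbox : MeasurableSet (Set.pi Set.univ fun _ : Fin d => Set.Ioo (-b) b) :=
    MeasurableSet.univ_pi fun _ => measurableSet_Ioo
  rw [hP, pi_unifM b hb, Measure.smul_apply, Measure.restrict_apply' hbox, smul_eq_mul] at hz
  have hset : {x : Fin d → ℝ | (∀ i, |x i| < b) ∧ ∃ a ∈ A,
      |(S x - 4*b^2*d/12) / (4*b^2*r) - (z - ((a : ℝ) - 1) / (n : ℝ))| < δ} =
      T ∩ Set.pi Set.univ fun _ : Fin d => Set.Ioo (-b) b := by
    ext x
    simp [hT, abs_lt, and_comm]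
  have hne0 : ENNReal.ofReal (2*b) ≠ 0 := by simpa using hb
  calc ENNReal.ofReal (2/5 * (2*b)^d * A.card * δ)
      = ENNReal.ofReal (2*b)^d * ENNReal.ofReal (2/5 * A.card * δ) := by
        rw [← ENNReal.ofReal_pow (by positivity), ← ENNReal.ofReal_mul (by positivity)]
        congr 1; ring
    _ ≤ ENNReal.ofReal (2*b)^d * (((ENNReal.ofReal (2*b))⁻¹)^d * volume (T ∩ Set.pi Set.univ fun _ : Fin d => Set.Ioo (-b) b)) := by
        gcongr
    _ = volume (T ∩ Set.pi Set.univ fun _ : Fin d => Set.Ioo (-b) b) := by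
        rw [← mul_assoc, ← mul_pow, ENNReal.mul_inv_cancel hne0 ENNReal.ofReal_ne_top, one_pow, one_mul]
    _ = _ := by rw [← hset]
end

section
/- For every ε > 0 there exist η > 0 and an integer d_0 such that for all integers d ≥ d_0 and D ≥ 1, and every real δ > 0 with δ · log d ≤ η, there exists a real number z such that the d-dimensional Lebesgue measure of the set {x ∈ BOX_D : |(‖x‖₂² − μ_D)/σ_D − z| < δ} is at least (√(2/π) − ε) · 2^{−dD} · δ. -/
open MeasureTheory

lemma aux_avg (m : Measure ℝ) [IsFiniteMeasure m] (t δ : ℝ) (ht : 0 < t) (hδ : 0 < δ) :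
    ∃ z : ℝ, ENNReal.ofReal (δ / (t + δ)) * m (Set.Ioo (-t) t) ≤ m {y | |y - z| < δ} := by
  have hS : MeasurableSet {p : ℝ × ℝ | |p.2 - p.1| < δ} :=
    measurableSet_lt (by fun_prop) (by fun_prop)
  have hmeas : Measurable (fun z : ℝ => m {y | |y - z| < δ}) :=
    measurable_measure_prodMk_left hS
  have hvol : volume (Set.Ioo (-(t+δ)) (t+δ)) = ENNReal.ofReal (2 * (t + δ)) := by
    rw [Real.volume_Ioo]; congr 1; ring
  have hint : ∫⁻ z in Set.Ioo (-(t+δ)) (t+δ), m {y | |y - z| < δ} ≠ ⊤ := by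
    refine ne_of_lt (lt_of_le_of_lt (lintegral_mono (g := fun _ => m Set.univ)
      (fun z => measure_mono (Set.subset_univ _))) ?_)
    rw [lintegral_const, Measure.restrict_apply_univ, hvol]
    exact ENNReal.mul_lt_top (measure_lt_top _ _) ENNReal.ofReal_lt_top
  obtain ⟨z, -, hz⟩ := exists_setLAverage_le (μ := volume)
    (s := Set.Ioo (-(t+δ)) (t+δ)) (f := fun z => m {y | |y - z| < δ})
    (by rw [hvol]; simp; linarith) measurableSet_Ioo.nullMeasurableSet hint
  refine ⟨z, le_trans ?_ hz⟩
  rw [setLAverage_eq, hvol]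
  have key : ENNReal.ofReal (2 * δ) * m (Set.Ioo (-t) t) ≤
      ∫⁻ z in Set.Ioo (-(t+δ)) (t+δ), m {y | |y - z| < δ} := by
    have e1 : ∫⁻ z in Set.Ioo (-(t+δ)) (t+δ), m {y | |y - z| < δ} =
        ((volume.restrict (Set.Ioo (-(t+δ)) (t+δ))).prod m) {p : ℝ × ℝ | |p.2 - p.1| < δ} := by
      rw [Measure.prod_apply hS]; rfl
    rw [e1, Measure.prod_apply_symm hS]
    calc ENNReal.ofReal (2 * δ) * m (Set.Ioo (-t) t)
        = ∫⁻ y in Set.Ioo (-t) t, ENNReal.ofReal (2 * δ) ∂m := by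
          rw [lintegral_const, Measure.restrict_apply_univ]
      _ ≤ ∫⁻ y in Set.Ioo (-t) t, (volume.restrict (Set.Ioo (-(t+δ)) (t+δ)))
            ((fun x => (x, y)) ⁻¹' {p : ℝ × ℝ | |p.2 - p.1| < δ}) ∂m := by
          refine setLIntegral_mono' measurableSet_Ioo (fun y hy => ?_)
          rw [Measure.restrict_apply (hS.preimage (by fun_prop))]
          have : Set.Ioo (y - δ) (y + δ) ⊆
              ((fun x => (x, y)) ⁻¹' {p : ℝ × ℝ | |p.2 - p.1| < δ}) ∩
                Set.Ioo (-(t+δ)) (t+δ) := by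
            intro x hx
            simp only [Set.mem_Ioo] at hx hy
            refine ⟨?_, ?_, ?_⟩
            · simp only [Set.mem_preimage, Set.mem_ofPred_eq, abs_lt]
              constructor <;> linarith
            · linarith
            · linarith
          refine le_trans (le_of_eq ?_) (measure_mono this)
          rw [Real.volume_Ioo]; congr 1; ring
      _ ≤ _ := setLIntegral_le_lintegral _ _
  rw [ENNReal.le_div_iff_mul_le (Or.inl (by simp; linarith)) (Or.inl ENNReal.ofReal_ne_top)]
  refine le_trans (le_of_eq ?_) key
  rw [mul_right_comm, ← ENNReal.ofReal_mul (by positivity)]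
  congr 2
  field_simp

lemma aux_gauss (t : ℝ) (ht : 0 < t) (ht1 : t < 1) :
    ENNReal.ofReal (t * (Real.sqrt (2 / Real.pi) - t)) <
      ProbabilityTheory.gaussianReal 0 1 (Set.Ioo (-t) t) := by
  have hs : Real.sqrt (2 / Real.pi) = 2 * (Real.sqrt (2 * Real.pi))⁻¹ := by
    rw [Real.sqrt_div (by norm_num), Real.sqrt_mul (by norm_num)]
    have := Real.mul_self_sqrt (show (0:ℝ) ≤ 2 by norm_num)
    have h2 : 0 < √(2:ℝ) := by positivity
    have h3 : 0 < √Real.pi := Real.sqrt_pos.2 Real.pi_pos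
    field_simp
    nlinarith
  have hs0 : 0 < Real.sqrt (2 / Real.pi) := by positivity
  have hs1 : Real.sqrt (2 / Real.pi) < 1 := by
    rw [Real.sqrt_lt' one_pos, div_lt_iff₀ Real.pi_pos]
    linarith [Real.pi_gt_three]
  set s := Real.sqrt (2 / Real.pi)
  have hle : ENNReal.ofReal (t * (s * (1 - t^2/2))) ≤
      ProbabilityTheory.gaussianReal 0 1 (Set.Ioo (-t) t) := by
    rw [ProbabilityTheory.gaussianReal_apply _ one_ne_zero]
    calc ENNReal.ofReal (t * (s * (1 - t^2/2)))
        = ∫⁻ x in Set.Ioo (-t) t, ENNReal.ofReal (s/2 * (1 - t^2/2)) := by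
          rw [lintegral_const, Measure.restrict_apply_univ, Real.volume_Ioo,
            ← ENNReal.ofReal_mul (mul_nonneg (by linarith) (by nlinarith))]
          congr 1; ring
      _ ≤ _ := by
          refine setLIntegral_mono' measurableSet_Ioo (fun x hx => ?_)
          rw [ProbabilityTheory.gaussianPDF]
          apply ENNReal.ofReal_le_ofReal
          rw [ProbabilityTheory.gaussianPDFReal]
          have e : s / 2 = (Real.sqrt (2 * Real.pi * ((1 : NNReal) : ℝ)))⁻¹ := by
            rw [hs]; simp
          rw [e]
          refine mul_le_mul_of_nonneg_left ?_ (by positivity)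
          have h1 := Real.add_one_le_exp (-(x - 0) ^ 2 / (2 * ((1 : NNReal) : ℝ)))
          refine le_trans ?_ h1
          have : x^2 ≤ t^2 := by
            apply sq_le_sq'
            · linarith [hx.1]
            · linarith [hx.2]
          simp
          linarith
  refine lt_of_lt_of_le ?_ hle
  have hpos : 0 < t * (s * (1 - t^2/2)) := by
    have : 0 < 1 - t^2/2 := by nlinarith
    positivity
  rw [ENNReal.ofReal_lt_ofReal_iff hpos]
  apply mul_lt_mul_of_pos_left _ ht
  nlinarith [mul_pos ht ht, mul_pos hs0 (mul_pos ht ht)]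

/-- uniform law on the centred unit interval -/
noncomputable def auxNu : Measure ℝ := volume.restrict (Set.Ioo (-(1/2)) (1/2))

instance : IsProbabilityMeasure auxNu := ⟨by
  rw [auxNu, Measure.restrict_apply_univ, Real.volume_Ioo]; norm_num⟩

lemma auxNu_integral (f : ℝ → ℝ) : ∫ x, f x ∂auxNu = ∫ x in (-(1/2))..(1/2), f x := by
  rw [auxNu, intervalIntegral.integral_of_le (by norm_num), integral_Ioc_eq_integral_Ioo]

lemma aux_clt (t c : ℝ) 
    (hc : ENNReal.ofReal c < ProbabilityTheory.gaussianReal 0 1 (Set.Ioo (-t) t)) :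
    ∃ d₀ : ℕ, ∀ d : ℕ, d₀ ≤ d → ENNReal.ofReal c ≤
      (Measure.map (fun x : Fin d → ℝ => ((∑ i, x i ^ 2) - (d:ℝ)/12) / Real.sqrt ((d : ℝ) / 180))
        (Measure.pi (fun _ => auxNu))) (Set.Ioo (-t) t) := by
  have hf : Measurable (fun y : ℝ => √180 * (y^2 - 1/12)) := by fun_prop
  have hmp (i : ℕ) := measurePreserving_eval_infinitePi (fun _ : ℕ => auxNu) i
  have hI (f : ℝ → ℝ) (hf : Measurable f) :
      ∫ ω : ℕ → ℝ, f (ω 0) ∂(Measure.infinitePi (fun _ : ℕ => auxNu)) = ∫ y, f y ∂auxNu := by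
    have := integral_map (μ := Measure.infinitePi (fun _ : ℕ => auxNu))
      (φ := Function.eval 0) (hmp 0).measurable.aemeasurable (f := f) hf.aestronglyMeasurable
    rw [(hmp 0).map_eq] at this
    exact this.symm
  have hm (j : ℕ) : Measurable (fun ω : ℕ → ℝ => √180 * (ω j ^ 2 - 1/12)) :=
    hf.comp (measurable_pi_apply j)
  have hclt := ProbabilityTheory.tendstoInDistribution_inv_sqrt_mul_sum
    (P := Measure.infinitePi (fun _ : ℕ => auxNu))
    (X := fun k ω => √180 * (ω k ^ 2 - 1/12)) (Y := id)
    (P' := ProbabilityTheory.gaussianReal 0 1) ⟨by fun_prop, by simp⟩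
    (by
      rw [show (∫ ω, √180 * ((ω : ℕ → ℝ) 0 ^ 2 - 1/12) ∂(Measure.infinitePi (fun _ : ℕ => auxNu)))
        = ∫ y, √180 * (y^2 - 1/12) ∂auxNu from hI _ hf]
      rw [auxNu_integral, intervalIntegral.integral_const_mul,
        intervalIntegral.integral_sub (Continuous.intervalIntegrable (by fun_prop) _ _)
          (Continuous.intervalIntegrable (by fun_prop) _ _)]
      norm_num [integral_pow])
    (by
      rw [show (∫ ω, ((fun ω : ℕ → ℝ => √180 * (ω 0 ^ 2 - 1/12)) ^ 2) ω
          ∂(Measure.infinitePi (fun _ : ℕ => auxNu)))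
        = ∫ y, (√180 * (y^2 - 1/12))^2 ∂auxNu from hI _ (hf.pow_const 2)]
      have e : ∀ y : ℝ, (√180 * (y^2 - 1/12))^2 = 180 * y^4 - 30 * y^2 + 5/4 := by
        intro y
        rw [mul_pow, Real.sq_sqrt (by norm_num)]; ring
      simp_rw [e]
      rw [auxNu_integral, intervalIntegral.integral_add (Continuous.intervalIntegrable (by fun_prop) _ _)
          (Continuous.intervalIntegrable (by fun_prop) _ _),
        intervalIntegral.integral_sub (Continuous.intervalIntegrable (by fun_prop) _ _)
          (Continuous.intervalIntegrable (by fun_prop) _ _),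
        intervalIntegral.integral_const_mul, intervalIntegral.integral_const_mul]
      norm_num [integral_pow])
    (ProbabilityTheory.iIndepFun_infinitePi (P := fun _ : ℕ => auxNu)
      (X := fun _ y => √180 * (y^2 - 1/12)) (fun _ => hf))
    (fun i => ⟨(hm i).aemeasurable, (hm 0).aemeasurable, by
      have key : ∀ j : ℕ, Measure.map (fun ω : ℕ → ℝ => √180 * (ω j ^ 2 - 1/12))
          (Measure.infinitePi (fun _ : ℕ => auxNu)) =
          Measure.map (fun y : ℝ => √180 * (y^2 - 1/12)) auxNu := by
        intro j
        have := Measure.map_map (μ := Measure.infinitePi (fun _ : ℕ => auxNu)) hf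
          (hmp j).measurable
        rw [(hmp j).map_eq] at this
        exact this.symm
      rw [key, key]⟩)
  have hlim := ProbabilityMeasure.le_liminf_measure_open_of_tendsto hclt.tendsto
    (isOpen_Ioo (a := -t) (b := t))
  simp only [ProbabilityMeasure.coe_mk, Measure.map_id] at hlim
  have hev := Filter.eventually_lt_of_lt_liminf (lt_of_lt_of_le hc hlim)
  obtain ⟨d₀, h⟩ := Filter.eventually_atTop.1 hev
  refine ⟨d₀, fun d hd => (h d hd).le.trans (le_of_eq ?_)⟩
  have hpi : Measure.pi (fun _ : Fin d => auxNu) =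
      Measure.map (fun ω (i : Fin d) => ω (i : ℕ)) (Measure.infinitePi (fun _ : ℕ => auxNu)) := by
    rw [← Measure.infinitePi_eq_pi]
    exact (Measure.map_infinitePi_infinitePi_of_inj (P := fun _ : ℕ => auxNu)
      Fin.val_injective).symm
  rw [hpi, Measure.map_map (by fun_prop) (by fun_prop)]
  congr 2
  ext ω
  simp only [Function.comp]
  rw [Fin.sum_univ_eq_sum_range (fun k => ω k ^ 2) d, ← Finset.mul_sum, Finset.sum_sub_distrib,
    Real.sqrt_div (by positivity)]
  simp only [one_div, Finset.sum_const, Finset.card_range, nsmul_eq_mul, div_eq_mul_inv, mul_inv,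
    inv_inv]
  ring

theorem stmt8 (ε : ℝ) (hε : 0 < ε) :
    ∃ η : ℝ, 0 < η ∧ ∃ d₀ : ℕ, ∀ d : ℕ, d₀ ≤ d → ∀ D : ℕ, 1 ≤ D →
      ∀ δ : ℝ, 0 < δ → δ * Real.logb 2 d ≤ η →
      ∃ z : ℝ,
        ENNReal.ofReal ((Real.sqrt (2 / Real.pi) - ε) * (2 : ℝ) ^ (-((d * D : ℕ) : ℤ)) * δ) ≤
          volume {x : Fin d → ℝ |
            (∀ i, |x i| < (2 : ℝ) ^ (-(D : ℤ) - 1)) ∧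
            |((∑ i, x i ^ 2) - (2 : ℝ) ^ (-(2 * (D : ℤ))) * d / 12) /
                ((2 : ℝ) ^ (-(2 * (D : ℤ))) * Real.sqrt ((d : ℝ) / 180)) - z| < δ} := by
  have hs1 : Real.sqrt (2 / Real.pi) < 1 := by
    rw [Real.sqrt_lt' one_pos, div_lt_iff₀ Real.pi_pos]
    linarith [Real.pi_gt_three]
  rcases le_or_gt (Real.sqrt (2 / Real.pi)) ε with hcase | hcase
  · refine ⟨1, one_pos, 0, fun d _ D _ δ hδ _ => ⟨0, ?_⟩⟩
    rw [ENNReal.ofReal_of_nonpos]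
    · exact zero_le
    · rw [mul_assoc]
      exact mul_nonpos_of_nonpos_of_nonneg (by linarith) (by positivity)
  have hG := aux_gauss (ε/2) (by linarith) (by linarith)
  set s := Real.sqrt (2 / Real.pi)
  obtain ⟨d₀, hd₀⟩ := aux_clt _ _ hG
  refine ⟨ε^2/4, by positivity, max d₀ 2, fun d hd D _ δ hδ hlog => ?_⟩
  have hd2 : (2:ℝ) ≤ d := by exact_mod_cast (le_max_right _ _).trans hd
  have hδη : δ ≤ ε^2/4 := by
    have : 1 ≤ Real.logb 2 d := by
      rw [Real.le_logb_iff_rpow_le (by norm_num) (by linarith)]; simpa using hd2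
    nlinarith
  have h1 := hd₀ d ((le_max_left _ _).trans hd)
  have hF : Measurable (fun x : Fin d → ℝ =>
      ((∑ i, x i ^ 2) - (d:ℝ)/12) / Real.sqrt ((d : ℝ) / 180)) := by fun_prop
  set m := Measure.map (fun x : Fin d → ℝ =>
      ((∑ i, x i ^ 2) - (d:ℝ)/12) / Real.sqrt ((d : ℝ) / 180))
        (Measure.pi (fun _ => auxNu)) with hm
  have : IsProbabilityMeasure m := Measure.isProbabilityMeasure_map hF.aemeasurable
  obtain ⟨z, hz⟩ := aux_avg m (ε/2) δ (by linarith) hδ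
  refine ⟨z, ?_⟩
  have hB : MeasurableSet {y : ℝ | |y - z| < δ} := measurableSet_lt (by fun_prop) (by fun_prop)
  have hr : (0:ℝ) < 2 ^ D := by positivity
  have hvol : m {y | |y - z| < δ} = volume {x : Fin d → ℝ | (∀ i, |x i| < 1/2) ∧
      |((∑ i, x i ^ 2) - (d:ℝ)/12) / Real.sqrt ((d : ℝ) / 180) - z| < δ} := by
    rw [hm, Measure.map_apply hF hB]
    simp only [auxNu]
    rw [← Measure.restrict_pi_pi, Measure.restrict_apply (hF hB), ← volume_pi]
    congr 1
    ext x
    simp only [Set.mem_inter_iff, Set.mem_preimage, Set.mem_ofPred_eq, Set.mem_pi, Set.mem_univ,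
      true_implies, Set.mem_Ioo, abs_lt]
    tauto
  have hpre : {x : Fin d → ℝ |
            (∀ i, |x i| < (2 : ℝ) ^ (-(D : ℤ) - 1)) ∧
            |((∑ i, x i ^ 2) - (2 : ℝ) ^ (-(2 * (D : ℤ))) * d / 12) /
                ((2 : ℝ) ^ (-(2 * (D : ℤ))) * Real.sqrt ((d : ℝ) / 180)) - z| < δ} =
      (fun x : Fin d → ℝ => ((2:ℝ)^D) • x) ⁻¹' {x : Fin d → ℝ | (∀ i, |x i| < 1/2) ∧
      |((∑ i, x i ^ 2) - (d:ℝ)/12) / Real.sqrt ((d : ℝ) / 180) - z| < δ} := by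
    have e1 : (2 : ℝ) ^ (-(D : ℤ) - 1) = (1/2) / 2^D := by
      rw [zpow_sub₀ (by norm_num), zpow_neg, zpow_natCast]; field_simp
    have e2 : (2 : ℝ) ^ (-(2 * (D : ℤ))) = ((2^D)^2)⁻¹ := by
      rw [zpow_neg]; congr 1
      rw [← pow_mul, mul_comm D 2]; norm_cast
    rw [e1, e2]
    ext x
    simp only [Set.mem_preimage, Set.mem_ofPred_eq, Pi.smul_apply, smul_eq_mul, mul_pow,
      ← Finset.mul_sum, abs_mul, abs_of_pos hr]
    refine and_congr (forall_congr' fun i => ?_) ?_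
    · rw [lt_div_iff₀ hr, mul_comm]
    · have hsq : 0 < Real.sqrt ((d:ℝ)/180) := Real.sqrt_pos.2 (by linarith)
      rw [show (∑ i, x i ^ 2 - ((2 ^ D) ^ 2)⁻¹ * (d:ℝ) / 12) /
          (((2 ^ D) ^ 2)⁻¹ * √((d:ℝ) / 180)) = ((2 ^ D) ^ 2 * ∑ i, x i ^ 2 - (d:ℝ) / 12) /
          √((d:ℝ) / 180) by field_simp]
  rw [hpre, Measure.addHaar_preimage_smul _ hr.ne', ← hvol]
  have e3 : (2 : ℝ) ^ (-((d * D : ℕ) : ℤ)) =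
      |(((2:ℝ)^D) ^ (Module.finrank ℝ (Fin d → ℝ)))⁻¹| := by
    rw [abs_of_pos (by positivity), Module.finrank_fin_fun, zpow_neg, zpow_natCast, ← pow_mul,
      mul_comm d D]
  rw [e3]
  set v := |(((2:ℝ)^D) ^ (Module.finrank ℝ (Fin d → ℝ)))⁻¹|
  have hv : 0 ≤ v := abs_nonneg _
  rw [show (s - ε) * v * δ = v * ((s - ε) * δ) by ring, ENNReal.ofReal_mul hv]
  gcongr
  refine le_trans ?_ (le_trans (mul_le_mul_right h1 _) hz)
  rw [← ENNReal.ofReal_mul (by positivity)]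
  apply ENNReal.ofReal_le_ofReal
  rw [div_mul_eq_mul_div, le_div_iff₀ (by positivity)]
  have : (s - ε) * (ε/2 + δ) ≤ ε/2 * (s - ε/2) := by nlinarith
  nlinarith
end

section
/- Let k and D be integers with D ≥ 1 and k > 2D. For every ε > 0 there exists N_0 such that for all integers N ≥ N_0, r_{k,D}(N)/N ≥ ((√90/(e·π^{3/2})) · (2^D/D^{1/4}) · binom(2D, D) − ε) · (2 log N)^{1/4} / 2^{√(8D·log N)}, where e is Euler's number and log is the base-2 logarithm. -/
/-- `A` contains a `k`-term `D`-progression: there is a nonconstant real polynomial `Q`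
of degree at most `D` such that `Q 1, Q 2, …, Q k` all lie in `A`. -/
def HasProgression (A : Finset ℕ) (k D : ℕ) : Prop :=
  ∃ Q : Polynomial ℝ, 0 < Q.natDegree ∧ Q.natDegree ≤ D ∧
    ∀ j ∈ Finset.Icc 1 k, ∃ m ∈ A, (m : ℝ) = Q.eval (j : ℝ)

/-- `rkD k D N` is the maximum size of a subset of `[1,N] ∩ ℤ` containing no
`k`-term `D`-progression. -/
noncomputable def rkD (k D N : ℕ) : ℕ :=
  sSup {m | ∃ A : Finset ℕ, A ⊆ Finset.Icc 1 N ∧ ¬ HasProgression A k D ∧ A.card = m}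


open Finset in
lemma aux_fwd_natDegree_le (P : Polynomial ℝ) (n : ℕ) (h : P.natDegree ≤ n) :
    ∑ k ∈ range (n + 1), ((-1 : ℝ) ^ (n - k) * n.choose k) * P.eval (k : ℝ)
      = P.coeff n * (n.factorial : ℝ) := by
  have key : (fwdDiff (1:ℝ))^[n] P.eval 0 = P.coeff n * (n.factorial : ℝ) := by
    rcases h.lt_or_eq with h | h
    · rw [Polynomial.fwdDiff_iter_eq_zero_of_degree_lt h, Polynomial.coeff_eq_zero_of_natDegree_lt h]
      simp
    · subst h
      rw [Polynomial.fwdDiff_iter_degree_eq_factorial]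
      simp
  rw [← key, fwdDiff_iter_eq_sum_shift]
  apply Finset.sum_congr rfl
  intro k _
  simp

open Finset in
lemma aux_poly_zero (P : Polynomial ℝ) (n : ℕ) (h : P.natDegree < n) (y : ℝ) :
    ∑ k ∈ range (n + 1), ((-1 : ℝ) ^ (n - k) * n.choose k) * P.eval (y + k) = 0 := by
  have key : (fwdDiff (1:ℝ))^[n] P.eval y = 0 := by
    rw [Polynomial.fwdDiff_iter_eq_zero_of_degree_lt h]; rfl
  rw [← key, fwdDiff_iter_eq_sum_shift]
  apply Finset.sum_congr rfl
  intro k _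
  simp

open Finset in
lemma aux_newton_sq (d e : ℕ) (w : ℕ → Fin d → ℤ) 
    (hv : ∀ i, e < i → i ≤ 2 * e → (fwdDiff 1)^[i] w 0 = 0) :
    ∑ k ∈ range (2 * e + 1), ((-1 : ℝ) ^ (2 * e - k) * (2 * e).choose k) * (∑ x, (w k x : ℝ) ^ 2)
      = (2 * e).choose e * ∑ x, (((fwdDiff 1)^[e] w 0 x : ℤ) : ℝ) ^ 2 := by
  set v : ℕ → Fin d → ℤ := fun i => (fwdDiff 1)^[i] w 0 with hvdef
  let p : Fin d → Polynomial ℝ := fun x =>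
    ∑ i ∈ range (e + 1), Polynomial.C ((v i x : ℝ) / i.factorial) * descPochhammer ℝ i
  have hpdeg : ∀ x, (p x).natDegree ≤ e := by
    intro x
    apply Polynomial.natDegree_sum_le_of_forall_le
    intro i hi
    refine (Polynomial.natDegree_C_mul_le _ _).trans ?_
    rw [descPochhammer_natDegree]
    simp at hi; omega
  have hpcoeff : ∀ x, (p x).coeff e = (v e x : ℝ) / e.factorial := by
    intro x
    simp only [p, Polynomial.finsetSum_coeff, Polynomial.coeff_C_mul]
    rw [Finset.sum_range_succ, Finset.sum_eq_zero]
    · have h1 := (monic_descPochhammer ℝ e).coeff_natDegree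
      rw [descPochhammer_natDegree] at h1
      rw [h1]; simp
    · intro i hi
      rw [Polynomial.coeff_eq_zero_of_natDegree_lt, mul_zero]
      rw [descPochhammer_natDegree]
      simpa using hi
  have hpeval : ∀ x, ∀ k ∈ range (2 * e + 1), (p x).eval (k : ℝ) = w k x := by
    intro x k hk
    have h1 := shift_eq_sum_fwdDiff_iter (1 : ℕ) w k 0
    simp only [smul_eq_mul, mul_one, zero_add] at h1
    have h2 : (w k x : ℝ) = ∑ i ∈ range (k + 1), (k.choose i : ℝ) * (v i x : ℝ) := by
      conv_lhs => rw [h1]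
      simp [v]
    have h3 : (w k x : ℝ) = ∑ i ∈ range (2 * e + 1), (k.choose i : ℝ) * (v i x : ℝ) := by
      rw [h2]
      apply Finset.sum_subset
      · intro i; simp at hk ⊢; omega
      · intro i _ hi
        rw [Nat.choose_eq_zero_of_lt]; simp
        simp at hi; omega
    rw [h3]
    simp only [p, Polynomial.eval_finsetSum, Polynomial.eval_mul, Polynomial.eval_C]
    have : ∀ i, (v i x : ℝ) / i.factorial * (descPochhammer ℝ i).eval (k : ℝ) = (k.choose i : ℝ) * (v i x : ℝ) := by
      intro i
      rw [descPochhammer_eval_eq_descFactorial, Nat.descFactorial_eq_factorial_mul_choose]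
      have : (i.factorial : ℝ) ≠ 0 := by positivity
      push_cast
      field_simp
    simp only [this]
    apply Finset.sum_subset
    · intro i; simp; omega
    · intro i hi hi'
      simp at hi hi'
      have := congrFun (hv i (by omega) (by omega)) x
      simp only [v]
      rw [this]; simp
  let P : Polynomial ℝ := ∑ x, (p x) ^ 2
  have hPdeg : P.natDegree ≤ 2 * e := by
    apply Polynomial.natDegree_sum_le_of_forall_le
    intro x _
    exact Polynomial.natDegree_pow_le_of_le 2 (hpdeg x)
  have hPc : P.coeff (2 * e) = ∑ x, ((v e x : ℝ) / e.factorial) ^ 2 := by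
    simp only [P, Polynomial.finsetSum_coeff]
    apply Finset.sum_congr rfl
    intro x _
    rw [Polynomial.coeff_pow_of_natDegree_le (hpdeg x), hpcoeff]
  have := aux_fwd_natDegree_le P (2 * e) hPdeg
  rw [hPc] at this
  have h4 : ∑ k ∈ range (2 * e + 1), ((-1 : ℝ) ^ (2 * e - k) * (2 * e).choose k) * (∑ x, (w k x : ℝ) ^ 2)
     = ∑ k ∈ range (2 * e + 1), ((-1 : ℝ) ^ (2 * e - k) * (2 * e).choose k) * P.eval (k : ℝ) := by
    apply Finset.sum_congr rfl
    intro k hk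
    congr 1
    simp only [P, Polynomial.eval_finsetSum, Polynomial.eval_pow]
    apply Finset.sum_congr rfl
    intro x _
    rw [hpeval x k hk]
  rw [h4, this]
  have h5 : ((2 * e).factorial : ℝ) = (2 * e).choose e * e.factorial * e.factorial := by
    have := Nat.choose_mul_factorial_mul_factorial (n := 2 * e) (k := e) (by omega)
    rw [show 2 * e - e = e by omega] at this
    exact_mod_cast this.symm
  rw [h5, Finset.sum_mul, Finset.mul_sum]
  apply Finset.sum_congr rfl
  intro x _
  have : (e.factorial : ℝ) ≠ 0 := by positivity
  simp only [v]
  field_simp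

/-- squared Euclidean norm of an integer vector -/
def gsq {d : ℕ} (w : Fin d → ℤ) : ℤ := ∑ x, w x ^ 2

/-- the vector `l` is congruent mod `q` to a multiple of `c` -/
def InLat {d : ℕ} (q : ℕ) (c : Fin d → ZMod q) (l : Fin d → ℤ) : Prop :=
  ∃ t : ZMod q, ∀ x, (l x : ZMod q) = t * c x

/-- `2^D w` lies in the open Voronoi cell of the lattice of `c` -/
def GoodPt {d : ℕ} (q D : ℕ) (c : Fin d → ZMod q) (w : Fin d → ℤ) : Prop :=
  ∀ l : Fin d → ℤ, l ≠ 0 → InLat q c l → 2 ^ (D + 1) * |w ⬝ᵥ l| < gsq l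

lemma gsq_eq_dot {d : ℕ} (w : Fin d → ℤ) : gsq w = w ⬝ᵥ w := by
  simp [gsq, dotProduct, sq]

lemma gsq_nonneg {d : ℕ} (w : Fin d → ℤ) : 0 ≤ gsq w :=
  Finset.sum_nonneg fun _ _ => sq_nonneg _

lemma aux_alt_sum (n : ℕ) (hn : 0 < n) :
    ∑ k ∈ Finset.range (n + 1), ((-1 : ℤ) ^ (n - k) * n.choose k) = 0 := by
  have := aux_poly_zero 1 n (by simpa using hn) 0
  simp only [Polynomial.eval_one, mul_one] at this
  exact_mod_cast this

open Finset in
lemma aux_fd_cong {d q : ℕ} (a b c : Fin d → ZMod q) (W : ℕ → Fin d → ℤ) (M : ℕ → ℕ) (T : ℕ → ZMod q)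
    (k : ℕ) (h : ∀ j < k, ∀ x, (W j x : ZMod q) = M j * a x + b x + T j * c x)
    (n : ℕ) (hn : 0 < n) (y : ℕ) (hy : y + n < k) (x : Fin d) :
    (((fwdDiff 1)^[n] W y x : ℤ) : ZMod q) =
      ((∑ j ∈ range (n + 1), ((-1 : ℤ) ^ (n - j) * n.choose j) * (M (y + j) : ℤ) : ℤ) : ZMod q) * a x
       + (∑ j ∈ range (n + 1), (((-1 : ℤ) ^ (n - j) * n.choose j : ℤ) : ZMod q) * T (y + j)) * c x := by
  rw [fwdDiff_iter_eq_sum_shift]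
  simp only [Finset.sum_apply, Pi.smul_apply]
  simp only [smul_eq_mul, mul_one]
  rw [Int.cast_sum, Int.cast_sum]
  have h0 : ∑ j ∈ range (n + 1), ((((-1 : ℤ) ^ (n - j) * n.choose j : ℤ) : ZMod q)) * b x = 0 := by
    rw [← Finset.sum_mul, ← Int.cast_sum, aux_alt_sum n hn]; simp
  refine Eq.trans ?_ (add_zero _)
  rw [← h0, Finset.sum_mul, Finset.sum_mul, ← Finset.sum_add_distrib,
    ← Finset.sum_add_distrib]
  apply Finset.sum_congr rfl
  intro j hj
  have := h (y + j) (by simp at hj; omega) x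
  push_cast
  rw [this]
  ring

open Finset in
lemma core_free {d q : ℕ} (k D N : ℕ) (hD : 1 ≤ D) (hk : 2 * D < k)
    (a b c : Fin d → ZMod q) (z δ : ℝ)
    (hfine : ∀ u : Fin d → ℤ, u ≠ 0 → (∃ n t : ZMod q, ∀ x, (u x : ZMod q) = n * a x + t * c x) →
      4 ^ D * δ < (gsq u : ℝ))
    (hind : ∀ n t : ZMod q, (∀ x, n * a x + t * c x = 0) → n = 0)
    (A : Finset ℕ) (hA : A ⊆ Finset.Icc 1 N) (hN : N < q)
    (hw : ∀ n ∈ A, ∃ (w : Fin d → ℤ) (t : ZMod q), GoodPt q D c w ∧ z - δ < (gsq w : ℝ) ∧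
      (gsq w : ℝ) ≤ z ∧ ∀ x, (w x : ZMod q) = n * a x + b x + t * c x) :
    ¬ HasProgression A k D := by
  rintro ⟨Q, hQ0, hQD, hQ⟩
  choose! m hmA hmQ using hQ
  choose! w t hgood hlo hhi hcong using hw
  set M : ℕ → ℕ := fun j => m (j + 1) with hM
  have hMA : ∀ j < k, M j ∈ A := fun j hj => hmA _ (by simp; omega)
  have hMQ : ∀ j < k, (M j : ℝ) = Q.eval (1 + (j : ℝ)) := by
    intro j hj
    rw [hM]; simp only
    rw [hmQ (j + 1) (by simp; omega)]
    push_cast; rw [add_comm]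
  set W : ℕ → Fin d → ℤ := fun j => w (M j) with hW
  have hWc : ∀ j < k, ∀ x, (W j x : ZMod q) = M j * a x + b x + t (M j) * c x :=
    fun j hj => hcong (M j) (hMA j hj)
  have hfd := aux_fd_cong a b c W M (fun j => t (M j)) k hWc
  have C1 : ∀ y, y + (D + 1) < k → (fwdDiff 1)^[D + 1] W y = 0 := by
    intro y hy
    by_contra hne
    set u := (fwdDiff 1)^[D + 1] W y with hu
    have hM0 : ∑ j ∈ range (D + 1 + 1), ((-1 : ℤ) ^ (D + 1 - j) * (D + 1).choose j) * (M (y + j) : ℤ) = 0 := by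
      have h1 := aux_poly_zero Q (D + 1) (by omega) (1 + (y : ℝ))
      have h2 : ∑ j ∈ range (D + 1 + 1), ((-1 : ℝ) ^ (D + 1 - j) * (D + 1).choose j) * (M (y + j) : ℝ) = 0 := by
        rw [← h1]
        apply Finset.sum_congr rfl
        intro j hj
        rw [hMQ (y + j) (by simp at hj; omega)]
        push_cast; rw [add_assoc]
      exact_mod_cast h2
    have hlat : InLat q c u := by
      refine ⟨∑ j ∈ range (D + 1 + 1),
        (((-1 : ℤ) ^ (D + 1 - j) * (D + 1).choose j : ℤ) : ZMod q) * t (M (y + j)), fun x => ?_⟩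
      rw [hu, hfd (D + 1) (by omega) y hy x, hM0]
      simp only [Int.cast_zero, zero_mul, zero_add]
    have husum : gsq u = ∑ j ∈ range (D + 1 + 1), ((-1 : ℤ) ^ (D + 1 - j) * (D + 1).choose j) * (W (y + j) ⬝ᵥ u) := by
      rw [gsq_eq_dot]
      conv_lhs => lhs; rw [hu, fwdDiff_iter_eq_sum_shift]
      rw [sum_dotProduct]
      apply Finset.sum_congr rfl
      intro j _
      rw [smul_dotProduct]
      simp
    have hlt : 2 ^ (D + 1) * gsq u < 2 ^ (D + 1) * gsq u := by
      calc 2 ^ (D + 1) * gsq u ≤ ∑ j ∈ range (D + 1 + 1), ((D + 1).choose j : ℤ) * (2 ^ (D + 1) * |W (y + j) ⬝ᵥ u|) := by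
            conv_lhs => rw [husum, Finset.mul_sum]
            apply Finset.sum_le_sum
            intro j _
            have h1 : ((-1 : ℤ) ^ (D + 1 - j) * (D + 1).choose j) * (W (y + j) ⬝ᵥ u) ≤ (D + 1).choose j * |W (y + j) ⬝ᵥ u| := by
              refine (le_abs_self _).trans ?_
              rw [abs_mul, abs_mul, abs_pow]
              simp
            have : (0:ℤ) ≤ 2 ^ (D + 1) := by positivity
            nlinarith [mul_le_mul_of_nonneg_left h1 this]
        _ < ∑ j ∈ range (D + 1 + 1), ((D + 1).choose j : ℤ) * gsq u := by
            apply Finset.sum_lt_sum_of_nonempty (by simp)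
            intro j hj
            simp at hj
            apply mul_lt_mul_of_pos_left
            · exact hgood (M (y + j)) (hMA _ (by omega)) u hne hlat
            · exact_mod_cast Nat.choose_pos (by omega)
        _ = 2 ^ (D + 1) * gsq u := by
            rw [← Finset.sum_mul]
            congr 1
            exact_mod_cast Nat.sum_range_choose (D + 1)
    exact lt_irrefl _ hlt
  have C2 : ∀ i, D < i → i ≤ 2 * D → (fwdDiff 1)^[i] W 0 = 0 := by
    intro i hi hi2
    obtain ⟨s, rfl⟩ : ∃ s, i = s + (D + 1) := ⟨i - (D + 1), by omega⟩
    rw [Function.iterate_add_apply, fwdDiff_iter_eq_sum_shift]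
    apply Finset.sum_eq_zero
    intro j hj
    simp at hj
    simp only [smul_eq_mul, mul_one, zero_add]
    rw [C1 j (by omega), smul_zero]
  by_cases hall : ∀ i, 1 ≤ i → i ≤ D → (fwdDiff 1)^[i] W 0 = 0
  · have hconst : ∀ j ≤ 2 * D, W j = W 0 := by
      intro j hj
      have h1 := shift_eq_sum_fwdDiff_iter (1 : ℕ) W j 0
      simp only [smul_eq_mul, mul_one, zero_add] at h1
      rw [h1, Finset.sum_range_succ', Finset.sum_eq_zero]
      · simp
      · intro i hi
        simp at hi
        by_cases hiD : i + 1 ≤ D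
        · rw [hall (i + 1) (by omega) hiD, smul_zero]
        · rw [C2 (i + 1) (by omega) (by omega), smul_zero]
    have hMc : ∀ j ≤ 2 * D, M j = M 0 := by
      intro j hj
      have h1 : ((M j : ZMod q) - (M 0 : ZMod q)) = 0 := by
        apply hind _ (t (M j) - t (M 0))
        intro x
        have e1 := hWc j (by omega) x
        have e2 := hWc 0 (by omega) x
        rw [hconst j hj, e2] at e1
        linear_combination -e1
      have h2 : (M j : ZMod q) = (M 0 : ZMod q) := sub_eq_zero.mp h1
      have h3 := (ZMod.natCast_eq_natCast_iff' _ _ _).mp h2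
      have b1 := hA (hMA j (by omega))
      have b2 := hA (hMA 0 (by omega))
      simp at b1 b2
      rwa [Nat.mod_eq_of_lt (by omega), Nat.mod_eq_of_lt (by omega)] at h3
    have hzero : Q - Polynomial.C (M 0 : ℝ) = 0 := by
      apply Polynomial.eq_zero_of_natDegree_lt_card_of_eval_eq_zero' _ 
        ((range (2 * D + 1)).image (fun j : ℕ => 1 + (j : ℝ)))
      · intro r hr
        simp only [mem_image, mem_range] at hr
        obtain ⟨j, hj, rfl⟩ := hr
        rw [Polynomial.eval_sub, ← hMQ j (by omega), hMc j (by omega)]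
        simp
      · rw [Finset.card_image_of_injective]
        · simp only [card_range]
          rw [Polynomial.natDegree_sub_C]; omega
        · intro i j hij
          simpa using hij
    rw [sub_eq_zero] at hzero
    rw [hzero] at hQ0
    simp at hQ0
  · push Not at hall
    obtain ⟨i0, hi1, hi2, hi3⟩ := hall
    classical
    set S := (Finset.Icc 1 D).filter (fun i => (fwdDiff 1)^[i] W 0 ≠ 0) with hS
    have hSn : S.Nonempty := ⟨i0, by simp [hS, hi1, hi2, hi3]⟩
    set e := S.max' hSn with he
    have heS : e ∈ S := S.max'_mem hSn
    simp only [hS, mem_filter, mem_Icc] at heS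
    obtain ⟨⟨he1, he2⟩, he3⟩ := heS
    have hz : ∀ i, e < i → i ≤ 2 * e → (fwdDiff 1)^[i] W 0 = 0 := by
      intro i hi hi'
      by_cases hiD : i ≤ D
      · by_contra hne
        have : i ∈ S := by simp [hS, hne, hiD]; omega
        have := S.le_max' i this
        omega
      · exact C2 i (by omega) (by omega)
    have hsq := aux_newton_sq d e W hz
    have hf := hfine _ he3 ⟨_, _, fun x => hfd e (by omega) 0 (by omega) x⟩
    have hδ : 0 < δ := by
      have h1 := hlo (M 0) (hMA 0 (by omega))
      have h2 := hhi (M 0) (hMA 0 (by omega))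
      linarith
    have hg : ∀ u : Fin d → ℤ, (gsq u : ℝ) = ∑ x, (u x : ℝ) ^ 2 := by
      intro u; simp [gsq]
    rw [← hg] at hsq
    simp only [← hg] at hsq
    have hup : ∑ j ∈ range (2 * e + 1), ((-1 : ℝ) ^ (2 * e - j) * (2 * e).choose j) * (gsq (W j) : ℝ) ≤ 4 ^ e * δ := by
      have h0 : ∑ j ∈ range (2 * e + 1), ((-1 : ℝ) ^ (2 * e - j) * (2 * e).choose j) * z = 0 := by
        rw [← Finset.sum_mul]
        have := aux_alt_sum (2 * e) (by omega)
        have h' : ∑ j ∈ range (2 * e + 1), ((-1 : ℝ) ^ (2 * e - j) * (2 * e).choose j) = 0 := by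
          exact_mod_cast this
        rw [h', zero_mul]
      calc _ = ∑ j ∈ range (2 * e + 1), ((-1 : ℝ) ^ (2 * e - j) * (2 * e).choose j) * ((gsq (W j) : ℝ) - z) := by
            rw [← sub_zero (∑ j ∈ range (2 * e + 1), _), ← h0, ← Finset.sum_sub_distrib]
            apply Finset.sum_congr rfl
            intro j _; ring
        _ ≤ ∑ j ∈ range (2 * e + 1), ((2 * e).choose j : ℝ) * δ := by
            apply Finset.sum_le_sum
            intro j hj
            simp at hj
            refine (le_abs_self _).trans ?_
            rw [abs_mul, abs_mul, abs_pow]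
            simp only [abs_neg, abs_one, one_pow, one_mul, Nat.abs_cast]
            have h1 := hlo (M j) (hMA j (by omega))
            have h2 := hhi (M j) (hMA j (by omega))
            apply mul_le_mul_of_nonneg_left _ (by positivity)
            rw [abs_le]
            constructor <;> simp only [hW] <;> linarith
        _ = 4 ^ e * δ := by
            rw [← Finset.sum_mul]
            congr 1
            have := Nat.sum_range_choose (2 * e)
            rw [pow_mul] at this
            exact_mod_cast this
    have hc : (1 : ℝ) ≤ (2 * e).choose e := by
      exact_mod_cast Nat.choose_pos (by omega)
    have hgn : (0 : ℝ) ≤ gsq ((fwdDiff 1)^[e] W 0) := by exact_mod_cast gsq_nonneg _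
    have h4 : (4 : ℝ) ^ e ≤ 4 ^ D := pow_le_pow_right₀ (by norm_num) he2
    nlinarith [mul_le_mul_of_nonneg_right h4 hδ.le, mul_le_mul_of_nonneg_right hc hgn]

lemma gsq_ge_of_dvd {d q : ℕ} (l : Fin d → ℤ) (hl : l ≠ 0) (h : ∀ x, (l x : ZMod q) = 0) :
    (q : ℝ) ^ 2 ≤ (gsq l : ℝ) := by
  obtain ⟨x, hx⟩ := Function.ne_iff.mp hl
  have h1 : (q : ℤ) ∣ l x := (ZMod.intCast_zmod_eq_zero_iff_dvd _ _).mp (h x)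
  have h2 : (q : ℤ) ≤ |l x| := Int.le_of_dvd (abs_pos.mpr hx) ((dvd_abs _ _).mpr h1)
  have h3 : l x ^ 2 ≤ gsq l :=
    Finset.single_le_sum (f := fun x => l x ^ 2) (fun _ _ => sq_nonneg _) (Finset.mem_univ x)
  have h4 : (q : ℤ) ^ 2 ≤ l x ^ 2 := by
    rw [← sq_abs (l x)]
    exact pow_le_pow_left₀ (by positivity) h2 2
  exact_mod_cast h4.trans h3

open Finset in
lemma not_good_mem {d q : ℕ} [Fact q.Prime] (D : ℕ) (R : ℝ) (BR : Finset (Fin d → ℤ))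
    (hBR : ∀ u : Fin d → ℤ, (gsq u : ℝ) ≤ R ^ 2 → u ∈ BR) (hR : 0 ≤ R) (hRq : 2 * R < q)
    (w : Fin d → ℤ) (hw : 4 ^ D * (gsq w : ℝ) ≤ R ^ 2) (c : Fin d → ZMod q)
    (hc : ¬ GoodPt q D c w) :
    ∃ p ∈ (univ : Finset (ZMod q)) ×ˢ BR, (fun x => p.1⁻¹ * (2 ^ D * (w x : ZMod q) - (p.2 x : ZMod q))) = c := by
  unfold GoodPt at hc
  push Not at hc
  obtain ⟨l, hl0, ⟨t, ht⟩, hl⟩ := hc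
  have hcs : (w ⬝ᵥ l) ^ 2 ≤ gsq w * gsq l := by
    simpa [dotProduct, gsq] using Finset.sum_mul_sq_le_sq_mul_sq univ w l
  have hgl0 : 0 < gsq l := by
    obtain ⟨x, hx⟩ := Function.ne_iff.mp hl0
    have h3 : l x ^ 2 ≤ gsq l :=
      Finset.single_le_sum (f := fun x => l x ^ 2) (fun _ _ => sq_nonneg _) (Finset.mem_univ x)
    have : 0 < l x ^ 2 := by
      have : l x ≠ 0 := hx
      positivity
    omega
  have hgl : gsq l ≤ 4 ^ (D + 1) * gsq w := by
    have h1 : gsq l ^ 2 ≤ (2 ^ (D + 1) * |w ⬝ᵥ l|) ^ 2 := pow_le_pow_left₀ hgl0.le hl 2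
    rw [mul_pow, sq_abs, ← pow_mul, mul_comm (D + 1) 2, pow_mul] at h1
    norm_num at h1
    have h2 : (0:ℤ) ≤ 4 ^ (D + 1) := by positivity
    have h3 : gsq l * gsq l ≤ (4 ^ (D + 1) * gsq w) * gsq l := by
      nlinarith [mul_le_mul_of_nonneg_left hcs h2]
    exact le_of_mul_le_mul_right h3 hgl0
  have htne : t ≠ 0 := by
    rintro rfl
    have h1 := gsq_ge_of_dvd (q := q) l hl0 (fun x => by rw [ht x]; simp)
    have h2 : (gsq l : ℝ) ≤ 4 ^ (D + 1) * gsq w := by exact_mod_cast hgl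
    rw [pow_succ] at h2
    nlinarith
  have main : ∀ (l' : Fin d → ℤ) (t' : ZMod q), t' ≠ 0 → (∀ x, (l' x : ZMod q) = t' * c x) →
      gsq l' ≤ 2 ^ (D + 1) * (w ⬝ᵥ l') → 
      ∃ p ∈ (univ : Finset (ZMod q)) ×ˢ BR, (fun x => p.1⁻¹ * (2 ^ D * (w x : ZMod q) - (p.2 x : ZMod q))) = c := by
    intro l' t' ht' hc' hl'
    refine ⟨(t', fun x => 2 ^ D * w x - l' x), ?_, ?_⟩
    · simp only [mem_product, mem_univ, true_and]
      apply hBR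
      refine le_trans ?_ hw
      have : gsq (fun x => 2 ^ D * w x - l' x) = 4 ^ D * gsq w - 2 ^ (D + 1) * (w ⬝ᵥ l') + gsq l' := by
        simp only [gsq, dotProduct, Finset.mul_sum]
        rw [← Finset.sum_sub_distrib, ← Finset.sum_add_distrib]
        apply Finset.sum_congr rfl
        intro x _
        rw [show (4:ℤ) ^ D = 2 ^ D * 2 ^ D by rw [← mul_pow]; norm_num]
        ring
      have h2 : gsq (fun x => 2 ^ D * w x - l' x) ≤ 4 ^ D * gsq w := by rw [this]; linarith
      exact_mod_cast h2
    · funext x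
      simp only
      push_cast
      rw [hc' x]
      field_simp
      ring
  rcases abs_cases (w ⬝ᵥ l) with ⟨h, _⟩ | ⟨h, _⟩
  · exact main l t htne ht (by rw [h] at hl; exact hl)
  · refine main (-l) (-t) (neg_ne_zero.mpr htne) (fun x => by simp [ht x]) ?_
    rw [dotProduct_neg, ← h]
    have : gsq (-l) = gsq l := by simp [gsq]
    rw [this]; exact hl

open Finset Classical in
lemma exists_set {d q : ℕ} [hq : Fact q.Prime] (k D N : ℕ) (hD : 1 ≤ D) (hk : 2 * D < k) (hN : N < q)
    (R r z δ : ℝ) (BR Br W : Finset (Fin d → ℤ))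
    (hBR : ∀ u : Fin d → ℤ, (gsq u : ℝ) ≤ R ^ 2 → u ∈ BR)
    (hBr : ∀ u : Fin d → ℤ, (gsq u : ℝ) ≤ r ^ 2 → u ∈ Br)
    (hR : 0 ≤ R) (hRq : 2 * R < q) (hr : 0 ≤ r) (hrq : r < q)
    (hBRc : 8 * q * BR.card ≤ q ^ d) (hBrc : 8 * q ^ 2 * Br.card ≤ q ^ d)
    (hW : ∀ w ∈ W, 4 ^ D * (gsq w : ℝ) ≤ R ^ 2 ∧ z - δ < (gsq w : ℝ) ∧ (gsq w : ℝ) ≤ z)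
    (hδ : 4 ^ D * δ ≤ r ^ 2) :
    ∃ A ⊆ Finset.Icc 1 N, ¬ HasProgression A k D ∧ N * q * W.card ≤ 2 * q ^ d * A.card := by
  haveI : NeZero q := ⟨hq.out.ne_zero⟩
  have hqpos : 0 < q := hq.out.pos
  let V := Fin d → ZMod q
  have hVcard : Fintype.card V = q ^ d := by simp [V, ZMod.card]
  let bad : Finset (V × V) := univ.filter fun p => ∃ s : ZMod q × ZMod q, s ≠ 0 ∧ ∃ u ∈ Br,
    ∀ x, (u x : ZMod q) = s.1 * p.1 x + s.2 * p.2 x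
  have hbad : 8 * bad.card ≤ q ^ d * q ^ d := by
    have h1 : bad ⊆ ((univ : Finset (ZMod q × ZMod q)) ×ˢ Br).biUnion fun s =>
        univ.filter fun p : V × V => s.1 ≠ 0 ∧ ∀ x, (s.2 x : ZMod q) = s.1.1 * p.1 x + s.1.2 * p.2 x := by
      intro p hp
      simp only [bad, mem_filter, mem_univ, true_and] at hp
      obtain ⟨s, hs, u, hu, h⟩ := hp
      simp only [mem_biUnion, mem_product, mem_univ, true_and, mem_filter]
      exact ⟨(s, u), hu, hs, h⟩
    have h2 : bad.card ≤ ((univ : Finset (ZMod q × ZMod q)) ×ˢ Br).card * q ^ d := by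
      refine (card_le_card h1).trans (card_biUnion_le_card_mul _ _ _ ?_)
      rintro ⟨s, u⟩ _
      simp only
      rw [← hVcard, ← card_univ]
      by_cases hs1 : s.1 = 0
      · apply card_le_card_of_injOn (fun p => p.1) (fun _ _ => mem_univ _)
        intro p hp p' hp' heq
        simp only [coe_filter, mem_univ, true_and, Set.mem_setOf_eq] at hp hp'
        have hs2 : s.2 ≠ 0 := fun h => hp.1 (Prod.ext hs1 h)
        simp only at heq
        refine Prod.ext heq (funext fun x => ?_)
        have e := hp.2 x
        rw [hp'.2 x, hs1] at e
        simp only [zero_mul, zero_add] at e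
        exact (mul_left_cancel₀ hs2 e).symm
      · apply card_le_card_of_injOn (fun p => p.2) (fun _ _ => mem_univ _)
        intro p hp p' hp' heq
        simp only [coe_filter, mem_univ, true_and, Set.mem_setOf_eq] at hp hp'
        simp only at heq
        refine Prod.ext (funext fun x => ?_) heq
        have e := hp.2 x
        rw [hp'.2 x, heq] at e
        exact (mul_left_cancel₀ hs1 (add_right_cancel e)).symm
    have h3 : ((univ : Finset (ZMod q × ZMod q)) ×ˢ Br).card = q ^ 2 * Br.card := by
      rw [card_product, card_univ, Fintype.card_prod, ZMod.card, sq]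
    rw [h3] at h2
    calc 8 * bad.card ≤ 8 * (q ^ 2 * Br.card * q ^ d) := by gcongr
      _ = (8 * q ^ 2 * Br.card) * q ^ d := by ring
      _ ≤ _ := by gcongr
  have hwbad : ∀ w ∈ W, (univ.filter fun c : V => ¬ GoodPt q D c w).card ≤ q * BR.card := by
    intro w hw
    have h1 : (univ.filter fun c : V => ¬ GoodPt q D c w) ⊆
        ((univ : Finset (ZMod q)) ×ˢ BR).image fun p => 
          (fun x => p.1⁻¹ * (2 ^ D * (w x : ZMod q) - (p.2 x : ZMod q))) := by
      intro c hc
      simp only [mem_filter, mem_univ, true_and] at hc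
      rw [mem_image]
      exact not_good_mem D R BR hBR hR hRq w (hW w hw).1 c hc
    refine (card_le_card h1).trans (card_image_le.trans ?_)
    rw [card_product, card_univ, ZMod.card]
  have hex : ∃ p : V × V, p ∉ bad ∧ W.card ≤ 2 * (W.filter fun w => GoodPt q D p.2 w).card := by
    by_contra hcon
    push Not at hcon
    have e1 : ∑ p : V × V, (W.filter fun w => ¬ GoodPt q D p.2 w).card ≤ q ^ d * (W.card * (q * BR.card)) := by
      rw [Fintype.sum_prod_type]
      simp only
      rw [sum_const, card_univ, hVcard, smul_eq_mul]
      gcongr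
      simp_rw [card_filter]
      rw [sum_comm]
      rw [← smul_eq_mul]
      apply sum_le_card_nsmul
      intro w hw
      rw [← card_filter]
      exact hwbad w hw
    have e2 : (badᶜ).card * (W.card + 1) ≤ ∑ p : V × V, 2 * (W.filter fun w => ¬ GoodPt q D p.2 w).card := by
      calc (badᶜ).card * (W.card + 1) = ∑ p ∈ badᶜ, (W.card + 1) := by simp
        _ ≤ ∑ p ∈ badᶜ, 2 * (W.filter fun w => ¬ GoodPt q D p.2 w).card := by
          apply sum_le_sum
          intro p hp
          have := hcon p (by simpa using hp)
          have h2 := card_filter_add_card_filter_not (s := W) (fun w => GoodPt q D p.2 w)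
          omega
        _ ≤ _ := sum_le_sum_of_subset (subset_univ _)
    rw [← mul_sum] at e2
    have e3 : bad.card + (badᶜ).card = q ^ d * q ^ d := by
      rw [card_add_card_compl, Fintype.card_prod, hVcard]
    have e4 : q ^ d * (W.card * (q * BR.card)) * 8 ≤ q ^ d * q ^ d * W.card := by
      calc _ = q ^ d * W.card * (8 * q * BR.card) := by ring
        _ ≤ q ^ d * W.card * q ^ d := by gcongr
        _ = _ := by ring
    have hpos : 0 < q ^ d * q ^ d := by positivity
    generalize q ^ d * q ^ d = Z at *
    have e5 : 7 * Z ≤ 8 * (badᶜ).card := by omega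
    nlinarith [Nat.mul_le_mul_right (W.card + 1) e5]
  obtain ⟨⟨a, c⟩, hnb, hWg⟩ := hex
  simp only at hWg
  set W' := W.filter fun w => GoodPt q D c w with hW'
  have hnb' : ∀ s : ZMod q × ZMod q, ∀ u ∈ Br, (∀ x, (u x : ZMod q) = s.1 * a x + s.2 * c x) → s = 0 := by
    intro s u hu h
    by_contra hs
    exact hnb (by simp only [bad, mem_filter, mem_univ, true_and]; exact ⟨s, hs, u, hu, h⟩)
  have hind : ∀ n t : ZMod q, (∀ x, n * a x + t * c x = 0) → n = 0 ∧ t = 0 := by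
    intro n t h
    have := hnb' (n, t) 0 (hBr 0 (by simp [gsq]; positivity)) (fun x => by simp [h x])
    exact Prod.mk_eq_zero.mp this
  have hfine : ∀ u : Fin d → ℤ, u ≠ 0 → (∃ n t : ZMod q, ∀ x, (u x : ZMod q) = n * a x + t * c x) →
      4 ^ D * δ < (gsq u : ℝ) := by
    rintro u hu ⟨n, t, h⟩
    by_contra hle
    push Not at hle
    have hs := hnb' (n, t) u (hBr u (hle.trans hδ)) h
    obtain ⟨rfl, rfl⟩ := Prod.mk_eq_zero.mp hs
    have := gsq_ge_of_dvd (q := q) u hu (fun x => by rw [h x]; simp)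
    have h2 : r ^ 2 < (q : ℝ) ^ 2 := pow_lt_pow_left₀ hrq hr (by norm_num)
    linarith
  let s : Finset (ℕ × ZMod q × (Fin d → ℤ)) := Icc 1 N ×ˢ (univ ×ˢ W')
  let f : ℕ × ZMod q × (Fin d → ℤ) → V := fun p x => (p.2.2 x : ZMod q) - p.1 * a x - p.2.1 * c x
  have hscard : s.card = N * q * W'.card := by
    simp [s, card_product, ZMod.card, mul_assoc]
  have hβ : ∃ b : V, s.card ≤ q ^ d * (s.filter fun p => f p = b).card := by
    by_contra hcon
    push Not at hcon
    have h1 := card_eq_sum_card_fiberwise (f := f) (s := s) (t := univ) (fun _ _ => mem_univ _)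
    have h2 : ∑ b : V, q ^ d * (s.filter fun p => f p = b).card < ∑ b : V, s.card := by
      apply sum_lt_sum_of_nonempty ⟨0, mem_univ _⟩
      intro b _
      exact hcon b
    rw [← mul_sum, ← h1, sum_const, card_univ, hVcard, smul_eq_mul] at h2
    exact lt_irrefl _ h2
  obtain ⟨b, hb⟩ := hβ
  have hfib : ∀ p ∈ (s.filter fun p => f p = b), p.1 ∈ Icc 1 N ∧ p.2.2 ∈ W' ∧ 
      ∀ x, (p.2.2 x : ZMod q) = p.1 * a x + b x + p.2.1 * c x := by
    intro p hp
    simp only [s, mem_filter, mem_product, mem_univ, true_and] at hp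
    refine ⟨hp.1.1, hp.1.2, fun x => ?_⟩
    rw [← hp.2]; simp only [f]; ring
  refine ⟨(s.filter fun p => f p = b).image Prod.fst, ?_, ?_, ?_⟩
  · intro n hn
    rw [mem_image] at hn
    obtain ⟨p, hp, rfl⟩ := hn
    exact (hfib p hp).1
  · refine core_free k D N hD hk a b c z δ hfine (fun n t h => (hind n t h).1) _ ?_ hN ?_
    · intro n hn
      rw [mem_image] at hn
      obtain ⟨p, hp, rfl⟩ := hn
      exact (hfib p hp).1
    · intro n hn
      rw [mem_image] at hn
      obtain ⟨p, hp, rfl⟩ := hn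
      obtain ⟨_, h2, h3⟩ := hfib p hp
      rw [hW', mem_filter] at h2
      exact ⟨p.2.2, p.2.1, h2.2, (hW _ h2.1).2.1, (hW _ h2.1).2.2, h3⟩
  · rw [card_image_of_injOn]
    · calc N * q * W.card ≤ N * q * (2 * W'.card) := by gcongr
        _ = 2 * s.card := by rw [hscard]; ring
        _ ≤ 2 * (q ^ d * (s.filter fun p => f p = b).card) := by gcongr
        _ = _ := by ring
    · intro p hp p' hp' heq
      obtain ⟨_, h2, h3⟩ := hfib p hp
      obtain ⟨_, h2', h3'⟩ := hfib p' hp'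
      rw [hW', mem_filter] at h2 h2'
      have hweq : p.2.2 = p'.2.2 := by
        by_contra hne
        have hl0 : p.2.2 - p'.2.2 ≠ 0 := sub_ne_zero.mpr hne
        have hl : InLat q c (p.2.2 - p'.2.2) := by
          refine ⟨p.2.1 - p'.2.1, fun x => ?_⟩
          simp only [Pi.sub_apply, Int.cast_sub]
          rw [h3 x, h3' x, heq]; ring
        have g1 := h2.2 _ hl0 hl
        have g2 := h2'.2 _ hl0 hl
        have g3 : gsq (p.2.2 - p'.2.2) = p.2.2 ⬝ᵥ (p.2.2 - p'.2.2) - p'.2.2 ⬝ᵥ (p.2.2 - p'.2.2) := by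
          rw [gsq_eq_dot, ← sub_dotProduct]
        have g4 : (4 : ℤ) ≤ 2 ^ (D + 1) := by
          calc (4:ℤ) = 2 ^ (1 + 1) := by norm_num
            _ ≤ _ := pow_le_pow_right₀ (by norm_num) (by omega)
        have g5 := le_abs_self (p.2.2 ⬝ᵥ (p.2.2 - p'.2.2))
        have g6 := neg_abs_le (p'.2.2 ⬝ᵥ (p.2.2 - p'.2.2))
        have g7 := abs_nonneg (p.2.2 ⬝ᵥ (p.2.2 - p'.2.2))
        have g8 := abs_nonneg (p'.2.2 ⬝ᵥ (p.2.2 - p'.2.2))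
        have g9 := mul_le_mul_of_nonneg_right g4 g7
        have g10 := mul_le_mul_of_nonneg_right g4 g8
        linarith
      have hteq : p.2.1 = p'.2.1 := by
        have := (hind 0 (p.2.1 - p'.2.1) (fun x => by
          have e := h3 x
          rw [hweq, h3' x, heq] at e
          linear_combination -e)).2
        exact sub_eq_zero.mp this
      exact Prod.ext heq (Prod.ext hteq hweq)
/-- Euclidean norm of a real vector -/
noncomputable def enrm {d : ℕ} (x : Fin d → ℝ) : ℝ := Real.sqrt (∑ i, x i ^ 2)

lemma enrm_eq {d : ℕ} (x : Fin d → ℝ) : enrm x = ‖(WithLp.toLp 2 x : EuclideanSpace ℝ (Fin d))‖ := by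
  simp [enrm, EuclideanSpace.norm_eq]

lemma enrm_add_le {d : ℕ} (x y : Fin d → ℝ) : enrm (x + y) ≤ enrm x + enrm y := by
  simp only [enrm_eq, WithLp.toLp_add]
  exact norm_add_le _ _

lemma enrm_smul {d : ℕ} (c : ℝ) (x : Fin d → ℝ) : enrm (c • x) = |c| * enrm x := by
  simp only [enrm_eq, WithLp.toLp_smul, norm_smul, Real.norm_eq_abs]

lemma enrm_le_of_coord {d : ℕ} (x : Fin d → ℝ) (c : ℝ) (h : ∀ i, |x i| ≤ c) (hc : 0 ≤ c) :
    enrm x ≤ Real.sqrt d * c := by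
  have : ∑ i, x i ^ 2 ≤ d * c ^ 2 := by
    calc ∑ i, x i ^ 2 ≤ ∑ i : Fin d, c ^ 2 := Finset.sum_le_sum fun i _ => by
          rw [← sq_abs]; exact pow_le_pow_left₀ (abs_nonneg _) (h i) 2
      _ = d * c ^ 2 := by simp
  calc enrm x ≤ Real.sqrt (d * c ^ 2) := Real.sqrt_le_sqrt this
    _ = _ := by rw [Real.sqrt_mul (by positivity), Real.sqrt_sq hc]

lemma coord_le_enrm {d : ℕ} (x : Fin d → ℝ) (i : Fin d) : |x i| ≤ enrm x := by
  apply Real.abs_le_sqrt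
  exact Finset.single_le_sum (f := fun i => x i ^ 2) (fun i _ => sq_nonneg _) (Finset.mem_univ i)

lemma continuous_enrm {d : ℕ} : Continuous (enrm : (Fin d → ℝ) → ℝ) := by
  unfold enrm; fun_prop

/-- Euclidean ball in `Fin d → ℝ` -/
def eball (d : ℕ) (X : ℝ) : Set (Fin d → ℝ) := {x | enrm x ≤ X}

open scoped Pointwise in
lemma eball_eq_smul {d : ℕ} {X : ℝ} (hX : 0 < X) : eball d X = X • eball d 1 := by
  ext x
  rw [Set.mem_smul_set_iff_inv_smul_mem₀ hX.ne']
  simp only [eball, Set.mem_ofPred_eq, enrm_smul, abs_inv, abs_of_pos hX]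
  rw [inv_mul_le_iff₀ hX, mul_one]

open MeasureTheory in
/-- volume of the unit ball -/
noncomputable def uvol (d : ℕ) : ℝ := (volume (eball d 1)).toReal

open MeasureTheory in
lemma eball_one_le (d : ℕ) : volume (eball d 1) ≤ ENNReal.ofReal (2 ^ d) := by
  have : eball d 1 ⊆ Set.Icc (fun _ => (-1 : ℝ)) (fun _ => 1) := by
    intro x hx
    have : ∀ i, |x i| ≤ 1 := fun i => (coord_le_enrm x i).trans hx
    exact ⟨fun i => (abs_le.1 (this i)).1, fun i => (abs_le.1 (this i)).2⟩
  refine (measure_mono this).trans ?_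
  rw [Real.volume_Icc_pi]
  simp only [sub_neg_eq_add, Finset.prod_const, Finset.card_univ, Fintype.card_fin]
  rw [ENNReal.ofReal_pow (by norm_num)]
  norm_num

open MeasureTheory in
lemma uvol_le (d : ℕ) : uvol d ≤ 2 ^ d :=
  ENNReal.toReal_le_of_le_ofReal (by positivity) (eball_one_le d)

open MeasureTheory in
lemma volume_eball {d : ℕ} {X : ℝ} (hX : 0 < X) :
    volume (eball d X) = ENNReal.ofReal (uvol d * X ^ d) := by
  rw [eball_eq_smul hX, Measure.addHaar_smul, mul_comm (uvol d), ENNReal.ofReal_mul (by positivity)]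
  congr 1
  · simp [abs_of_pos hX]
  · rw [uvol, ENNReal.ofReal_toReal]
    exact ne_top_of_le_ne_top ENNReal.ofReal_ne_top (eball_one_le d)

open MeasureTheory in
lemma le_uvol (d : ℕ) (hd : 0 < d) : (2 / Real.sqrt d) ^ d ≤ uvol d := by
  have hs : 0 < Real.sqrt d := Real.sqrt_pos.2 (by exact_mod_cast hd)
  have : Set.Icc (fun _ => (-(1 / Real.sqrt d) : ℝ)) (fun _ => 1 / Real.sqrt d) ⊆ eball d 1 := by
    intro x hx
    have h1 : ∀ i, |x i| ≤ 1 / Real.sqrt d := fun i => abs_le.2 ⟨hx.1 i, hx.2 i⟩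
    have := enrm_le_of_coord x _ h1 (by positivity)
    rwa [mul_one_div_cancel hs.ne'] at this
  have h2 := measure_mono (μ := volume) this
  have hf : volume (eball d 1) ≠ ⊤ := ne_top_of_le_ne_top ENNReal.ofReal_ne_top (eball_one_le d)
  have h3 := ENNReal.toReal_mono hf h2
  rw [Real.volume_Icc_pi_toReal (by intro i; have : 0 < 1 / Real.sqrt d := by positivity
                                    simp only; linarith)] at h3
  simp only [sub_neg_eq_add, Finset.prod_const, Finset.card_univ, Fintype.card_fin] at h3
  rw [uvol]
  convert h3 using 2
  ring

lemma uvol_pos (d : ℕ) (hd : 0 < d) : 0 < uvol d := by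
  have hs : 0 < Real.sqrt d := Real.sqrt_pos.2 (by exact_mod_cast hd)
  exact lt_of_lt_of_le (by positivity) (le_uvol d hd)

/-- integer points of a ball -/
noncomputable def iball (d : ℕ) (X : ℝ) : Finset (Fin d → ℤ) :=
  (Fintype.piFinset fun _ => Finset.Icc (-⌈X⌉) ⌈X⌉).filter fun w => (gsq w : ℝ) ≤ X ^ 2

lemma enrm_int {d : ℕ} (w : Fin d → ℤ) : enrm (fun i => (w i : ℝ)) = Real.sqrt (gsq w : ℝ) := by
  simp [enrm, gsq]

lemma mem_iball {d : ℕ} {X : ℝ} (hX : 0 ≤ X) (w : Fin d → ℤ) :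
    w ∈ iball d X ↔ (gsq w : ℝ) ≤ X ^ 2 := by
  simp only [iball, Finset.mem_filter, Fintype.mem_piFinset, Finset.mem_Icc, and_iff_right_iff_imp]
  intro h i
  have h1 := coord_le_enrm (fun i => (w i : ℝ)) i
  rw [enrm_int] at h1
  have h2 : Real.sqrt (gsq w : ℝ) ≤ X := Real.sqrt_le_iff.2 ⟨hX, h⟩
  have h3 := abs_le.1 (h1.trans (h2.trans (Int.le_ceil X)))
  exact ⟨by exact_mod_cast h3.1, by exact_mod_cast h3.2⟩

lemma mem_iball' {d : ℕ} {X : ℝ} (hX : 0 ≤ X) (w : Fin d → ℤ) :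
    w ∈ iball d X ↔ enrm (fun i => (w i : ℝ)) ≤ X := by
  rw [mem_iball hX, enrm_int, Real.sqrt_le_iff]
  simp [hX]

/-- unit cube with integer corner -/
def ucube {d : ℕ} (w : Fin d → ℤ) : Set (Fin d → ℝ) :=
  Set.pi Set.univ fun i => Set.Ico (w i : ℝ) (w i + 1)

lemma mem_ucube {d : ℕ} (w : Fin d → ℤ) (x : Fin d → ℝ) :
    x ∈ ucube w ↔ ∀ i, ⌊x i⌋ = w i := by
  simp [ucube, Int.floor_eq_iff]

open MeasureTheory in
lemma volume_ucube {d : ℕ} (w : Fin d → ℤ) : volume (ucube w) = 1 := by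
  rw [ucube, Real.volume_pi_Ico]
  simp

lemma ucube_dist {d : ℕ} (w : Fin d → ℤ) (x : Fin d → ℝ) (h : x ∈ ucube w) :
    enrm (x - fun i => (w i : ℝ)) ≤ Real.sqrt d ∧ enrm ((fun i => (w i : ℝ)) - x) ≤ Real.sqrt d := by
  rw [mem_ucube] at h
  have h1 : ∀ i, |x i - w i| ≤ 1 := fun i => by
    rw [← h i, abs_le]
    constructor <;> linarith [Int.floor_le (x i), Int.lt_floor_add_one (x i)]
  constructor
  · simpa using enrm_le_of_coord (x - fun i => (w i : ℝ)) 1 (fun i => h1 i) zero_le_one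
  · simpa using enrm_le_of_coord ((fun i => (w i : ℝ)) - x) 1
      (fun i => by simpa [abs_sub_comm] using h1 i) zero_le_one

open MeasureTheory in
lemma iball_card_le {d : ℕ} {X : ℝ} (hX : 0 < X) :
    ((iball d X).card : ℝ) ≤ uvol d * (X + Real.sqrt d) ^ d := by
  have h1 : volume (⋃ w ∈ iball d X, ucube w) = (iball d X).card := by
    rw [measure_biUnion_finset]
    · simp [volume_ucube]
    · intro a _ b _ hab
      refine Set.disjoint_left.2 fun x hxa hxb => hab ?_
      rw [mem_ucube] at hxa hxb
      funext i
      rw [← hxa i, hxb i]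
    · intro b _
      exact MeasurableSet.univ_pi fun i => measurableSet_Ico
  have h2 : (⋃ w ∈ iball d X, ucube w) ⊆ eball d (X + Real.sqrt d) := by
    intro x hx
    simp only [Set.mem_iUnion] at hx
    obtain ⟨w, hw, hx⟩ := hx
    rw [mem_iball' hX.le] at hw
    have := enrm_add_le (fun i => (w i : ℝ)) (x - fun i => (w i : ℝ))
    rw [add_sub_cancel] at this
    exact this.trans (add_le_add hw (ucube_dist w x hx).1)
  have h3 := measure_mono (μ := volume) h2
  have hp : 0 < X + Real.sqrt d := by positivity
  rw [h1, volume_eball hp] at h3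
  have h0 : 0 ≤ uvol d := ENNReal.toReal_nonneg
  have := ENNReal.toReal_mono ENNReal.ofReal_ne_top h3
  rwa [ENNReal.toReal_ofReal (by positivity), ENNReal.toReal_natCast] at this

open MeasureTheory in
lemma le_iball_card {d : ℕ} {X : ℝ} (hX : Real.sqrt d < X) :
    uvol d * (X - Real.sqrt d) ^ d ≤ (iball d X).card := by
  have hX0 : 0 ≤ X := (Real.sqrt_nonneg _).trans hX.le
  have h2 : eball d (X - Real.sqrt d) ⊆ ⋃ w ∈ iball d X, ucube w := by
    intro x hx
    simp only [Set.mem_iUnion]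
    have hc : x ∈ ucube (fun i => ⌊x i⌋) := (mem_ucube _ _).2 fun i => rfl
    refine ⟨fun i => ⌊x i⌋, ?_, hc⟩
    rw [mem_iball' hX0]
    have := enrm_add_le x ((fun i => ((⌊x i⌋ : ℤ) : ℝ)) - x)
    rw [add_sub_cancel] at this
    have h3 := (ucube_dist _ x hc).2
    have h4 : enrm x ≤ X - Real.sqrt d := hx
    linarith
  have h3 := (measure_mono (μ := volume) h2).trans (measure_biUnion_finset_le _ _)
  simp only [volume_ucube, Finset.sum_const, nsmul_eq_mul, mul_one] at h3
  rw [volume_eball (sub_pos.2 hX)] at h3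
  have := ENNReal.toReal_mono (ENNReal.natCast_ne_top _) h3
  have h0 : 0 ≤ uvol d := ENNReal.toReal_nonneg
  have h5 : 0 ≤ X - Real.sqrt d := by linarith
  rwa [ENNReal.toReal_ofReal (by positivity), ENNReal.toReal_natCast] at this
lemma sqrt_le_nat (d : ℕ) : Real.sqrt d ≤ d := by
  rw [Real.sqrt_le_left (by positivity)]
  have : d ≤ d ^ 2 := Nat.le_self_pow (by norm_num) d
  exact_mod_cast this

lemma uvol_nonneg (d : ℕ) : 0 ≤ uvol d := ENNReal.toReal_nonneg

lemma iball_card_le3 {d : ℕ} (hd : 1 ≤ d) {X : ℝ} (hX : (d : ℝ) ^ 2 ≤ X) :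
    ((iball d X).card : ℝ) ≤ 3 * (uvol d * X ^ d) := by
  have hd' : (1 : ℝ) ≤ d := by exact_mod_cast hd
  have hX0 : 0 < X := lt_of_lt_of_le (by positivity) hX
  have hs := sqrt_le_nat d
  have h1 : X + Real.sqrt d ≤ X * Real.exp (1 / d) := by
    have h2 : Real.sqrt d ≤ X * (1 / d) := by
      rw [mul_one_div, le_div_iff₀ (by positivity)]
      nlinarith
    have h3 := Real.add_one_le_exp (1 / (d : ℝ))
    nlinarith
  have h4 : (X + Real.sqrt d) ^ d ≤ X ^ d * 3 := by
    calc (X + Real.sqrt d) ^ d ≤ (X * Real.exp (1 / d)) ^ d :=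
          pow_le_pow_left₀ (by positivity) h1 d
      _ = X ^ d * Real.exp 1 := by
          rw [mul_pow, ← Real.exp_nat_mul, mul_one_div_cancel (by positivity)]
      _ ≤ X ^ d * 3 := by
          have := Real.exp_one_lt_d9
          gcongr
          linarith
  calc ((iball d X).card : ℝ) ≤ uvol d * (X + Real.sqrt d) ^ d := iball_card_le hX0
    _ ≤ uvol d * (X ^ d * 3) := mul_le_mul_of_nonneg_left h4 (uvol_nonneg d)
    _ = _ := by ring

lemma shell_lower {d : ℕ} (hd : 5 ≤ d) {ρ : ℝ} (hρ : 4 * (d : ℝ) ^ 2 ≤ ρ) :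
    uvol d * ρ ^ d / 2 ≤ (iball d ρ).card - (iball d (ρ * (1 - 4 / d))).card := by
  have hd' : (5 : ℝ) ≤ d := by exact_mod_cast hd
  have hρ0 : 0 < ρ := lt_of_lt_of_le (by positivity) hρ
  have hs := sqrt_le_nat d
  have hs0 := Real.sqrt_nonneg d
  have hlt : (4 : ℝ) / d < 1 := by rw [div_lt_one (by positivity)]; linarith
  have hA : ρ ^ d * (3 / 4) ≤ (ρ - Real.sqrt d) ^ d := by
    have h1 : Real.sqrt d / ρ ≤ 1 := by rw [div_le_one hρ0]; nlinarith
    have h2 := one_add_mul_le_pow (a := -(Real.sqrt d / ρ)) (by linarith) d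
    have h3 : (d : ℝ) * (Real.sqrt d / ρ) ≤ 1 / 4 := by
      rw [← mul_div_assoc, div_le_iff₀ hρ0]; nlinarith
    have h4 : ρ - Real.sqrt d = ρ * (1 + -(Real.sqrt d / ρ)) := by field_simp; ring
    rw [h4, mul_pow]
    gcongr
    linarith
  have hB : (ρ * (1 - 4 / d) + Real.sqrt d) ^ d ≤ ρ ^ d * (1 / 4) := by
    have h1 : ρ * (1 - 4 / d) + Real.sqrt d ≤ ρ * Real.exp (-(2 / d)) := by
      have h2 : Real.sqrt d ≤ ρ * (2 / d) := by
        rw [← mul_div_assoc, le_div_iff₀ (by positivity)]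
        nlinarith
      have h3 := Real.add_one_le_exp (-(2 / (d : ℝ)))
      have h5 : ρ * (4 / d) = 2 * (ρ * (2 / d)) := by ring
      nlinarith
    have h0 : 0 ≤ ρ * (1 - 4 / d) + Real.sqrt d := by
      have : 0 ≤ ρ * (1 - 4 / d) := mul_nonneg hρ0.le (by linarith)
      linarith
    calc (ρ * (1 - 4 / d) + Real.sqrt d) ^ d ≤ (ρ * Real.exp (-(2 / d))) ^ d :=
          pow_le_pow_left₀ h0 h1 d
      _ = ρ ^ d * Real.exp (-2) := by
          rw [mul_pow, ← Real.exp_nat_mul]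
          congr 2
          field_simp
      _ ≤ ρ ^ d * (1 / 4) := by
          gcongr
          rw [Real.exp_neg, ← one_div]
          apply one_div_le_one_div_of_le (by norm_num)
          have h6 := Real.add_one_le_exp 1
          have h7 : Real.exp 2 = Real.exp 1 * Real.exp 1 := by rw [← Real.exp_add]; norm_num
          nlinarith
  have h1 := le_iball_card (d := d) (X := ρ) (by nlinarith)
  have h2 := iball_card_le (d := d) (X := ρ * (1 - 4 / d)) (mul_pos hρ0 (by linarith))
  have h3 := mul_le_mul_of_nonneg_left hA (uvol_nonneg d)
  have h4 := mul_le_mul_of_nonneg_left hB (uvol_nonneg d)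
  linarith

lemma window_pigeon {d : ℕ} (hd : 5 ≤ d) {ρ δ : ℝ} (hρ : 4 * (d : ℝ) ^ 2 ≤ ρ) (hδ : 0 < δ) :
    ∃ (W : Finset (Fin d → ℤ)) (z : ℝ),
      (∀ w ∈ W, (gsq w : ℝ) ≤ ρ ^ 2 ∧ z - δ < (gsq w : ℝ) ∧ (gsq w : ℝ) ≤ z) ∧
      uvol d * ρ ^ d / 2 ≤ (8 * ρ ^ 2 / (d * δ) + 1) * W.card := by
  have hd' : (5 : ℝ) ≤ d := by exact_mod_cast hd
  have hρ0 : 0 < ρ := lt_of_lt_of_le (by positivity) hρ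
  have hlt : (4 : ℝ) / d < 1 := by rw [div_lt_one (by positivity)]; linarith
  have hp : 0 ≤ ρ * (1 - 4 / d) := mul_nonneg hρ0.le (by linarith)
  set S := iball d ρ \ iball d (ρ * (1 - 4 / d)) with hS
  have hScard : uvol d * ρ ^ d / 2 ≤ S.card := by
    have h1 := shell_lower hd hρ
    have h2 : (iball d ρ).card - (iball d (ρ * (1 - 4 / d))).card ≤ S.card := by
      rw [hS]; convert Finset.le_card_sdiff (iball d (ρ * (1 - 4 / d))) (iball d ρ)
    have h3 : ((iball d ρ).card : ℝ) ≤ S.card + (iball d (ρ * (1 - 4 / d))).card := by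
      have : (iball d ρ).card ≤ S.card + (iball d (ρ * (1 - 4 / d))).card := by omega
      exact_mod_cast this
    linarith
  set K := ⌊8 * ρ ^ 2 / (d * δ)⌋₊ with hK
  set f : (Fin d → ℤ) → ℕ := fun w => ⌊(ρ ^ 2 - gsq w) / δ⌋₊ with hf
  have hmem : ∀ w ∈ S, (gsq w : ℝ) ≤ ρ ^ 2 ∧ ρ ^ 2 - gsq w ≤ 8 * ρ ^ 2 / d := by
    intro w hw
    rw [hS, Finset.mem_sdiff, mem_iball hρ0.le, mem_iball hp, not_le] at hw
    refine ⟨hw.1, ?_⟩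
    have h1 : (ρ * (1 - 4 / d)) ^ 2 = ρ ^ 2 - 8 * ρ ^ 2 / d + (4 * ρ / d) ^ 2 := by
      field_simp; ring
    nlinarith [sq_nonneg (4 * ρ / d), hw.2]
  have hmaps : ∀ w ∈ S, f w ∈ Finset.range (K + 1) := by
    intro w hw
    rw [Finset.mem_range, Nat.lt_succ_iff]
    apply Nat.floor_le_floor
    rw [← div_div]
    exact div_le_div_of_nonneg_right (hmem w hw).2 hδ.le
  have hKpos : (0 : ℝ) < K + 1 := by positivity
  obtain ⟨j, -, hj⟩ := Finset.exists_le_card_fiber_of_nsmul_le_card_of_maps_to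
    (s := S) (t := Finset.range (K + 1)) (f := f) (b := (S.card : ℝ) / (K + 1)) hmaps (by simp)
    (by simp only [Finset.card_range, nsmul_eq_mul, Nat.cast_add, Nat.cast_one]
        rw [mul_div_cancel₀ _ hKpos.ne'])
  refine ⟨S.filter (fun w => f w = j), ρ ^ 2 - j * δ, ?_, ?_⟩
  · intro w hw
    rw [Finset.mem_filter] at hw
    obtain ⟨hw, hwj⟩ := hw
    have h1 := hmem w hw
    have h2 : 0 ≤ (ρ ^ 2 - gsq w) / δ := div_nonneg (by linarith) hδ.le
    have h3 := Nat.floor_le h2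
    have h4 := Nat.lt_floor_add_one ((ρ ^ 2 - gsq w) / δ)
    have hwj' : ⌊(ρ ^ 2 - gsq w) / δ⌋₊ = j := hwj
    rw [hwj'] at h3 h4
    rw [le_div_iff₀ hδ] at h3
    rw [div_lt_iff₀ hδ] at h4
    exact ⟨h1.1, by linarith, by linarith⟩
  · rw [div_le_iff₀ hKpos] at hj
    have h5 : (K : ℝ) ≤ 8 * ρ ^ 2 / (d * δ) := Nat.floor_le (by positivity)
    have h6 : (0 : ℝ) ≤ ((S.filter (fun w => f w = j)).card : ℝ) := by positivity
    nlinarith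

set_option maxHeartbeats 1600000 in
lemma build {d q : ℕ} [hq : Fact q.Prime] (k D N : ℕ) (hD : 1 ≤ D) (hk : 2 * D < k) (hN : N < q)
    (hN0 : 0 < N) (hd : 5 ≤ d) (t : ℝ) (ht : 0 < t) (htd : t ^ d = q) (h1 : Real.sqrt d < t)
    (h2 : 192 * 2 ^ D * (d : ℝ) ^ 2 ≤ t ^ (d - 2)) :
    ∃ A ⊆ Finset.Icc 1 N, ¬ HasProgression A k D ∧
      (d : ℝ) / (864 * t ^ 2 * 2 ^ (D * d)) ≤ (A.card : ℝ) / N := by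
  have hd' : (5 : ℝ) ≤ d := by exact_mod_cast hd
  have hq0 : (0 : ℝ) < q := by exact_mod_cast hq.out.pos
  have hv := uvol_pos d (by omega)
  have hs1 : 1 ≤ Real.sqrt d := by rw [Real.one_le_sqrt]; linarith
  have ht1 : 1 ≤ t := by linarith
  have hdt : (d : ℝ) ≤ t ^ 2 := by
    have := Real.sq_sqrt (show (0 : ℝ) ≤ d by positivity)
    nlinarith
  have hd0 : d ≠ 0 := by omega
  obtain ⟨e, rfl⟩ : ∃ e, d = e + 2 := ⟨d - 2, by omega⟩
  simp only [Nat.add_sub_cancel] at h2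
  set d := e + 2 with hde
  obtain ⟨R, hR0, hRd⟩ : ∃ R : ℝ, 0 < R ∧ uvol d * R ^ d = (q : ℝ) ^ (e + 1) / 24 := by
    refine ⟨((q : ℝ) ^ (e + 1) / 24 / uvol d) ^ ((d : ℝ)⁻¹), by positivity, ?_⟩
    rw [Real.rpow_inv_natCast_pow (by positivity) hd0]
    field_simp
  set r := R / t with hr
  have hr0 : 0 < r := by positivity
  have hrd : uvol d * r ^ d = (q : ℝ) ^ e / 24 := by
    rw [hr, div_pow, htd, ← mul_div_assoc, hRd, pow_succ]
    field_simp
  have hqt : (q : ℝ) ^ (e + 1) = (t ^ (e + 1)) ^ d := by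
    rw [← htd, ← pow_mul, ← pow_mul, mul_comm]
  have hRlow : t ^ (e + 1) / 48 ≤ R := by
    refine le_of_pow_le_pow_left₀ hd0 hR0.le ?_
    have h3 : uvol d * R ^ d ≤ 2 ^ d * R ^ d :=
      mul_le_mul_of_nonneg_right (uvol_le d) (by positivity)
    rw [hRd, hqt] at h3
    have h4 : (24 : ℝ) ≤ 24 ^ d := le_self_pow₀ (by norm_num) hd0
    rw [div_pow, div_le_iff₀ (by positivity)]
    have h5 : (48 : ℝ) ^ d = 2 ^ d * 24 ^ d := by rw [← mul_pow]; norm_num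
    rw [h5]
    have h6 : 0 ≤ 2 ^ d * R ^ d := by positivity
    nlinarith
  have hRup : 2 * R < q := by
    have h3 : R ≤ t ^ (e + 1) * (Real.sqrt d / 2) := by
      refine le_of_pow_le_pow_left₀ hd0 (by positivity) ?_
      have h4 := mul_le_mul_of_nonneg_right (le_uvol d (by omega)) (show 0 ≤ R ^ d by positivity)
      rw [hRd, hqt] at h4
      rw [mul_pow]
      have h5 : (2 / Real.sqrt d) ^ d * (Real.sqrt d / 2) ^ d = 1 := by
        rw [← mul_pow]
        have : 2 / Real.sqrt d * (Real.sqrt d / 2) = 1 := by field_simp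
        rw [this, one_pow]
      have h6 := mul_le_mul_of_nonneg_right h4 (show 0 ≤ (Real.sqrt d / 2) ^ d by positivity)
      have h7 : 0 ≤ (t ^ (e + 1)) ^ d * (Real.sqrt d / 2) ^ d := by positivity
      calc R ^ d = (2 / Real.sqrt d) ^ d * R ^ d * (Real.sqrt d / 2) ^ d := by
            rw [mul_right_comm, h5, one_mul]
        _ ≤ (t ^ (e + 1)) ^ d / 24 * (Real.sqrt d / 2) ^ d := h6
        _ ≤ _ := by linarith
    have h8 : (q : ℝ) = t ^ (e + 1) * t := by rw [← htd, hde, ← pow_succ]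
    rw [h8]
    have h9 : t ^ (e + 1) * Real.sqrt d < t ^ (e + 1) * t := by gcongr
    linarith
  have hrq : r < q := by
    have : r ≤ R := div_le_self hR0.le ht1
    linarith
  have hDp : (1 : ℝ) ≤ 2 ^ D := one_le_pow₀ (by norm_num)
  have hrlow : 4 * 2 ^ D * (d : ℝ) ^ 2 ≤ r := by
    rw [hr, le_div_iff₀ ht]
    rw [pow_succ] at hRlow
    have := mul_le_mul_of_nonneg_right h2 ht.le
    linarith
  have hrR : r ≤ R := div_le_self hR0.le ht1
  have hd2 : 4 * (d : ℝ) ^ 2 ≤ 4 * 2 ^ D * (d : ℝ) ^ 2 := by nlinarith [sq_nonneg (d : ℝ)]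
  have hd3 : (d : ℝ) ^ 2 ≤ 4 * (d : ℝ) ^ 2 := by nlinarith
  set ρ := R / 2 ^ D with hρ
  have hρlow : 4 * (d : ℝ) ^ 2 ≤ ρ := by
    rw [hρ, le_div_iff₀ (by positivity)]
    linarith
  set δ := r ^ 2 / 4 ^ D with hδ
  obtain ⟨W, z, hW, hWc⟩ := window_pigeon (d := d) hd hρlow (δ := δ) (by positivity)
  have h42 : (4 : ℝ) ^ D = (2 ^ D) ^ 2 := by rw [← pow_mul, mul_comm, pow_mul]; norm_num
  have hρ2 : (4 : ℝ) ^ D * ρ ^ 2 = R ^ 2 := by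
    rw [h42, hρ]; field_simp
  obtain ⟨A, hA, hAp, hAc⟩ := exists_set (d := d) (q := q) k D N hD hk hN R r z δ
    (iball d R) (iball d r) W
    (fun u hu => (mem_iball hR0.le u).2 hu) (fun u hu => (mem_iball hr0.le u).2 hu)
    hR0.le hRup hr0.le hrq
    (by
      have h3 := iball_card_le3 (d := d) (by omega) (X := R) (by linarith)
      rw [hRd] at h3
      have : (8 * q * (iball d R).card : ℝ) ≤ (q : ℝ) ^ d := by
        rw [hde, pow_succ]
        nlinarith
      exact_mod_cast this)
    (by
      have h3 := iball_card_le3 (d := d) (by omega) (X := r) (by linarith)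
      rw [hrd] at h3
      have : (8 * (q : ℝ) ^ 2 * (iball d r).card : ℝ) ≤ (q : ℝ) ^ d := by
        rw [hde, pow_add]
        have : (0 : ℝ) < (q : ℝ) ^ 2 := by positivity
        nlinarith
      exact_mod_cast this)
    (fun w hw => ⟨by
      rw [← hρ2]
      exact mul_le_mul_of_nonneg_left (hW w hw).1 (by positivity), (hW w hw).2⟩)
    (by rw [hδ]; field_simp; rfl)
  refine ⟨A, hA, hAp, ?_⟩
  have hJ : 8 * ρ ^ 2 / (d * δ) + 1 ≤ 9 * t ^ 2 / d := by
    have h3 : 8 * ρ ^ 2 / (d * δ) = 8 * t ^ 2 / d := by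
      rw [hδ, hρ, hr, h42]; field_simp
    rw [h3]
    have h4 : 1 ≤ t ^ 2 / d := by rw [le_div_iff₀ (by positivity)]; linarith
    have h5 : 9 * t ^ 2 / d = 8 * t ^ 2 / d + t ^ 2 / d := by ring
    linarith
  have hρd : uvol d * ρ ^ d = (q : ℝ) ^ (e + 1) / 24 / 2 ^ (D * d) := by
    rw [hρ, div_pow, ← mul_div_assoc, hRd, ← pow_mul]
  have hWc2 : (q : ℝ) ^ (e + 1) / 24 / 2 ^ (D * d) / 2 ≤ 9 * t ^ 2 / d * W.card := by
    rw [← hρd]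
    exact hWc.trans (mul_le_mul_of_nonneg_right hJ (by positivity))
  have hAc' : (N * q * W.card : ℝ) ≤ 2 * (q : ℝ) ^ d * A.card := by exact_mod_cast hAc
  have hqd : (q : ℝ) ^ d = (q : ℝ) ^ (e + 1) * q := by rw [hde, ← pow_succ]
  have hNr : (0 : ℝ) < N := by exact_mod_cast hN0
  have hAc2 : (N * W.card : ℝ) ≤ 2 * (q : ℝ) ^ (e + 1) * A.card := by
    rw [hqd] at hAc'
    refine le_of_mul_le_mul_right ?_ hq0
    linarith
  rw [div_le_div_iff₀ (by positivity) hNr]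
  have hQ : (0 : ℝ) < (q : ℝ) ^ (e + 1) := by positivity
  rw [div_div, div_div, div_le_iff₀ (by positivity)] at hWc2
  have h10 : 9 * t ^ 2 / d * W.card * (24 * 2 ^ (D * d) * 2) * d =
      432 * t ^ 2 * 2 ^ (D * d) * W.card := by
    have h14 : 9 * t ^ 2 / d * d = 9 * t ^ 2 := div_mul_cancel₀ _ (by positivity)
    linear_combination (W.card * (24 * 2 ^ (D * d) * 2) : ℝ) * h14
  have h11 := mul_le_mul_of_nonneg_right hWc2 (show (0 : ℝ) ≤ d by positivity)
  have h11' : (q : ℝ) ^ (e + 1) * d ≤ 432 * t ^ 2 * 2 ^ (D * d) * W.card := by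
    rw [← h10]; linarith
  refine le_of_mul_le_mul_left ?_ hQ
  have h12 := mul_le_mul_of_nonneg_right h11' hNr.le
  have h13 := mul_le_mul_of_nonneg_left hAc2 (show 0 ≤ 432 * t ^ 2 * 2 ^ (D * d) by positivity)
  linarith
lemma card_le_rkD (k D N : ℕ) (A : Finset ℕ) (hA : A ⊆ Finset.Icc 1 N)
    (h : ¬ HasProgression A k D) : A.card ≤ rkD k D N := by
  refine le_csSup ⟨N, ?_⟩ ⟨A, hA, h, rfl⟩
  rintro m ⟨B, hB, -, rfl⟩
  simpa using Finset.card_le_card hB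

lemma nat_lt_two_pow_sub (m : ℕ) (hm : 3 ≤ m) : m + 2 < 2 ^ m := by
  induction m, hm using Nat.le_induction with
  | base => norm_num
  | succ n hn ih => rw [pow_succ]; omega

set_option maxHeartbeats 1600000 in
lemma final_bound (k D : ℕ) (hD : 1 ≤ D) (hk : 2 * D < k) (N : ℕ) (hN0 : 0 < N)
    (hl : (D : ℝ) * (2 * D + 10) ^ 2 ≤ 2 * Real.logb 2 N) :
    Real.sqrt (2 * Real.logb 2 N / D) / (864 * (2 : ℝ) ^ (D + Real.sqrt (8 * D))) /
      (2 : ℝ) ^ (Real.sqrt (8 * D * Real.logb 2 N)) ≤ (rkD k D N : ℝ) / N := by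
  obtain ⟨q, hq, hNq, hq2⟩ := Nat.exists_prime_lt_and_le_two_mul N hN0.ne'
  haveI : Fact q.Prime := ⟨hq⟩
  have hD' : (1 : ℝ) ≤ D := by exact_mod_cast hD
  have hN' : (0 : ℝ) < N := by exact_mod_cast hN0
  have hq' : (0 : ℝ) < q := by exact_mod_cast hq.pos
  set l := Real.logb 2 N with hldef
  set L := Real.logb 2 q with hLdef
  have hlL : l ≤ L := Real.logb_le_logb_of_le (by norm_num) hN' (by exact_mod_cast hNq.le)
  have hLl : L ≤ l + 1 := by
    have h1 : L ≤ Real.logb 2 (2 * N) :=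
      Real.logb_le_logb_of_le (by norm_num) hq' (by exact_mod_cast hq2)
    rw [Real.logb_mul (by norm_num) hN'.ne', Real.logb_self_eq_one (by norm_num)] at h1
    linarith
  have hl0 : 0 ≤ l := by
    have : 0 ≤ (D : ℝ) * (2 * D + 10) ^ 2 := by positivity
    linarith
  have hL0 : 0 ≤ L := hl0.trans hlL
  set x := Real.sqrt (2 * L / D) with hx
  have hx2 : D * x ^ 2 = 2 * L := by
    rw [hx, Real.sq_sqrt (by positivity)]; field_simp
  have hx0 : 0 ≤ x := Real.sqrt_nonneg _
  have hxlow : 2 * (D : ℝ) + 10 ≤ x := by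
    apply Real.le_sqrt_of_sq_le
    rw [le_div_iff₀ (by positivity)]
    linarith
  set d := ⌈x⌉₊ with hd
  have hxd : x ≤ d := Nat.le_ceil x
  have hdx : (d : ℝ) < x + 1 := Nat.ceil_lt_add_one hx0
  have hdlow : 2 * D + 10 ≤ d := by
    have : (2 * (D : ℝ) + 10) ≤ d := hxlow.trans hxd
    exact_mod_cast this
  have hdpos : (0 : ℝ) < d := by linarith
  obtain ⟨m, hm⟩ : ∃ m, d = m + 2 := ⟨d - 2, by omega⟩
  have hmr : (d : ℝ) = m + 2 := by rw [hm]; push_cast; ring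
  set t : ℝ := (2 : ℝ) ^ (L / d) with ht
  have ht0 : 0 < t := by positivity
  have htd : t ^ d = q := by
    rw [ht, ← Real.rpow_natCast, ← Real.rpow_mul (by norm_num), div_mul_cancel₀ _ hdpos.ne',
      Real.rpow_logb (by norm_num) (by norm_num) hq']
  have ht2 : t ^ 2 = (2 : ℝ) ^ (2 * L / d) := by
    rw [ht, ← Real.rpow_natCast, ← Real.rpow_mul (by norm_num)]
    congr 1
    push_cast; ring
  have ht2m : (2 : ℝ) ^ m ≤ t ^ 2 := by
    rw [ht2, ← Real.rpow_natCast]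
    apply Real.rpow_le_rpow_of_exponent_le (by norm_num)
    rw [le_div_iff₀ hdpos, ← hx2]
    have h1 : (m : ℝ) + 1 ≤ x := by linarith
    have h2 : ((m : ℝ) + 1) ^ 2 ≤ x ^ 2 := pow_le_pow_left₀ (by positivity) h1 2
    have h3 : x ^ 2 ≤ D * x ^ 2 := le_mul_of_one_le_left (sq_nonneg x) hD'
    rw [hmr]
    nlinarith
  have hm2 : (d : ℝ) < 2 ^ m := by
    have := nat_lt_two_pow_sub m (by omega)
    rw [← hm] at this
    exact_mod_cast this
  have h1 : Real.sqrt d < t := by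
    rw [Real.sqrt_lt' ht0]; linarith
  have h2 : 192 * 2 ^ D * (d : ℝ) ^ 2 ≤ t ^ (d - 2) := by
    have hdm : d - 2 = m := by omega
    rw [hdm]
    refine le_of_pow_le_pow_left₀ two_ne_zero (by positivity) ?_
    calc (192 * 2 ^ D * (d : ℝ) ^ 2) ^ 2 ≤ (2 ^ 8 * 2 ^ D * (2 ^ m) ^ 2) ^ 2 := by
          gcongr
          norm_num
      _ = (2 : ℝ) ^ (16 + 2 * D + 4 * m) := by ring
      _ ≤ (2 : ℝ) ^ (m * m) := by
          apply pow_le_pow_right₀ (by norm_num)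
          have : 2 * D + 8 ≤ m := by omega
          nlinarith
      _ = (2 ^ m) ^ m := by rw [pow_mul]
      _ ≤ (t ^ 2) ^ m := by gcongr
      _ = (t ^ m) ^ 2 := by rw [← pow_mul, ← pow_mul, mul_comm]
  obtain ⟨A, hA, hAp, hAc⟩ := build (d := d) (q := q) k D N hD hk hNq hN0 (by omega) t ht0 htd h1 h2
  have hAr : (A.card : ℝ) ≤ rkD k D N := by exact_mod_cast card_le_rkD k D N A hA hAp
  refine le_trans ?_ (hAc.trans (div_le_div_of_nonneg_right hAr hN'.le))
  have hexp : t ^ 2 * 2 ^ (D * d) ≤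
      (2 : ℝ) ^ (D + Real.sqrt (8 * D)) * (2 : ℝ) ^ (Real.sqrt (8 * D * l)) := by
    rw [ht2, ← Real.rpow_natCast, ← Real.rpow_add (by norm_num), ← Real.rpow_add (by norm_num)]
    apply Real.rpow_le_rpow_of_exponent_le (by norm_num)
    have e1 : 2 * D * x = Real.sqrt (8 * D * L) := by
      rw [eq_comm, Real.sqrt_eq_iff_mul_self_eq (by positivity) (by positivity)]
      linear_combination (-4 * D : ℝ) * hx2
    have e2 : Real.sqrt (8 * D * L) ≤ Real.sqrt (8 * D * l) + Real.sqrt (8 * D) := by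
      rw [Real.sqrt_le_left (by positivity)]
      have s1 := Real.sq_sqrt (show 0 ≤ 8 * D * l by positivity)
      have s2 := Real.sq_sqrt (show (0 : ℝ) ≤ 8 * D by positivity)
      have s3 : 0 ≤ Real.sqrt (8 * D * l) * Real.sqrt (8 * D) := by positivity
      nlinarith
    have e3 : 2 * L / d + ((D * d : ℕ) : ℝ) ≤ 2 * D * x + D := by
      push_cast
      rw [← hx2, div_add' _ _ _ hdpos.ne', div_le_iff₀ hdpos]
      have h3 : ((d : ℝ) - x) ^ 2 ≤ d := by
        have h4 : ((d : ℝ) - x) ^ 2 ≤ 1 := by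
          apply pow_le_one₀ <;> linarith
        linarith
      have h5 := mul_le_mul_of_nonneg_left h3 (show (0 : ℝ) ≤ D by linarith)
      linarith
    linarith
  rw [div_div]
  have hnum : Real.sqrt (2 * l / D) ≤ d := by
    refine le_trans (Real.sqrt_le_sqrt ?_) hxd
    gcongr
  apply div_le_div₀ hdpos.le hnum (by positivity)
  linarith

theorem stmt14 (k D : ℕ) (hD : 1 ≤ D) (hk : 2 * D < k) (ε : ℝ) (hε : 0 < ε) :
    ∃ N₀ : ℕ, ∀ N : ℕ, N₀ ≤ N →
      (rkD k D N : ℝ) / N ≥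
        (Real.sqrt 90 / (Real.exp 1 * Real.pi ^ ((3 : ℝ) / 2)) *
            ((2 : ℝ) ^ D / (D : ℝ) ^ ((1 : ℝ) / 4)) * ((2 * D).choose D : ℝ) - ε) *
          (2 * Real.logb 2 N) ^ ((1 : ℝ) / 4) /
            (2 : ℝ) ^ (Real.sqrt (8 * D * Real.logb 2 N)) := by
  generalize (Real.sqrt 90 / (Real.exp 1 * Real.pi ^ ((3 : ℝ) / 2)) *
            ((2 : ℝ) ^ D / (D : ℝ) ^ ((1 : ℝ) / 4)) * ((2 * D).choose D : ℝ) - ε) = C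
  have hD' : (1 : ℝ) ≤ D := by exact_mod_cast hD
  have hlog : Filter.Tendsto (fun N : ℕ => 2 * Real.logb 2 (N : ℝ)) Filter.atTop Filter.atTop :=
    ((Real.tendsto_logb_atTop one_lt_two).comp tendsto_natCast_atTop_atTop).const_mul_atTop
      two_pos
  have hrp : Filter.Tendsto (fun N : ℕ => (2 * Real.logb 2 (N : ℝ)) ^ ((1 : ℝ) / 4))
      Filter.atTop Filter.atTop :=
    (tendsto_rpow_atTop (by norm_num)).comp hlog
  set K : ℝ := 864 * (2 : ℝ) ^ (D + Real.sqrt (8 * D)) with hK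
  have hK0 : 0 < K := by positivity
  have hsD : 0 < Real.sqrt D := Real.sqrt_pos.2 (by linarith)
  have hev := (hlog.eventually_ge_atTop ((D : ℝ) * (2 * D + 10) ^ 2)).and
    ((hrp.eventually_ge_atTop (C * (K * Real.sqrt D))).and (Filter.eventually_gt_atTop 0))
  obtain ⟨N₀, hN₀⟩ := Filter.eventually_atTop.1 hev
  refine ⟨N₀, fun N hN => ?_⟩
  obtain ⟨h1, h2, h3⟩ := hN₀ N hN
  refine ge_iff_le.2 (le_trans ?_ (final_bound k D hD hk N h3 h1))
  have hl0 : 0 ≤ 2 * Real.logb 2 (N : ℝ) := le_trans (by positivity) h1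
  have hy0 : 0 ≤ (2 * Real.logb 2 (N : ℝ)) ^ ((1 : ℝ) / 4) := Real.rpow_nonneg hl0 _
  have hy : Real.sqrt (2 * Real.logb 2 N) = (2 * Real.logb 2 (N : ℝ)) ^ ((1 : ℝ) / 4) *
      (2 * Real.logb 2 (N : ℝ)) ^ ((1 : ℝ) / 4) := by
    rw [Real.sqrt_eq_rpow, ← Real.rpow_add_of_nonneg hl0 (by norm_num) (by norm_num)]
    norm_num
  apply div_le_div_of_nonneg_right _ (by positivity)
  rw [Real.sqrt_div hl0, hy, div_div, le_div_iff₀ (by positivity)]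
  have := mul_le_mul_of_nonneg_right h2 hy0
  linarith
end

section
/- Let k and D be integers with D ≥ 1 and k > 2D. There exist a positive constant C and an integer d_0 such that for every integer d ≥ d_0 and every real number N for which N_0 := (e·π/(3√5)) · (4^D · binom(2D, D))^{−1} · N^{2/d} · d^{−1/2} satisfies N_0 ≥ 1, one has r_{k,D}(N)/N ≥ C · 2^{−dD} · r_{k,2D}(N_0)/N_0. -/
/-- For a real `x ≥ 1`, `rkDR k D x` is the maximum size of a subset of `[1,x] ∩ ℤ`
containing no `k`-term `D`-progression. -/
noncomputable def rkDR (k D : ℕ) (x : ℝ) : ℕ :=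
  sSup {m | ∃ A : Finset ℕ, (∀ a ∈ A, 1 ≤ a ∧ (a : ℝ) ≤ x) ∧
    ¬ HasProgression A k D ∧ A.card = m}

/-- Iterated forward difference of a sequence. -/
def dl {R : Type*} [CommRing R] : ℕ → (ℕ → R) → ℕ → R
  | 0, f, y => f y
  | (n + 1), f, y => dl n f (y + 1) - dl n f y

lemma dl_map {R S : Type*} [CommRing R] [CommRing S] (φ : R →+* S) (n : ℕ) (f : ℕ → R) (y : ℕ) :
    φ (dl n f y) = dl n (fun j => φ (f j)) y := by
  induction n generalizing y with
  | zero => simp [dl]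
  | succ n ih => simp [dl, ih]

lemma dl_congr {R : Type*} [CommRing R] (n : ℕ) (f g : ℕ → R) (y : ℕ)
    (h : ∀ j, y ≤ j → j ≤ y + n → f j = g j) : dl n f y = dl n g y := by
  induction n generalizing y with
  | zero => simpa [dl] using h y le_rfl le_rfl
  | succ n ih =>
    simp only [dl]
    rw [ih (y + 1) (fun j h1 h2 => h j (by omega) (by omega)),
      ih y (fun j h1 h2 => h j (by omega) (by omega))]

lemma dl_add {R : Type*} [CommRing R] (n : ℕ) (f g : ℕ → R) (y : ℕ) :
    dl n (fun j => f j + g j) y = dl n f y + dl n g y := by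
  induction n generalizing y with
  | zero => simp [dl]
  | succ n ih => simp only [dl, ih]; ring

lemma dl_mul {R : Type*} [CommRing R] (n : ℕ) (f : ℕ → R) (c : R) (y : ℕ) :
    dl n (fun j => f j * c) y = dl n f y * c := by
  induction n generalizing y with
  | zero => simp [dl]
  | succ n ih => simp only [dl, ih]; ring

lemma dl_const {R : Type*} [CommRing R] (n : ℕ) (hn : 0 < n) (c : R) (y : ℕ) :
    dl n (fun _ => c) y = 0 := by
  obtain ⟨n, rfl⟩ : ∃ m, n = m + 1 := ⟨n - 1, by omega⟩
  induction n generalizing y with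
  | zero => simp [dl]
  | succ n ih =>
    rw [dl, ih _ (by omega), ih _ (by omega), sub_zero]

lemma dl_bound (n : ℕ) (f : ℕ → ℤ) (B : ℤ) (y : ℕ)
    (h : ∀ j, y ≤ j → j ≤ y + (n + 1) → 0 ≤ f j ∧ f j ≤ B) : |dl (n + 1) f y| ≤ 2 ^ n * B := by
  induction n generalizing y with
  | zero =>
    have h1 := h y le_rfl (by omega)
    have h2 := h (y + 1) (by omega) (by omega)
    simp only [dl, abs_le]
    constructor <;> omega
  | succ n ih =>
    have h1 := ih y (fun j h1 h2 => h j h1 (by omega))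
    have h2 := ih (y + 1) (fun j h1 h2 => h j (by omega) (by omega))
    rw [dl]
    calc _ ≤ |dl (n + 1) f (y + 1)| + |dl (n + 1) f y| := abs_sub _ _
      _ ≤ _ := by rw [pow_succ]; linarith

lemma dl_last {R : Type*} [CommRing R] (n : ℕ) (f : ℕ → R) (y : ℕ)
    (h : ∀ j, y ≤ j → j < y + n → f j = 0) : dl n f y = f (y + n) := by
  induction n generalizing y with
  | zero => simp [dl]
  | succ n ih =>
    rw [dl, ih (y + 1) (fun j h1 h2 => h j (by omega) (by omega)),
      ih y (fun j h1 h2 => h j h1 (by omega)), h (y + n) (by omega) (by omega), sub_zero]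
    congr 1; ring

lemma dl_eval (n : ℕ) (P : Polynomial ℝ) (y : ℕ) :
    dl n (fun j => P.eval (j : ℝ)) y = (fwdDiff 1)^[n] P.eval (y : ℝ) := by
  induction n generalizing y with
  | zero => simp [dl]
  | succ n ih =>
    rw [dl, ih, ih, Function.iterate_succ_apply', fwdDiff]; push_cast; rfl

lemma dl_poly_zero (n : ℕ) (P : Polynomial ℝ) (hP : P.natDegree < n) (y : ℕ) :
    dl n (fun j => P.eval (j : ℝ)) y = 0 := by
  rw [dl_eval, Polynomial.fwdDiff_iter_eq_zero_of_degree_lt hP]; rfl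

lemma dl_poly_coeff (n : ℕ) (P : Polynomial ℝ) (hP : P.natDegree ≤ n) (y : ℕ) :
    dl n (fun j => P.eval (j : ℝ)) y = P.coeff n * n.factorial := by
  rcases hP.lt_or_eq with h | h
  · rw [dl_poly_zero n P h, Polynomial.coeff_eq_zero_of_natDegree_lt h, zero_mul]
  · subst h
    rw [dl_eval, Polynomial.fwdDiff_iter_degree_eq_factorial]
    simp

/-- A sequence on `1..k` with vanishing differences is polynomial. -/
lemma exists_poly (e k : ℕ) (f : ℕ → ℝ)
    (h : ∀ y, 1 ≤ y → y + (e + 1) ≤ k → dl (e + 1) f y = 0) :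
    ∃ P : Polynomial ℝ, P.natDegree ≤ e ∧ ∀ j, 1 ≤ j → j ≤ k → P.eval (j : ℝ) = f j := by
  have hinj : Set.InjOn (fun j : ℕ => (j : ℝ)) (Finset.Icc 1 (e + 1) : Finset ℕ) :=
    fun a _ b _ hab => by simpa using hab
  refine ⟨Lagrange.interpolate (Finset.Icc 1 (e + 1)) (fun j : ℕ => (j : ℝ)) f, ?_, ?_⟩
  · have := Lagrange.degree_interpolate_le f hinj
    simp only [Nat.card_Icc, Nat.add_sub_cancel] at this
    exact Polynomial.natDegree_le_of_degree_le this
  · set P := Lagrange.interpolate (Finset.Icc 1 (e + 1)) (fun j : ℕ => (j : ℝ)) f with hPdef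
    have hdeg : P.natDegree < e + 1 := by
      have := Lagrange.degree_interpolate_le f hinj
      simp only [Nat.card_Icc, Nat.add_sub_cancel] at this
      exact Nat.lt_succ_of_le (Polynomial.natDegree_le_of_degree_le this)
    intro j
    induction j using Nat.strong_induction_on with
    | _ j ih =>
      intro h1 h2
      by_cases hj : j ≤ e + 1
      · exact Lagrange.eval_interpolate_at_node f hinj (Finset.mem_Icc.2 ⟨h1, hj⟩)
      · obtain ⟨y, rfl⟩ : ∃ y, j = y + (e + 1) := ⟨j - (e + 1), by omega⟩
        have key := dl_last (e + 1) (fun j => P.eval (j : ℝ) + f j * (-1)) y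
          (fun j h3 h4 => by
            rw [ih j h4 (by omega) (by omega)]; ring)
        rw [dl_add, dl_mul, dl_poly_zero _ _ hdeg, h y (by omega) h2] at key
        linarith

lemma progfree (k D p H M d : ℕ) (hD : 1 ≤ D) (hk : 2 * D < k) (A0 : Finset ℕ)
    (hA0 : ¬ HasProgression A0 k (2 * D)) (V0 B : ℤ) (hB : 2 ^ D * B < p) (hB0 : 0 ≤ B)
    (hH : 0 < H)
    (ω α : Fin d → ZMod p)
    (hω : ∀ m : ℤ, m ≠ 0 → |m| ≤ 2 ^ D * M → ∀ u : Fin d → ℤ,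
      (∀ i, (u i : ZMod p) = m * ω i) → 4 ^ D * (H : ℤ) < ∑ i, (u i) ^ 2)
    (A : Finset ℕ)
    (hA : ∀ n ∈ A, n ≤ M ∧ ∃ x : Fin d → ℤ, (∀ i, 0 ≤ x i ∧ x i ≤ B) ∧
      (∀ i, (x i : ZMod p) = n * ω i + α i) ∧
      ∃ a ∈ A0, ∃ h : ℕ, h < H ∧ ∑ i, (x i) ^ 2 = V0 + a * (4 ^ D * H) + h) :
    ¬ HasProgression A k D := by
  rintro ⟨Q, hQ0, hQD, hQ⟩
  obtain ⟨e, he⟩ : ∃ e, Q.natDegree = e := ⟨_, rfl⟩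
  rw [he] at hQ0 hQD
  have h1 : ∀ j : ℕ, ∃ (n : ℕ) (x : Fin d → ℤ) (a h : ℕ), 1 ≤ j → j ≤ k →
      ((n : ℝ) = Q.eval (j : ℝ) ∧ n ≤ M ∧ (∀ i, 0 ≤ x i ∧ x i ≤ B) ∧
      (∀ i, (x i : ZMod p) = n * ω i + α i) ∧ a ∈ A0 ∧ h < H ∧
      ∑ i, (x i) ^ 2 = V0 + a * (4 ^ D * H) + h) := by
    intro j
    by_cases hj : 1 ≤ j ∧ j ≤ k
    · obtain ⟨n, hn, hn'⟩ := hQ j (Finset.mem_Icc.2 hj)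
      obtain ⟨hM, x, hx, hx', a, ha, h, hh, hs⟩ := hA n hn
      exact ⟨n, x, a, h, fun _ _ => ⟨hn', hM, hx, hx', ha, hh, hs⟩⟩
    · exact ⟨0, 0, 0, 0, fun h1 h2 => absurd ⟨h1, h2⟩ hj⟩
  choose n x a h hall using h1
  have hpow : (2 : ℤ) ^ e ≤ 2 ^ D := pow_le_pow_right₀ (by norm_num) hQD
  -- differences of n
  have hnd : ∀ y m, 1 ≤ y → y + m ≤ k → ((dl m (fun j => (n j : ℤ)) y : ℤ) : ℝ) =
      dl m (fun j => Q.eval (j : ℝ)) y := by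
    intro y m hy hym
    have := dl_map (Int.castRingHom ℝ) m (fun j => (n j : ℤ)) y
    simp only [eq_intCast] at this
    rw [this]
    apply dl_congr
    intro j hj1 hj2
    have := (hall j (by omega) (by omega)).1
    rw [← this]; simp
  -- differences of x mod p
  have hxd : ∀ i y m, 0 < m → 1 ≤ y → y + m ≤ k → ((dl m (fun j => x j i) y : ℤ) : ZMod p) =
      ((dl m (fun j => (n j : ℤ)) y : ℤ) : ZMod p) * ω i := by
    intro i y m hm hy hym
    have e1 := dl_map (Int.castRingHom (ZMod p)) m (fun j => x j i) y
    have e2 := dl_map (Int.castRingHom (ZMod p)) m (fun j => (n j : ℤ)) y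
    simp only [eq_intCast] at e1 e2
    rw [e1, e2, ← dl_mul]
    rw [dl_congr m _ (fun j => ((n j : ℤ) : ZMod p) * ω i + α i) y
      (fun j h1 h2 => by
        have := (hall j (by omega) (by omega)).2.2.2.1 i
        rw [this]; simp), dl_add, dl_const m hm, add_zero]
  -- x is polynomial
  have hxp : ∀ i, ∃ P : Polynomial ℝ, P.natDegree ≤ e ∧
      ∀ j, 1 ≤ j → j ≤ k → P.eval (j : ℝ) = (x j i : ℝ) := by
    intro i
    apply exists_poly e k (fun j => (x j i : ℝ))
    intro y hy hyk
    have e1 := hxd i y (e + 1) (by omega) hy hyk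
    have e2 := hnd y (e + 1) hy hyk
    rw [dl_poly_zero _ _ (by omega)] at e2
    have e3 : dl (e + 1) (fun j => (n j : ℤ)) y = 0 := by exact_mod_cast e2
    rw [e3] at e1
    simp only [Int.cast_zero, zero_mul] at e1
    rw [ZMod.intCast_zmod_eq_zero_iff_dvd] at e1
    have e4 := dl_bound e (fun j => x j i) B y
      (fun j h1 h2 => (hall j (by omega) (by omega)).2.2.1 i)
    have e5 : dl (e + 1) (fun j => x j i) y = 0 := by
      apply Int.eq_zero_of_abs_lt_dvd e1
      nlinarith
    have := dl_map (Int.castRingHom ℝ) (e + 1) (fun j => x j i) y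
    simp only [eq_intCast] at this
    rw [← this, e5]; simp
  choose P hPdeg hPe using hxp
  set W : Polynomial ℝ := ∑ i, (P i) ^ 2 with hW
  have hWdeg : W.natDegree ≤ 2 * e := by
    apply Polynomial.natDegree_sum_le_of_forall_le
    intro i _
    calc _ ≤ 2 * (P i).natDegree := Polynomial.natDegree_pow_le
      _ ≤ _ := by have := hPdeg i; omega
  have hWcoeff : W.coeff (2 * e) = ∑ i, ((P i).coeff e) ^ 2 := by
    rw [hW, Polynomial.finsetSum_coeff]
    refine Finset.sum_congr rfl fun i _ => ?_
    rw [Polynomial.coeff_pow_of_natDegree_le (hPdeg i)]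
  have hWe : ∀ j, 1 ≤ j → j ≤ k → W.eval (j : ℝ) =
      ((V0 + a j * (4 ^ D * H) + h j : ℤ) : ℝ) := by
    intro j h1 h2
    rw [← (hall j h1 h2).2.2.2.2.2.2, hW, Polynomial.eval_finsetSum]
    push_cast
    refine Finset.sum_congr rfl fun i _ => ?_
    rw [Polynomial.eval_pow, hPe i j h1 h2]
  have hWd : ∀ y m, 1 ≤ y → y + m ≤ k → 0 < m → dl m (fun j => W.eval (j : ℝ)) y =
      ((dl m (fun j => (a j : ℤ)) y * (4 ^ D * H) + dl m (fun j => (h j : ℤ)) y : ℤ) : ℝ) := by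
    intro y m hy hym hm
    rw [dl_congr m _ (fun j => (Int.castRingHom ℝ) (V0 + a j * (4 ^ D * H) + h j)) y
      (fun j h1 h2 => by rw [hWe j (by omega) (by omega)]; rfl), ← dl_map, dl_add, dl_add,
      dl_const m hm, dl_mul]
    simp
  -- a is polynomial
  have hap : ∃ F : Polynomial ℝ, F.natDegree ≤ 2 * D ∧
      ∀ j, 1 ≤ j → j ≤ k → F.eval (j : ℝ) = (a j : ℝ) := by
    apply exists_poly (2 * D) k (fun j => (a j : ℝ))
    intro y hy hyk
    have e1 := hWd y (2 * D + 1) hy hyk (by omega)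
    rw [dl_poly_zero _ _ (by omega)] at e1
    have e2 : dl (2 * D + 1) (fun j => (a j : ℤ)) y * (4 ^ D * H) +
      dl (2 * D + 1) (fun j => (h j : ℤ)) y = 0 := by exact_mod_cast e1.symm
    have e4 := dl_bound (2 * D) (fun j => (h j : ℤ)) (H - 1) y
      (fun j h1 h2 => by
        have := (hall j (by omega) (by omega)).2.2.2.2.2.1
        omega)
    rw [pow_mul] at e4
    norm_num at e4
    have e5 : dl (2 * D + 1) (fun j => (h j : ℤ)) y = 0 := by
      apply Int.eq_zero_of_abs_lt_dvd (m := 4 ^ D * (H : ℤ))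
      · exact ⟨- dl (2 * D + 1) (fun j => (a j : ℤ)) y, by linarith⟩
      · have : (0 : ℤ) < 4 ^ D := by positivity
        nlinarith
    have e6 : dl (2 * D + 1) (fun j => (a j : ℤ)) y = 0 := by
      rw [e5, add_zero] at e2
      have : (0 : ℤ) < 4 ^ D * (H : ℤ) := by positivity
      rcases mul_eq_zero.1 e2 with h | h
      · exact h
      · omega
    have := dl_map (Int.castRingHom ℝ) (2 * D + 1) (fun j => (a j : ℤ)) y
    simp only [eq_intCast, Int.cast_natCast] at this
    rw [← this, e6]; simp
  obtain ⟨F, hFd, hFe⟩ := hap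
  have hF0 : F.natDegree = 0 := by
    by_contra hne
    apply hA0
    refine ⟨F, by omega, hFd, fun j hj => ?_⟩
    rw [Finset.mem_Icc] at hj
    exact ⟨a j, (hall j hj.1 hj.2).2.2.2.2.1, (hFe j hj.1 hj.2).symm⟩
  have hac : dl (2 * e) (fun j => (a j : ℤ)) 1 = 0 := by
    have e1 := dl_poly_zero (2 * e) F (by omega) 1
    have := dl_map (Int.castRingHom ℝ) (2 * e) (fun j => (a j : ℤ)) 1
    simp only [eq_intCast, Int.cast_natCast] at this
    rw [dl_congr (2 * e) _ _ 1 (fun j h1 h2 => hFe j (by omega) (by omega)), ← this] at e1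
    exact_mod_cast e1
  have f1 := hWd 1 (2 * e) le_rfl (by omega) (by omega)
  rw [hac, dl_poly_coeff _ _ hWdeg, hWcoeff] at f1
  have f2 := dl_bound (2 * e - 1) (fun j => (h j : ℤ)) (H - 1) 1
      (fun j h1 h2 => by
        have := (hall j (by omega) (by omega)).2.2.2.2.2.1
        omega)
  rw [show 2 * e - 1 + 1 = 2 * e by omega] at f2
  -- the difference vector
  have g1 : ∀ i, ((dl e (fun j => x j i) 1 : ℤ) : ℝ) = (P i).coeff e * e.factorial := by
    intro i
    rw [← dl_poly_coeff e (P i) (hPdeg i) 1]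
    have := dl_map (Int.castRingHom ℝ) e (fun j => x j i) 1
    simp only [eq_intCast] at this
    rw [this]
    exact dl_congr _ _ _ _ (fun j h1 h2 => (hPe i j (by omega) (by omega)).symm)
  have g2 := hnd 1 e le_rfl (by omega)
  rw [dl_poly_coeff e Q (by omega)] at g2
  have g3 : dl e (fun j => (n j : ℤ)) 1 ≠ 0 := by
    intro h0
    rw [h0, ← he] at g2
    simp only [Int.cast_zero, Polynomial.coeff_natDegree] at g2
    rcases mul_eq_zero.1 g2.symm with h | h
    · rw [Polynomial.leadingCoeff_eq_zero] at h
      rw [h] at he; simp at he; omega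
    · exact absurd h (by positivity)
  have g4 : |dl e (fun j => (n j : ℤ)) 1| ≤ 2 ^ D * M := by
    have := dl_bound (e - 1) (fun j => (n j : ℤ)) M 1
      (fun j h1 h2 => by
        have := (hall j (by omega) (by omega)).2.1
        omega)
    rw [show e - 1 + 1 = e by omega] at this
    refine this.trans ?_
    gcongr
    · norm_num
    omega
  have g5 := hω _ g3 g4 (fun i => dl e (fun j => x j i) 1)
    (fun i => hxd i 1 e hQ0 le_rfl (by omega))
  have g6 : ((∑ i, (dl e (fun j => x j i) 1) ^ 2 : ℤ) : ℝ) ≤ 4 ^ D * H := by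
    push_cast
    simp only [g1, mul_pow]
    rw [← Finset.sum_mul]
    have fac : ((e.factorial : ℝ)) ^ 2 ≤ ((2 * e).factorial : ℝ) := by
      have := Nat.factorial_mul_factorial_dvd_factorial_add e e
      have := Nat.le_of_dvd (Nat.factorial_pos _) this
      rw [← two_mul, ← sq] at this
      exact_mod_cast this
    have f3 : ((dl (2 * e) (fun j => (h j : ℤ)) 1 : ℤ) : ℝ) ≤ 4 ^ D * H := by
      have : dl (2 * e) (fun j => (h j : ℤ)) 1 ≤ 4 ^ D * H := by
        refine (le_abs_self _).trans (f2.trans ?_)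
        have : (2 : ℤ) ^ (2 * e - 1) ≤ 4 ^ D := by
          rw [show (4 : ℤ) = 2 ^ 2 by norm_num, ← pow_mul]
          exact pow_le_pow_right₀ (by norm_num) (by omega)
        gcongr
        · omega
        · omega
      exact_mod_cast this
    calc _ ≤ (∑ i, ((P i).coeff e) ^ 2) * ((2 * e).factorial : ℝ) := by
          gcongr
      _ = _ := f1
      _ ≤ _ := by push_cast at f3 ⊢; simpa using f3
  have g7 : ∑ i, (dl e (fun j => x j i) 1) ^ 2 ≤ 4 ^ D * (H : ℤ) := by exact_mod_cast g6
  omega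

lemma geo_int (q : ℝ) (Y : ℕ) :
    (∑ n ∈ Finset.Icc (-(Y : ℤ)) Y, q ^ n.natAbs) * (1 - q) = 1 + q - 2 * q ^ (Y + 1) := by
  induction Y with
  | zero => simp; ring
  | succ Y ih =>
    have : Finset.Icc (-((Y + 1 : ℕ) : ℤ)) ((Y + 1 : ℕ) : ℤ) =
        insert (-((Y + 1 : ℕ) : ℤ)) (insert ((Y + 1 : ℕ) : ℤ) (Finset.Icc (-(Y : ℤ)) Y)) := by
      ext t; simp only [Finset.mem_Icc, Finset.mem_insert]; push_cast; omega
    rw [this, Finset.sum_insert, Finset.sum_insert, add_mul, add_mul, ih]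
    · rw [Int.natAbs_neg, Int.natAbs_natCast]; ring
    · simp
    · simp only [Finset.mem_insert, Finset.mem_Icc]; push_cast; omega

/-- integer points of an `ℓ¹` ball -/
noncomputable def l1ball (d Y : ℕ) : Finset (Fin d → ℤ) :=
  (Fintype.piFinset (fun _ : Fin d => Finset.Icc (-(Y : ℤ)) Y)).filter
    (fun u => ∑ i, (u i).natAbs ≤ Y)

lemma mem_l1ball (d Y : ℕ) (u : Fin d → ℤ) (h : ∑ i, (u i).natAbs ≤ Y) : u ∈ l1ball d Y := by
  rw [l1ball, Finset.mem_filter, Fintype.mem_piFinset]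
  refine ⟨fun i => ?_, h⟩
  have := Finset.single_le_sum (f := fun i => (u i).natAbs) (fun _ _ => Nat.zero_le _)
    (Finset.mem_univ i)
  rw [Finset.mem_Icc]
  omega

lemma card_l1ball (d Y : ℕ) (hd : 0 < d) (hY : 0 < Y) :
    ((l1ball d Y).card : ℝ) ≤ (Real.exp 1 * (2 * (1 + Y / d))) ^ d := by
  have hd' : (0 : ℝ) < d := by exact_mod_cast hd
  have hY' : (0 : ℝ) < Y := by exact_mod_cast hY
  set q : ℝ := (1 + (d : ℝ) / Y)⁻¹ with hq
  have hq0 : 0 < q := by positivity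
  have hq1 : q ≤ 1 := inv_le_one_of_one_le₀ (by have : 0 < (d : ℝ) / Y := by positivity
                                                linarith)
  have h1q : 1 - q = (1 + (Y : ℝ) / d)⁻¹ := by
    rw [hq]; field_simp; ring
  have hgeo : ∑ n ∈ Finset.Icc (-(Y : ℤ)) Y, q ^ n.natAbs ≤ 2 * (1 + Y / d) := by
    have h := geo_int q Y
    rw [h1q] at h
    have h2 : (0 : ℝ) < 1 + Y / d := by positivity
    rw [← div_eq_mul_inv, div_eq_iff h2.ne'] at h
    rw [h]
    gcongr
    have : 0 < q ^ (Y + 1) := by positivity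
    linarith
  have h1 : ((l1ball d Y).card : ℝ) * q ^ Y ≤ (2 * (1 + Y / d)) ^ d := by
    calc ((l1ball d Y).card : ℝ) * q ^ Y = ∑ u ∈ l1ball d Y, q ^ Y := by simp
      _ ≤ ∑ u ∈ l1ball d Y, ∏ i, q ^ (u i).natAbs := by
          refine Finset.sum_le_sum fun u hu => ?_
          rw [Finset.prod_pow_eq_pow_sum]
          exact pow_le_pow_of_le_one hq0.le hq1 (Finset.mem_filter.1 hu).2
      _ ≤ ∑ u ∈ Fintype.piFinset (fun _ : Fin d => Finset.Icc (-(Y : ℤ)) Y),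
            ∏ i, q ^ (u i).natAbs := by
          apply Finset.sum_le_sum_of_subset_of_nonneg (Finset.filter_subset _ _)
          intros; positivity
      _ = (∑ n ∈ Finset.Icc (-(Y : ℤ)) Y, q ^ n.natAbs) ^ d := by
          rw [← Finset.prod_univ_sum (fun _ : Fin d => Finset.Icc (-(Y : ℤ)) Y)
            (fun _ n => q ^ n.natAbs)]
          simp
      _ ≤ _ := by
          gcongr
  have h2 : (q ^ Y)⁻¹ ≤ Real.exp 1 ^ d := by
    rw [hq, inv_pow, inv_inv]
    calc (1 + (d : ℝ) / Y) ^ Y ≤ (Real.exp ((d : ℝ) / Y)) ^ Y := by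
          gcongr
          have := Real.add_one_le_exp ((d : ℝ) / Y)
          linarith
      _ = Real.exp 1 ^ d := by
          rw [← Real.exp_nat_mul, ← Real.exp_nat_mul]
          congr 1; field_simp
  calc ((l1ball d Y).card : ℝ) = ((l1ball d Y).card * q ^ Y) * (q ^ Y)⁻¹ := by
        field_simp
    _ ≤ (2 * (1 + Y / d)) ^ d * Real.exp 1 ^ d := by gcongr
    _ = _ := by rw [mul_pow (Real.exp 1)]; ring

lemma exists_omega (p d Y m0 : ℕ) [Fact p.Prime] (hM : m0 < p)
    (hc : m0 * (l1ball d Y).card < p ^ d) :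
    ∃ ω : Fin d → ZMod p, ∀ m : ℤ, m ≠ 0 → |m| ≤ m0 → ∀ u : Fin d → ℤ,
      (∀ i, (u i : ZMod p) = m * ω i) → Y < ∑ i, (u i).natAbs := by
  classical
  set bad : Finset (Fin d → ZMod p) :=
    ((Finset.Icc 1 m0) ×ˢ l1ball d Y).image
      (fun z i => ((z.1 : ℕ) : ZMod p)⁻¹ * ((z.2 i : ℤ) : ZMod p)) with hbad
  have hcard : bad.card < (Finset.univ : Finset (Fin d → ZMod p)).card := by
    refine lt_of_le_of_lt Finset.card_image_le ?_
    rw [Finset.card_product, Finset.card_univ, Fintype.card_fun, ZMod.card, Fintype.card_fin,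
      Nat.card_Icc, Nat.add_sub_cancel]
    exact hc
  obtain ⟨ω, -, hω⟩ := Finset.exists_mem_notMem_of_card_lt_card hcard
  have main : ∀ m : ℕ, 1 ≤ m → m ≤ m0 → ∀ u : Fin d → ℤ,
      (∀ i, (u i : ZMod p) = (m : ZMod p) * ω i) → Y < ∑ i, (u i).natAbs := by
    intro m h1 h2 u hu
    by_contra hcon
    push Not at hcon
    apply hω
    rw [hbad, Finset.mem_image]
    refine ⟨(m, u), ?_, ?_⟩
    · rw [Finset.mem_product, Finset.mem_Icc]
      exact ⟨⟨h1, h2⟩, mem_l1ball d Y u hcon⟩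
    · funext i
      have hm : (m : ZMod p) ≠ 0 := by
        intro h0
        rw [ZMod.natCast_eq_zero_iff] at h0
        have := Nat.le_of_dvd (by omega) h0
        omega
      simp only
      rw [hu i, inv_mul_cancel_left₀ hm]
  refine ⟨ω, fun m hm hm0 u hu => ?_⟩
  rcases lt_or_gt_of_ne hm with hneg | hpos
  · have := main m.natAbs (by omega) (by rw [abs_of_neg hneg] at hm0; omega) (fun i => - u i) (by
      intro i
      have : ((m.natAbs : ℕ) : ZMod p) = ((-m : ℤ) : ZMod p) := by
        rw [← Int.cast_natCast]; congr 1; omega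
      rw [this]; push_cast; rw [hu i]; ring)
    simpa using this
  · exact main m.natAbs (by omega) (by rw [abs_of_pos hpos] at hm0; omega) u (by
      intro i
      have : ((m.natAbs : ℕ) : ZMod p) = ((m : ℤ) : ZMod p) := by
        rw [← Int.cast_natCast]; congr 1; omega
      rw [this, hu i])

lemma sum_zero_pi (d L : ℕ) (f : Fin L → ℝ) (hf : ∑ a, f a = 0) :
    ∑ x : Fin d → Fin L, ∑ i, f (x i) = 0 := by
  induction d with
  | zero => simp
  | succ d ih =>
    rw [← (Fin.consEquiv (fun _ => Fin L)).sum_comp, Fintype.sum_prod_type]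
    simp [Fin.sum_univ_succ, Finset.sum_add_distrib, ih, ← Finset.mul_sum, hf]

lemma sum_sq_pi (d L : ℕ) (f : Fin L → ℝ) (hf : ∑ a, f a = 0) (B : ℝ)
    (hB : ∀ a, |f a| ≤ B) :
    ∑ x : Fin d → Fin L, (∑ i, f (x i)) ^ 2 ≤ d * (L : ℝ) ^ d * B ^ 2 := by
  induction d with
  | zero => simp
  | succ d ih =>
    rw [← (Fin.consEquiv (fun _ => Fin L)).sum_comp, Fintype.sum_prod_type]
    have h1 : ∀ a : Fin L, ∑ y : Fin d → Fin L,
        (∑ i, f ((Fin.consEquiv (fun _ => Fin L)) (a, y) i)) ^ 2 =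
        (L : ℝ) ^ d * f a ^ 2 + ∑ y : Fin d → Fin L, (∑ i, f (y i)) ^ 2 := by
      intro a
      have : ∀ y : Fin d → Fin L, (∑ i, f ((Fin.consEquiv (fun _ => Fin L)) (a, y) i)) ^ 2 =
          f a ^ 2 + 2 * f a * (∑ i, f (y i)) + (∑ i, f (y i)) ^ 2 := by
        intro y
        simp [Fin.sum_univ_succ]; ring
      simp only [this, Finset.sum_add_distrib, ← Finset.mul_sum, sum_zero_pi d L f hf]
      simp
    simp only [h1, Finset.sum_add_distrib]
    have h2 : ∑ a : Fin L, (L : ℝ) ^ d * f a ^ 2 ≤ ∑ a : Fin L, (L : ℝ) ^ d * B ^ 2 := by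
      refine Finset.sum_le_sum fun a _ => ?_
      have := sq_le_sq' (by have := (abs_le.1 (hB a)).1; linarith) (abs_le.1 (hB a)).2
      gcongr
    have h3 : ∑ a : Fin L, ∑ y : Fin d → Fin L, (∑ i, f (y i)) ^ 2 ≤
        L * (d * (L : ℝ) ^ d * B ^ 2) := by
      simp only [Finset.sum_const, Finset.card_univ, Fintype.card_fin, nsmul_eq_mul]
      gcongr
    simp only [Finset.sum_const, Finset.card_univ, Fintype.card_fin, nsmul_eq_mul] at h2 h3 ⊢
    push_cast
    calc _ ≤ _ := add_le_add h2 h3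
      _ = _ := by ring

lemma chebyshev (d L : ℕ) (hd : 0 < d) (hL : 0 < L) : ∃ (μ : ℝ) (U : Finset (Fin d → Fin L)),
    3 / 4 * (L : ℝ) ^ d ≤ U.card ∧
    ∀ x ∈ U, |((∑ i, ((x i : ℕ) : ℤ) ^ 2 : ℤ) : ℝ) - μ| ≤ 2 * Real.sqrt d * (L : ℝ) ^ 2 := by
  classical
  have hd' : (0 : ℝ) < d := by exact_mod_cast hd
  have hL' : (0 : ℝ) < L := by exact_mod_cast hL
  set m2 : ℝ := (∑ a : Fin L, ((a : ℕ) : ℝ) ^ 2) / L with hm2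
  set f : Fin L → ℝ := fun a => ((a : ℕ) : ℝ) ^ 2 - m2 with hf
  have hterm : ∀ a : Fin L, ((a : ℕ) : ℝ) ^ 2 ≤ (L : ℝ) ^ 2 := by
    intro a
    have : ((a : ℕ) : ℝ) ≤ L := by exact_mod_cast a.2.le
    gcongr
  have hm0 : 0 ≤ m2 := by positivity
  have hm1 : m2 ≤ (L : ℝ) ^ 2 := by
    rw [hm2, div_le_iff₀ hL']
    calc _ ≤ ∑ a : Fin L, (L : ℝ) ^ 2 := Finset.sum_le_sum fun a _ => hterm a
      _ = _ := by simp; ring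
  have hsum : ∑ a, f a = 0 := by
    simp only [hf, Finset.sum_sub_distrib, Finset.sum_const, Finset.card_univ, Fintype.card_fin,
      nsmul_eq_mul, hm2]
    field_simp; ring
  have hfB : ∀ a, |f a| ≤ (L : ℝ) ^ 2 := by
    intro a
    have := hterm a
    have h0 : 0 ≤ ((a : ℕ) : ℝ) ^ 2 := by positivity
    rw [abs_le]; constructor <;> simp only [hf] <;> linarith
  have hvar := sum_sq_pi d L f hsum _ hfB
  have hfs : ∀ x : Fin d → Fin L, ∑ i, f (x i) =
      ((∑ i, ((x i : ℕ) : ℤ) ^ 2 : ℤ) : ℝ) - d * m2 := by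
    intro x
    simp [hf, Finset.sum_sub_distrib]
  set T := 2 * Real.sqrt d * (L : ℝ) ^ 2 with hT
  have hT0 : 0 < T := by positivity
  refine ⟨d * m2, Finset.univ.filter (fun x => |∑ i, f (x i)| ≤ T), ?_, ?_⟩
  · have hsplit := Finset.card_filter_add_card_filter_not (s := (Finset.univ : Finset (Fin d → Fin L)))
      (fun x => |∑ i, f (x i)| ≤ T)
    have hbad : ((Finset.univ.filter (fun x : Fin d → Fin L => ¬ |∑ i, f (x i)| ≤ T)).card : ℝ)
        * T ^ 2 ≤ d * (L : ℝ) ^ d * ((L : ℝ) ^ 2) ^ 2 := by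
      refine le_trans ?_ hvar
      rw [← nsmul_eq_mul, ← Finset.sum_const]
      refine le_trans (Finset.sum_le_sum (fun x hx => ?_))
        (Finset.sum_le_sum_of_subset_of_nonneg (Finset.filter_subset _ _)
          (fun x _ _ => sq_nonneg (∑ i, f (x i))))
      have := (Finset.mem_filter.1 hx).2
      rw [← sq_abs (∑ i, f (x i))]
      have := (not_le.1 this).le
      gcongr
    have hTsq : T ^ 2 = 4 * d * ((L : ℝ) ^ 2) ^ 2 := by
      rw [hT, mul_pow, mul_pow, Real.sq_sqrt hd'.le]; ring
    rw [hTsq] at hbad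
    have hbad2 : ((Finset.univ.filter (fun x : Fin d → Fin L => ¬ |∑ i, f (x i)| ≤ T)).card : ℝ)
        ≤ (L : ℝ) ^ d / 4 := by
      have hpos : 0 < (d : ℝ) * ((L : ℝ) ^ 2) ^ 2 := by positivity
      rw [← mul_le_mul_iff_left₀ hpos]
      linarith
    rw [Finset.card_univ, Fintype.card_fun, Fintype.card_fin, Fintype.card_fin] at hsplit
    have hs : ((Finset.univ.filter (fun x : Fin d → Fin L => |∑ i, f (x i)| ≤ T)).card : ℝ) +
        ((Finset.univ.filter (fun x : Fin d → Fin L => ¬ |∑ i, f (x i)| ≤ T)).card : ℝ) =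
        (L : ℝ) ^ d := by exact_mod_cast hsplit
    linarith
  · intro x hx
    rw [← hfs]
    exact (Finset.mem_filter.1 hx).2

open Classical in
lemma avg {ι X : Type*} [Nonempty ι] (I : Finset ι) (U : Finset X) (r : ι → X → Prop) (q : ℕ)
    (hq : ∀ x ∈ U, q ≤ (I.filter (fun i => r i x)).card) (c : ℝ) (hc : (I.card : ℝ) ≤ c)
    (hc0 : 0 < c) : ∃ i, (U.card : ℝ) * q ≤ (U.filter (fun x => r i x)).card * c := by
  by_contra! hcon
  have h1 : ∑ i ∈ I, (U.filter (fun x => r i x)).card =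
      ∑ x ∈ U, (I.filter (fun i => r i x)).card :=
    Finset.sum_card_bipartiteAbove_eq_sum_card_bipartiteBelow r
  have h2 : U.card * q ≤ ∑ i ∈ I, (U.filter (fun x => r i x)).card := by
    rw [h1, ← smul_eq_mul, ← Finset.sum_const]
    exact Finset.sum_le_sum hq
  have h3 : (U.card : ℝ) * q ≤ ∑ i ∈ I, ((U.filter (fun x => r i x)).card : ℝ) := by
    exact_mod_cast h2
  have hQ : 0 < (U.card : ℝ) * q := by
    have i0 : ι := Classical.arbitrary ι
    exact lt_of_le_of_lt (by positivity) (hcon i0)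
  rcases I.eq_empty_or_nonempty with hI | hI
  · subst hI; simp at h3; linarith
  · have h4 := Finset.sum_lt_sum_of_nonempty hI (fun i _ => hcon i)
    rw [← Finset.sum_mul, Finset.sum_const, nsmul_eq_mul] at h4
    nlinarith

open Classical in
lemma exists_V0 {X : Type*} (U : Finset X) (V : X → ℤ) (μ T N0 : ℝ) (hT : 0 ≤ T) (hN0 : 0 ≤ N0)
    (hV : ∀ x ∈ U, |(V x : ℝ) - μ| ≤ T) (A0 : Finset ℕ) (hA0 : ∀ a ∈ A0, (a : ℝ) ≤ N0)
    (K H : ℕ) (hK : 0 < K) :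
    ∃ V0 : ℤ, (U.card : ℝ) * (A0.card * H : ℕ) ≤
      (U.filter (fun x => ∃ a ∈ A0, ∃ h : ℕ, h < H ∧ V x = V0 + a * (K * H) + h)).card *
        (2 * T + N0 * (K * H) + H + 1) := by
  have key := avg (Finset.Icc ⌈μ - T - N0 * (K * H) - H⌉ ⌊μ + T⌋) U
    (fun V0 x => ∃ a ∈ A0, ∃ h : ℕ, h < H ∧ V x = V0 + a * (K * H) + h) (A0.card * H) ?_
    (2 * T + N0 * (K * H) + H + 1) ?_ ?_
  · convert key
  · intro x hx
    have hVx := abs_le.1 (hV x hx)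
    have : (A0.card * H) = (A0 ×ˢ Finset.range H).card := by simp
    rw [this]
    apply Finset.card_le_card_of_injOn (fun z => V x - z.1 * (K * H) - z.2)
    · rintro ⟨a, h⟩ hz
      simp only [Finset.coe_product, Set.mem_prod, Finset.mem_coe, Finset.mem_range] at hz
      simp only [Finset.coe_filter, Finset.mem_Icc, Set.mem_ofPred_eq]
      have ha := hA0 a hz.1
      have hh : (h : ℝ) ≤ H := by exact_mod_cast hz.2.le
      have haKH : (a : ℝ) * (K * H) ≤ N0 * (K * H) := by gcongr
      have haKH0 : 0 ≤ (a : ℝ) * (K * H) := by positivity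
      have hh0 : 0 ≤ (h : ℝ) := by positivity
      refine ⟨⟨?_, ?_⟩, a, hz.1, h, hz.2, by ring⟩
      · rw [Int.ceil_le]; push_cast; linarith
      · rw [Int.le_floor]; push_cast; linarith
    · rintro ⟨a, h⟩ hz ⟨b, g⟩ hw heq
      simp only [Finset.coe_product, Set.mem_prod, Finset.mem_coe, Finset.mem_range] at hz hw heq
      have e1 : (a : ℤ) * (K * H) + h = b * (K * H) + g := by linarith
      have e2 : a * (K * H) + h = b * (K * H) + g := by exact_mod_cast e1
      have hKH : H ≤ K * H := Nat.le_mul_of_pos_left H hK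
      have e3 : a = b := by
        have h1 : (a * (K * H) + h) / (K * H) = a := by
          rw [Nat.add_comm, Nat.add_mul_div_right _ _ (by omega), Nat.div_eq_of_lt (by omega)]
          omega
        have h2 : (b * (K * H) + g) / (K * H) = b := by
          rw [Nat.add_comm, Nat.add_mul_div_right _ _ (by omega), Nat.div_eq_of_lt (by omega)]
          omega
        rw [← h1, e2, h2]
      subst e3
      simp only [Prod.mk.injEq, true_and]; omega
  · rw [Int.card_Icc]
    have h1 := Int.floor_le (μ + T)
    have h2 := Int.le_ceil (μ - T - N0 * (K * H) - H)
    have h3 : 0 ≤ 2 * T + N0 * (K * H) + H + 1 := by positivity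
    rcases le_total 0 (⌊μ + T⌋ + 1 - ⌈μ - T - N0 * (K * H) - H⌉) with h | h
    · have : ((⌊μ + T⌋ + 1 - ⌈μ - T - N0 * (K * H) - H⌉).toNat : ℝ) =
        ((⌊μ + T⌋ + 1 - ⌈μ - T - N0 * (K * H) - H⌉ : ℤ) : ℝ) := by
        rw [← Int.cast_natCast, Int.toNat_of_nonneg h]
      rw [this]; push_cast; linarith
    · rw [Int.toNat_of_nonpos h]; simpa using h3
  · positivity

open Classical in
lemma exists_alpha (p d L M : ℕ) [Fact p.Prime] (hL : L ≤ p) (S : Finset (Fin d → Fin L))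
    (ω : Fin d → ZMod p) : ∃ α : Fin d → ZMod p,
    (M : ℝ) * S.card ≤ ((Finset.Icc 1 M).filter (fun n : ℕ => ∃ x ∈ S, ∀ i,
      (((x i : ℕ) : ℤ) : ZMod p) = n * ω i + α i)).card * (p : ℝ) ^ d := by
  have hp : 0 < p := (Fact.out : p.Prime).pos
  have := avg (Finset.univ : Finset (Fin d → ZMod p)) (Finset.Icc 1 M)
    (fun α n => ∃ x ∈ S, ∀ i, (((x i : ℕ) : ℤ) : ZMod p) = n * ω i + α i) S.card ?_
    ((p : ℝ) ^ d) ?_ (by positivity)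
  · simpa using this
  · intro n _
    apply Finset.card_le_card_of_injOn (fun x i => (((x i : ℕ) : ℤ) : ZMod p) - n * ω i)
    · intro x hx
      simp only [Finset.coe_filter, Finset.mem_univ, true_and, Set.mem_ofPred_eq]
      exact ⟨x, hx, fun i => by ring⟩
    · intro x _ y _ hxy
      funext i
      have := congrFun hxy i
      simp only [sub_left_inj, Int.cast_natCast] at this
      rw [ZMod.natCast_eq_natCast_iff'] at this
      rw [Nat.mod_eq_of_lt (by have := (x i).2; omega),
        Nat.mod_eq_of_lt (by have := (y i).2; omega)] at this
      exact Fin.ext this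
  · rw [Finset.card_univ, Fintype.card_fun, ZMod.card, Fintype.card_fin]; simp

lemma rk_bdd (k D : ℕ) (x : ℝ) : BddAbove {m | ∃ A : Finset ℕ, (∀ a ∈ A, 1 ≤ a ∧ (a : ℝ) ≤ x) ∧
    ¬ HasProgression A k D ∧ A.card = m} := by
  refine ⟨⌊x⌋₊, ?_⟩
  rintro m ⟨A, hA, -, rfl⟩
  have : A ⊆ Finset.Icc 1 ⌊x⌋₊ := fun a ha =>
    Finset.mem_Icc.2 ⟨(hA a ha).1, Nat.le_floor (hA a ha).2⟩
  simpa using Finset.card_le_card this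

lemma rk_exists (k D : ℕ) (hk : 1 ≤ k) (x : ℝ) : ∃ A : Finset ℕ, (∀ a ∈ A, 1 ≤ a ∧ (a : ℝ) ≤ x) ∧
    ¬ HasProgression A k D ∧ A.card = rkDR k D x := by
  refine Nat.sSup_mem (s := {m | ∃ A : Finset ℕ, (∀ a ∈ A, 1 ≤ a ∧ (a : ℝ) ≤ x) ∧
    ¬ HasProgression A k D ∧ A.card = m}) ⟨0, ∅, by simp, ?_, rfl⟩ (rk_bdd k D x)
  rintro ⟨Q, -, -, h⟩
  obtain ⟨m, hm, -⟩ := h 1 (Finset.mem_Icc.2 ⟨le_rfl, hk⟩)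
  simp at hm

lemma le_rk (k D : ℕ) (x : ℝ) (A : Finset ℕ) (hA : ∀ a ∈ A, 1 ≤ a ∧ (a : ℝ) ≤ x)
    (h : ¬ HasProgression A k D) : A.card ≤ rkDR k D x :=
  le_csSup (rk_bdd k D x) ⟨A, hA, h, rfl⟩

set_option maxHeartbeats 4000000 in
theorem stmt15 (k D : ℕ) (hD : 1 ≤ D) (hk : 2 * D < k) :
    ∃ C : ℝ, 0 < C ∧ ∃ d₀ : ℕ, ∀ d : ℕ, d₀ ≤ d → ∀ N N₀ : ℝ, 1 ≤ N →
      N₀ = Real.exp 1 * Real.pi / (3 * Real.sqrt 5) *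
          ((4 : ℝ) ^ D * ((2 * D).choose D : ℝ))⁻¹ * N ^ ((2 : ℝ) / d) / Real.sqrt d →
      1 ≤ N₀ →
      (rkDR k D N : ℝ) / N ≥
        C * (2 : ℝ) ^ (-((d * D : ℕ) : ℤ)) * ((rkDR k (2 * D) N₀ : ℝ) / N₀) := by
  classical
  set c0 : ℝ := Real.exp 1 * Real.pi / (3 * Real.sqrt 5) *
          ((4 : ℝ) ^ D * ((2 * D).choose D : ℝ))⁻¹ with hc0
  have hchoose : (1 : ℝ) ≤ ((2 * D).choose D : ℝ) := by
    exact_mod_cast Nat.choose_pos (by omega)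
  have h4D : (1 : ℝ) ≤ 4 ^ D := one_le_pow₀ (by norm_num)
  have h2D : (1 : ℝ) ≤ 2 ^ D := one_le_pow₀ (by norm_num)
  have h42 : (4 : ℝ) ^ D = 2 ^ D * 2 ^ D := by rw [← mul_pow]; norm_num
  have hc0pos : 0 < c0 := by
    have := Real.pi_pos
    positivity
  have hc0le : c0 ≤ 2 := by
    have h5 : (2 : ℝ) ≤ Real.sqrt 5 := Real.le_sqrt_of_sq_le (by norm_num)
    have he := Real.exp_one_lt_d9
    have hpi := Real.pi_lt_four
    have hpi0 := Real.pi_pos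
    have h1 : Real.exp 1 * Real.pi / (3 * Real.sqrt 5) ≤ 2 := by
      rw [div_le_iff₀ (by positivity)]
      have : Real.exp 1 * Real.pi ≤ 3 * 4 := by
        gcongr
        linarith
      linarith
    have h2 : ((4 : ℝ) ^ D * ((2 * D).choose D : ℝ))⁻¹ ≤ 1 :=
      inv_le_one_of_one_le₀ (by nlinarith)
    calc c0 ≤ 2 * 1 := by rw [hc0]; gcongr
      _ = 2 := by norm_num
  set E : ℝ := 2310 * 4 ^ D with hE
  have hEpos : 0 < E := by positivity
  refine ⟨3 * c0 / (16 * E), by positivity, 1, ?_⟩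
  intro d hd N N₀ hN hN₀ hN₀1
  have hd' : (1 : ℝ) ≤ d := by exact_mod_cast hd
  set s : ℝ := Real.sqrt d with hs
  have hs1 : 1 ≤ s := Real.one_le_sqrt.2 hd'
  have hss : s * s = d := Real.mul_self_sqrt (by linarith)
  set ν : ℝ := N ^ ((1 : ℝ) / d) with hν
  have hν1 : 1 ≤ ν := Real.one_le_rpow hN (by positivity)
  have hνd : ν ^ d = N := by
    rw [hν, ← Real.rpow_natCast, ← Real.rpow_mul (by linarith)]
    rw [one_div_mul_cancel (by linarith), Real.rpow_one]
  have hν2 : N ^ ((2 : ℝ) / d) = ν ^ 2 := by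
    rw [hν, ← Real.rpow_natCast, ← Real.rpow_mul (by linarith)]
    congr 1; push_cast; ring
  rw [hν2] at hN₀
  have hN₀s : N₀ * s = c0 * ν ^ 2 := by
    rw [hN₀]; field_simp
  -- parameters
  obtain ⟨z, hz⟩ : ∃ z : ℕ, z = d + ⌈N⌉₊ := ⟨_, rfl⟩
  have hzN : N ≤ z := by
    have := Nat.le_ceil N
    rw [hz]; push_cast; linarith
  have hzd : (d : ℝ) ≤ z := by rw [hz]; push_cast; linarith [Nat.cast_nonneg (α := ℝ) ⌈N⌉₊]
  have hz1 : (1 : ℝ) ≤ z := by linarith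
  set G : ℝ := 11 * 4 ^ D * ν * z with hG
  have hGz : 11 * 4 ^ D * z ≤ G := by
    have : 11 * 4 ^ D * 1 * (z : ℝ) ≤ G := by rw [hG]; gcongr
    linarith
  have hGpos : 11 ≤ G := by
    have : 11 * 1 * (1 : ℝ) ≤ 11 * 4 ^ D * z := by gcongr
    linarith
  obtain ⟨p, hpp, hp1, hp2⟩ := Nat.exists_prime_lt_and_le_two_mul ⌈G⌉₊
    (by have := Nat.ceil_pos.2 (by linarith : 0 < G); omega)
  have : Fact p.Prime := ⟨hpp⟩
  have hpG : G < p := lt_of_le_of_lt (Nat.le_ceil G) (by exact_mod_cast hp1)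
  have hpG2 : (p : ℝ) ≤ 24 * 4 ^ D * ν * z := by
    have h1 := Nat.ceil_lt_add_one (by linarith : 0 ≤ G)
    have h2 : (p : ℝ) ≤ 2 * (⌈G⌉₊ : ℝ) := by exact_mod_cast hp2
    linarith
  have hppos : (0 : ℝ) < p := by linarith
  obtain ⟨M, hM⟩ : ∃ M : ℕ, M = ⌊N⌋₊ := ⟨_, rfl⟩
  have hMN : (M : ℝ) ≤ N := by rw [hM]; exact Nat.floor_le (by linarith)
  have hMN2 : N / 2 ≤ M := by
    have h1 := Nat.lt_floor_add_one N
    have h2 : 1 ≤ M := by rw [hM]; exact Nat.le_floor (by simpa using hN)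
    have h3 : (1 : ℝ) ≤ M := by exact_mod_cast h2
    rw [← hM] at h1
    linarith
  have hMp : 2 ^ D * M < p := by
    have : (2 : ℝ) ^ D * M < p := by
      calc (2 : ℝ) ^ D * M ≤ 2 ^ D * (2 ^ D * z) := by
            gcongr
            nlinarith
        _ = 4 ^ D * z := by rw [h42]; ring
        _ ≤ 11 * 4 ^ D * z := by
            have : (0 : ℝ) ≤ 4 ^ D * z := by positivity
            linarith
        _ < p := by linarith
    exact_mod_cast this
  obtain ⟨Y, hY⟩ : ∃ Y : ℕ, Y = d * 2 ^ D * z := ⟨_, rfl⟩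
  obtain ⟨H, hH⟩ : ∃ H : ℕ, H = d * z ^ 2 := ⟨_, rfl⟩
  have hzpos : 0 < z := by exact_mod_cast (by linarith : (0 : ℝ) < z)
  have hYpos : 0 < Y := by rw [hY]; positivity
  have hHpos : 0 < H := by rw [hH]; positivity
  have hcount : 2 ^ D * M * (l1ball d Y).card < p ^ d := by
    have h1 := card_l1ball d Y hd hYpos
    have h2 : (Y : ℝ) / d = 2 ^ D * z := by
      rw [hY]; push_cast; field_simp
    rw [h2] at h1
    have h3 : Real.exp 1 * (2 * (1 + 2 ^ D * (z : ℝ))) ≤ 11 * 2 ^ D * z := by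
      have he := Real.exp_one_lt_d9
      have h4 : 1 ≤ 2 ^ D * (z : ℝ) := by nlinarith
      calc Real.exp 1 * (2 * (1 + 2 ^ D * (z : ℝ))) ≤ 2.75 * (2 * (2 ^ D * z + 2 ^ D * z)) := by
            gcongr
            linarith
        _ = _ := by ring
    have h5 : ((l1ball d Y).card : ℝ) ≤ (11 * 2 ^ D * z) ^ d := by
      refine h1.trans ?_
      gcongr
    have h6 : (2 : ℝ) ^ D ≤ (2 ^ D) ^ d := le_self_pow₀ h2D (by omega)
    have h7 : (2 : ℝ) ^ D * M * (l1ball d Y).card < (p : ℝ) ^ d := by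
      calc (2 : ℝ) ^ D * M * (l1ball d Y).card ≤ (2 ^ D) ^ d * ν ^ d * (11 * 2 ^ D * z) ^ d := by
            gcongr
            rw [hνd]; exact hMN
        _ = G ^ d := by
            rw [← mul_pow, ← mul_pow, hG, h42]; congr 1; ring
        _ < (p : ℝ) ^ d := by
            apply pow_lt_pow_left₀ hpG (by linarith) (by omega)
    exact_mod_cast h7
  obtain ⟨ω, hω⟩ := exists_omega p d Y (2 ^ D * M) hMp hcount
  obtain ⟨L, hL⟩ : ∃ L : ℕ, L = p / 2 ^ D := ⟨_, rfl⟩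
  have hLp : 2 ^ D * L ≤ p := by rw [hL]; exact Nat.mul_div_le _ _
  have hLp2 : p < 2 ^ D * L + 2 ^ D := by
    rw [hL]
    have := Nat.lt_mul_div_succ p (show 0 < 2 ^ D by positivity)
    rw [mul_add, mul_one] at this
    exact this
  have hLp' : (2 : ℝ) ^ D * L ≤ p := by exact_mod_cast hLp
  have hLp2' : (p : ℝ) < 2 ^ D * L + 2 ^ D := by exact_mod_cast hLp2
  have hpbig : 2 * (d * 2 ^ D) ≤ (p : ℝ) := by
    calc 2 * (d * (2 : ℝ) ^ D) ≤ 11 * (z * 4 ^ D) := by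
          rw [h42]
          have : (2 : ℝ) ^ D * 1 ≤ 2 ^ D * 2 ^ D := by gcongr
          rw [mul_one] at this
          gcongr
          norm_num
      _ ≤ _ := by linarith
  have h2Dd : (2 : ℝ) ^ D ≤ d * 2 ^ D := le_mul_of_one_le_left (by positivity) hd'
  have hLpos : 0 < L := by
    by_contra h0
    have : L = 0 := by omega
    rw [this] at hLp2'
    simp only [Nat.cast_zero, mul_zero, zero_add] at hLp2'
    linarith
  have hLlep : L ≤ p := by
    refine le_trans ?_ hLp
    exact Nat.le_mul_of_pos_left L (by positivity)
  obtain ⟨A0, hA0, hA0p, hA0c⟩ := rk_exists k (2 * D) (by omega) N₀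
  obtain ⟨μ, U, hU, hUμ⟩ := chebyshev d L hd hLpos
  obtain ⟨V0, hV0⟩ := exists_V0 U (fun x => ∑ i, ((x i : ℕ) : ℤ) ^ 2) μ
    (2 * Real.sqrt d * (L : ℝ) ^ 2) N₀ (by positivity) (by linarith) hUμ A0
    (fun a ha => (hA0 a ha).2) (4 ^ D) H (by positivity)
  set S := U.filter (fun x => ∃ a ∈ A0, ∃ h : ℕ, h < H ∧
    ∑ i, ((x i : ℕ) : ℤ) ^ 2 = V0 + a * (((4 ^ D : ℕ) : ℤ) * H) + h) with hS
  obtain ⟨α, hα⟩ := exists_alpha p d L M hLlep S ω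
  set A := (Finset.Icc 1 M).filter (fun n : ℕ => ∃ x ∈ S, ∀ i,
      (((x i : ℕ) : ℤ) : ZMod p) = n * ω i + α i) with hA
  have hAfree : ¬ HasProgression A k D := by
    apply progfree k D p H M d hD hk A0 hA0p V0 ((L : ℤ) - 1) ?_ (by omega) hHpos ω α ?_ A ?_
    · have h1 : (2 : ℤ) ^ D * L ≤ p := by exact_mod_cast hLp
      have h2 : (0 : ℤ) < 2 ^ D := by positivity
      linarith
    · intro m hm hm' u hu
      have h1 := hω m hm (by push_cast; exact hm') u hu
      by_contra! hcon
      have h2 : (∑ i, |u i|) ^ 2 ≤ d * ∑ i, |u i| ^ 2 := by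
        have := sq_sum_le_card_mul_sum_sq (s := (Finset.univ : Finset (Fin d))) (f := fun i => |u i|)
        simpa using this
      simp only [sq_abs] at h2
      have h3 : ((∑ i, (u i).natAbs : ℕ) : ℤ) = ∑ i, |u i| := by
        push_cast
        rfl
      have h4 : (Y : ℤ) < ∑ i, |u i| := by rw [← h3]; exact_mod_cast h1
      have h5 : (∑ i, |u i|) ^ 2 ≤ (Y : ℤ) ^ 2 := by
        refine h2.trans ?_
        calc (d : ℤ) * ∑ i, u i ^ 2 ≤ d * (4 ^ D * H) := by gcongr
          _ = (Y : ℤ) ^ 2 := by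
            rw [hY, hH]; push_cast
            rw [show (4 : ℤ) = 2 * 2 by norm_num, mul_pow]; ring
      have h6 : (0 : ℤ) ≤ Y := by positivity
      nlinarith
    · intro n hn
      rw [hA, Finset.mem_filter, Finset.mem_Icc] at hn
      obtain ⟨⟨_, hnM⟩, x, hx, hxe⟩ := hn
      rw [hS, Finset.mem_filter] at hx
      obtain ⟨_, a, ha, h, hh, hsum⟩ := hx
      refine ⟨hnM, fun i => ((x i : ℕ) : ℤ), fun i => ?_, hxe, a, ha, h, hh, ?_⟩
      · have := (x i).2
        beta_reduce
        constructor <;> omega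
      · rw [hsum]; push_cast; ring
  have hAr := le_rk k D N A (fun a ha => by
    rw [hA, Finset.mem_filter, Finset.mem_Icc] at ha
    refine ⟨ha.1.1, le_trans ?_ hMN⟩
    exact_mod_cast ha.1.2) hAfree
  -- final computation
  rw [← hA0c]
  have hAr' : (A.card : ℝ) ≤ rkDR k D N := by exact_mod_cast hAr
  have hνz : 0 < ν ^ 2 * (z : ℝ) ^ 2 := by positivity
  have hHr : (H : ℝ) = s * s * z ^ 2 := by rw [hH, hss]; push_cast; ring
  have hHN : N₀ * H = c0 * (s * (ν ^ 2 * z ^ 2)) := by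
    rw [hHr]; linear_combination (s * (z : ℝ) ^ 2) * hN₀s
  have hH1 : (1 : ℝ) ≤ H := by exact_mod_cast hHpos
  have hw : 0 < s * (ν ^ 2 * (z : ℝ) ^ 2) := by positivity
  have hrange : 2 * (2 * Real.sqrt d * (L : ℝ) ^ 2) + N₀ * (((4 ^ D : ℕ) : ℝ) * H) + H + 1 ≤
      E * (s * (ν ^ 2 * z ^ 2)) := by
    have hLle : (L : ℝ) ≤ 24 * 2 ^ D * ν * z := by
      have : (2 : ℝ) ^ D * L ≤ 2 ^ D * (24 * 2 ^ D * ν * z) := by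
        refine hLp'.trans (hpG2.trans (le_of_eq ?_))
        rw [h42]; ring
      exact le_of_mul_le_mul_left this (by positivity)
    have hL2 : (L : ℝ) ^ 2 ≤ 576 * 4 ^ D * (ν ^ 2 * z ^ 2) := by
      calc (L : ℝ) ^ 2 ≤ (24 * 2 ^ D * ν * z) ^ 2 := by gcongr
        _ = _ := by rw [h42]; ring
    have t1 : 2 * (2 * Real.sqrt d * (L : ℝ) ^ 2) ≤ 2304 * 4 ^ D * (s * (ν ^ 2 * z ^ 2)) := by
      calc 2 * (2 * Real.sqrt d * (L : ℝ) ^ 2) ≤ 2 * (2 * s * (576 * 4 ^ D * (ν ^ 2 * z ^ 2))) := by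
            rw [← hs]; gcongr
        _ = _ := by ring
    have t2 : N₀ * H ≤ 2 * (s * (ν ^ 2 * z ^ 2)) := by rw [hHN]; gcongr
    have t3 : N₀ * (((4 ^ D : ℕ) : ℝ) * H) ≤ 2 * 4 ^ D * (s * (ν ^ 2 * z ^ 2)) := by
      push_cast
      calc N₀ * ((4 : ℝ) ^ D * H) = 4 ^ D * (N₀ * H) := by ring
        _ ≤ 4 ^ D * (2 * (s * (ν ^ 2 * z ^ 2))) := by gcongr
        _ = _ := by ring
    have t4 : (H : ℝ) ≤ N₀ * H := by nlinarith
    have t5 : 2 * (s * (ν ^ 2 * (z : ℝ) ^ 2)) ≤ 2 * 4 ^ D * (s * (ν ^ 2 * z ^ 2)) := by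
      gcongr
      linarith
    have t6 : E * (s * (ν ^ 2 * (z : ℝ) ^ 2)) = 2310 * 4 ^ D * (s * (ν ^ 2 * z ^ 2)) := by rw [hE]
    linarith
  have hN₀pos : 0 < N₀ := by linarith
  have hSlow : 3 / 4 * (L : ℝ) ^ d * A0.card * c0 ≤ S.card * (E * N₀) := by
    have h1 : 3 / 4 * (L : ℝ) ^ d * (A0.card * H) ≤ S.card * (E * (s * (ν ^ 2 * z ^ 2))) := by
      calc 3 / 4 * (L : ℝ) ^ d * (A0.card * H) ≤ U.card * (A0.card * H) := by gcongr
        _ ≤ _ := by push_cast at hV0 ⊢; exact hV0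
        _ ≤ _ := by
          push_cast at hrange
          gcongr
    have h2 : (3 / 4 * (L : ℝ) ^ d * A0.card * c0) * (s * (ν ^ 2 * z ^ 2)) ≤
        (S.card * (E * N₀)) * (s * (ν ^ 2 * z ^ 2)) := by
      calc _ = N₀ * (3 / 4 * (L : ℝ) ^ d * (A0.card * H)) := by
            linear_combination (-(3 / 4 * (L : ℝ) ^ d * A0.card)) * hHN
        _ ≤ N₀ * (S.card * (E * (s * (ν ^ 2 * z ^ 2)))) := by gcongr
        _ = _ := by ring
    exact le_of_mul_le_mul_right h2 hw
  have hLratio : (p : ℝ) ^ d ≤ 2 * ((2 ^ D) ^ d * (L : ℝ) ^ d) := by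
    have hb := one_add_mul_le_pow (a := -((2 : ℝ) ^ D / p)) (by
      have : (2 : ℝ) ^ D / p ≤ 1 := by
        rw [div_le_one hppos]; linarith
      linarith) d
    have h1 : (d : ℝ) * (2 ^ D / p) ≤ 1 / 2 := by
      rw [← mul_div_assoc, div_le_iff₀ hppos]; linarith
    have h2 : (1 : ℝ) / 2 ≤ (1 + -((2 : ℝ) ^ D / p)) ^ d := by linarith
    have h3 : (p : ℝ) * (1 + -((2 : ℝ) ^ D / p)) = p - 2 ^ D := by field_simp; ring
    have h5 : (2 : ℝ) ^ D ≤ p := by linarith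
    have h4 : (p : ℝ) ^ d * (1 / 2) ≤ (2 ^ D * L) ^ d := by
      calc (p : ℝ) ^ d * (1 / 2) ≤ (p : ℝ) ^ d * (1 + -((2 : ℝ) ^ D / p)) ^ d := by gcongr
        _ = (p - 2 ^ D) ^ d := by rw [← mul_pow, h3]
        _ ≤ _ := by
          apply pow_le_pow_left₀ <;> linarith
    rw [mul_pow] at h4
    linarith
  have h2z : (2 : ℝ) ^ (-((d * D : ℕ) : ℤ)) = ((2 ^ D) ^ d)⁻¹ := by
    rw [zpow_neg, zpow_natCast, ← pow_mul, mul_comm d D]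
  rw [h2z, ge_iff_le]
  set P2 : ℝ := (2 ^ D) ^ d with hP2
  have hP2pos : 0 < P2 := by positivity
  have hLd : 0 < (L : ℝ) ^ d := by positivity
  have hNpos : 0 < N := by linarith
  have hfin : 3 * c0 * A0.card * N ≤ rkDR k D N * (16 * E * P2 * N₀) := by
    have h1 : N / 2 * S.card ≤ rkDR k D N * (2 * (P2 * (L : ℝ) ^ d)) := by
      calc N / 2 * S.card ≤ M * S.card := by gcongr
        _ ≤ A.card * (p : ℝ) ^ d := hα
        _ ≤ _ := by gcongr
    have h2 : (3 * c0 * A0.card * N) * (L : ℝ) ^ d ≤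
        (rkDR k D N * (16 * E * P2 * N₀)) * (L : ℝ) ^ d := by
      calc _ = 4 * N * (3 / 4 * (L : ℝ) ^ d * A0.card * c0) := by ring
        _ ≤ 4 * N * (S.card * (E * N₀)) := by gcongr
        _ = 8 * (E * N₀) * (N / 2 * S.card) := by ring
        _ ≤ 8 * (E * N₀) * (rkDR k D N * (2 * (P2 * (L : ℝ) ^ d))) := by gcongr
        _ = _ := by ring
    exact le_of_mul_le_mul_right h2 hLd
  rw [le_div_iff₀ hNpos]
  calc 3 * c0 / (16 * E) * P2⁻¹ * (A0.card / N₀) * N =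
      (3 * c0 * A0.card * N) / (16 * E * P2 * N₀) := by field_simp
    _ ≤ _ := by rw [div_le_iff₀ (by positivity)]; exact hfin
end
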